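/- Assume the blow-up framework with T_i → ∞: for each i ∈ ℕ, K_i satisfies (K1) with constant C₀, (K2) with constant Λ and (K3), with K_i(x_i) → n(n−2); c_i : ∂'B₁⁺ → ℝ with |c_i| ≤ Λ; u_i is a positive solution of the boundary Yamabe system on B₁⁺ with coefficients (K_i, c_i); x_i ∈ cl(ℝⁿ₊) ∩ B(0,1/2) is a selected local maximum point, i.e. M_i := u_i(x_i), Γ_i := M_i^{2/(n−2)}, there is σ_i → 0 with u_i(x_i) ≥ u_i on B(x_i,σ_i) ∩ ℝⁿ₊ and Γ_i·σ_i → ∞, and u_i(x_i) · (min over cl(B_{2/3}⁺) of u_i) > i; moreover T_i := x_{i,n}·Γ_i → ∞ and the rescalings v̄_i(y) = M_i^{−1}·u_i(x_i + Γ_i^{−1}y) converge in C²_loc(ℝⁿ) to U(y) = (1+|y|²)^{−(n−2)/2}. Then lim inf over i of ‖∇K_i(x_i)‖ = 0, i.e. there is a subsequence along which ‖∇K_i(x_i)‖ → 0. -/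

import Mathlib

open Metric Set MeasureTheory Filter Topology

noncomputable section

abbrev Euc (n : ℕ) := EuclideanSpace ℝ (Fin n)

/-- Index of the last coordinate. -/
def lastIdx (n : ℕ) (h0 : 0 < n) : Fin n := ⟨n - 1, by omega⟩

/-- The open upper half-space `ℝⁿ₊ = {x : xₙ > 0}`. -/
def upperHalf (n : ℕ) (h0 : 0 < n) : Set (Euc n) := {x | 0 < x (lastIdx n h0)}

/-- The upper half-ball `B_r⁺ = B(0,r) ∩ ℝⁿ₊`. -/
def halfBall (n : ℕ) (h0 : 0 < n) (r : ℝ) : Set (Euc n) :=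
  Metric.ball (0 : Euc n) r ∩ upperHalf n h0

/-- The flat boundary portion `∂'B_r⁺ = B(0,r) ∩ {xₙ = 0}`. -/
def flatBdry (n : ℕ) (h0 : 0 < n) (r : ℝ) : Set (Euc n) :=
  Metric.ball (0 : Euc n) r ∩ {x | x (lastIdx n h0) = 0}

/-- Laplacian (within a set `s`) as the sum of pure second partial derivatives. -/
def lapWithin (n : ℕ) (s : Set (Euc n)) (u : Euc n → ℝ) (x : Euc n) : ℝ :=
  ∑ i : Fin n, iteratedFDerivWithin ℝ 2 u s x
    ![EuclideanSpace.single i (1 : ℝ), EuclideanSpace.single i (1 : ℝ)]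

/-- Normal derivative `∂u/∂xₙ` (within a set `s`). -/
def normalDerivWithin (n : ℕ) (h0 : 0 < n) (s : Set (Euc n)) (u : Euc n → ℝ) (x : Euc n) : ℝ :=
  fderivWithin ℝ u s x (EuclideanSpace.single (lastIdx n h0) (1 : ℝ))

/-- Positive solution of the boundary Yamabe system on `B₁⁺` with coefficients `(K, c)`. -/
def IsYamabeSol (n : ℕ) (h0 : 0 < n) (K c u : Euc n → ℝ) : Prop :=
  ContDiffOn ℝ 2 u (closure (halfBall n h0 1)) ∧
  (∀ x ∈ closure (halfBall n h0 1), 0 < u x) ∧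
  (∀ x ∈ halfBall n h0 1,
    lapWithin n (closure (halfBall n h0 1)) u x
      + K x * u x ^ (((n : ℝ) + 2) / ((n : ℝ) - 2)) = 0) ∧
  (∀ x ∈ flatBdry n h0 1,
    normalDerivWithin n h0 (closure (halfBall n h0 1)) u x
      = c x * u x ^ ((n : ℝ) / ((n : ℝ) - 2)))

/-- Condition (K1) with constant `C₀`. -/
def CondK1 (n : ℕ) (h0 : 0 < n) (C₀ : ℝ) (K : Euc n → ℝ) : Prop :=
  ContDiffOn ℝ (n - 2 : ℕ) K (closure (halfBall n h0 1)) ∧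
  ∀ x ∈ closure (halfBall n h0 1), ∀ j : ℕ, 1 ≤ j → j ≤ n - 2 →
    ‖iteratedFDerivWithin ℝ j K (closure (halfBall n h0 1)) x‖ ≤
      C₀ * ‖iteratedFDerivWithin ℝ 1 K (closure (halfBall n h0 1)) x‖ ^
        (((n : ℝ) - 2 - (j : ℝ)) / ((n : ℝ) - 3))

/-- Condition (K2) with constant `Λ`. -/
def CondK2 (n : ℕ) (h0 : 0 < n) (Λ : ℝ) (K : Euc n → ℝ) : Prop :=
  ∀ x ∈ closure (halfBall n h0 1),
    1 / Λ ≤ K x ∧ ∀ j : ℕ, 1 ≤ j → j ≤ n - 2 →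
      ‖iteratedFDerivWithin ℝ j K (closure (halfBall n h0 1)) x‖ ≤ Λ

/-- Condition (K3): `K` depends only on the first `n - 1` coordinates. -/
def CondK3 (n : ℕ) (h0 : 0 < n) (K : Euc n → ℝ) : Prop :=
  ∀ x ∈ closure (halfBall n h0 1), ∀ y ∈ closure (halfBall n h0 1),
    (∀ i : Fin n, i ≠ lastIdx n h0 → x i = y i) → K x = K y

/-- `C²_loc` convergence of `v i` to `U` on the region `D`: uniform convergence of the
functions and their first and second derivatives on every compact subset of `D`. -/
def TendstoC2LocOn (n : ℕ) (v : ℕ → Euc n → ℝ) (U : Euc n → ℝ) (D : Set (Euc n)) : Prop :=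
  ∀ s : Set (Euc n), IsCompact s → s ⊆ D →
    TendstoUniformlyOn (fun i => v i) U Filter.atTop s ∧
    TendstoUniformlyOn (fun i y => fderivWithin ℝ (v i) D y)
      (fun y => fderivWithin ℝ U D y) Filter.atTop s ∧
    TendstoUniformlyOn (fun i y => iteratedFDerivWithin ℝ 2 (v i) D y)
      (fun y => iteratedFDerivWithin ℝ 2 U D y) Filter.atTop s

open scoped RealInnerProductSpace

/-- `F` is twice differentiable at `x`, with gradient `g` and Laplacian `L`. -/
def HasLap {n : ℕ} (F : Euc n → ℝ) (x g : Euc n) (L : ℝ) : Prop :=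
  ∃ (F' : Euc n → Euc n →L[ℝ] ℝ) (B : Euc n →L[ℝ] Euc n →L[ℝ] ℝ),
    (∀ᶠ y in 𝓝 x, HasFDerivAt F (F' y) y) ∧ HasFDerivAt F' B x ∧ F' x = innerSL ℝ g ∧
      ∑ j, B (EuclideanSpace.single j 1) (EuclideanSpace.single j 1) = L

namespace HasLap

variable {n : ℕ} {F G : Euc n → ℝ} {x g g' : Euc n} {L L' : ℝ}

lemma sum_inner_single (a b : Euc n) :
    ∑ j, ⟪a, EuclideanSpace.single j (1 : ℝ)⟫ * ⟪b, EuclideanSpace.single j (1 : ℝ)⟫ = ⟪a, b⟫ := by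
  simp [PiLp.inner_apply, mul_comm]

lemma hasFDerivAt (h : HasLap F x g L) : HasFDerivAt F (innerSL ℝ g) x := by
  obtain ⟨F', B, h1, -, h3, -⟩ := h
  exact h3 ▸ h1.self_of_nhds

lemma congr (h : HasLap F x g L) (hg : g = g') (hL : L = L') : HasLap F x g' L' := hg ▸ hL ▸ h

lemma of_contDiffAt (h : ContDiffAt ℝ 2 F x) :
    HasLap F x ((InnerProductSpace.toDual ℝ (Euc n)).symm (fderiv ℝ F x))
      (∑ j, fderiv ℝ (fderiv ℝ F) x (EuclideanSpace.single j 1) (EuclideanSpace.single j 1)) := by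
  refine ⟨fderiv ℝ F, fderiv ℝ (fderiv ℝ F) x, ?_, ?_, ?_, rfl⟩
  · filter_upwards [h.eventually (by simp)] with y hy
    exact (hy.differentiableAt (by simp)).hasFDerivAt
  · exact ((h.fderiv_right (m := 1) (by norm_num)).differentiableAt (by simp)).hasFDerivAt
  · ext w
    simp [InnerProductSpace.toDual_symm_apply]

lemma const (a : ℝ) (x : Euc n) : HasLap (fun _ => a) x 0 0 :=
  ⟨fun _ => 0, 0, .of_forall fun y => hasFDerivAt_const a y, hasFDerivAt_const _ x, by simp,
    by simp⟩

lemma inner_left (e x : Euc n) : HasLap (fun y => ⟪e, y⟫) x e 0 :=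
  ⟨fun _ => innerSL ℝ e, 0, .of_forall fun y => (innerSL ℝ e).hasFDerivAt, hasFDerivAt_const _ x,
    rfl, by simp⟩

lemma add (hF : HasLap F x g L) (hG : HasLap G x g' L') :
    HasLap (fun y => F y + G y) x (g + g') (L + L') := by
  obtain ⟨F', B, h1, h2, h3, h4⟩ := hF
  obtain ⟨G', C, k1, k2, k3, k4⟩ := hG
  refine ⟨fun y => F' y + G' y, B + C, ?_, h2.add k2, by simp [h3, k3], ?_⟩
  · filter_upwards [h1, k1] with y a b using a.add b
  · simp [Finset.sum_add_distrib, h4, k4]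

lemma mul (hF : HasLap F x g L) (hG : HasLap G x g' L') :
    HasLap (fun y => F y * G y) x (F x • g' + G x • g) (F x * L' + G x * L + 2 * ⟪g, g'⟫) := by
  obtain ⟨F', B, h1, h2, h3, h4⟩ := hF
  obtain ⟨G', C, k1, k2, k3, k4⟩ := hG
  refine ⟨fun y => F y • G' y + G y • F' y, _, ?_,
    (h1.self_of_nhds.smul k2).add (k1.self_of_nhds.smul h2), by simp [h3, k3], ?_⟩
  · filter_upwards [h1, k1] with y a b using a.mul b
  · simp only [h3, k3, ← h4, ← k4, ← sum_inner_single g g', Finset.mul_sum,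
      ← Finset.sum_add_distrib]
    refine Finset.sum_congr rfl fun j _ => ?_
    simp
    ring

lemma const_mul (a : ℝ) (hF : HasLap F x g L) : HasLap (fun y => a * F y) x (a • g) (a * L) :=
  ((const a x).mul hF).congr (by simp) (by simp)

lemma sub (hF : HasLap F x g L) (hG : HasLap G x g' L') :
    HasLap (fun y => F y - G y) x (g - g') (L - L') := by
  have := hF.add (hG.const_mul (-1))
  simpa [sub_eq_add_neg] using this

lemma comp {ψ ψ' : ℝ → ℝ} {c : ℝ} (hF : HasLap F x g L)
    (h1 : ∀ᶠ t in 𝓝 (F x), HasDerivAt ψ (ψ' t) t) (h2 : HasDerivAt ψ' c (F x)) :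
    HasLap (fun y => ψ (F y)) x (ψ' (F x) • g) (ψ' (F x) * L + c * ⟪g, g⟫) := by
  obtain ⟨F', B, k1, k2, k3, k4⟩ := hF
  have hF1 := k1.self_of_nhds
  refine ⟨fun y => ψ' (F y) • F' y, _, ?_,
    (h2.comp_hasFDerivAt x hF1).smul k2, by simp [k3], ?_⟩
  · filter_upwards [k1, hF1.continuousAt.eventually h1] with y a b
    exact b.comp_hasFDerivAt y a
  · simp only [k3, ← k4, ← sum_inner_single g g, Finset.mul_sum, ← Finset.sum_add_distrib]
    refine Finset.sum_congr rfl fun j _ => ?_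
    simp
    ring

lemma norm_sq (x : Euc n) : HasLap (fun y => ‖y‖ ^ 2) x ((2 : ℝ) • x) (2 * n) := by
  refine ⟨fun y => (2 : ℝ) • innerSL ℝ y, (2 : ℝ) • (innerSL ℝ : Euc n →L[ℝ] _),
    .of_forall fun y => ?_, ?_, by simp, ?_⟩
  · have := (hasStrictFDerivAt_norm_sq y).hasFDerivAt
    refine this.congr_fderiv ?_
    ext w
    simp
  · exact ((2 : ℝ) • (innerSL ℝ : Euc n →L[ℝ] _)).hasFDerivAt
  · have : ∀ j : Fin n, ((2 : ℝ) • (innerSL ℝ : Euc n →L[ℝ] _)) (EuclideanSpace.single j 1)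
        (EuclideanSpace.single j 1) = 2 := fun j => by
      change (2 : ℝ) • ⟪EuclideanSpace.single j (1 : ℝ), EuclideanSpace.single j 1⟫ = 2
      simp
    rw [Finset.sum_congr rfl fun j _ => this j]
    simp [mul_comm]

lemma comp_smul {m : Euc n → ℝ} {γ : Euc n} {Lm : ℝ} (hm : HasLap m x g Lm)
    (hF : HasLap F (m x • x) γ L) (hx : x ≠ 0) (hg : g = (-(2 * m x / ‖x‖ ^ 2)) • x) :
    HasLap (fun y => F (m y • y)) x (m x • γ + ⟪γ, x⟫ • g)
      (m x ^ 2 * L + 2 * ⟪γ, g⟫ + Lm * ⟪γ, x⟫) := by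
  obtain ⟨m', M, h1, h2, h3, h4⟩ := hm
  obtain ⟨F', B, k1, k2, k3, k4⟩ := hF
  have hΦ : ∀ y, HasFDerivAt m (m' y) y →
      HasFDerivAt (fun y => m y • y) (m y • ContinuousLinearMap.id ℝ (Euc n) +
        (m' y).smulRight y) y := fun y hy => hy.smul (hasFDerivAt_id y)
  have hΦx := hΦ x h1.self_of_nhds
  have hm1 := h1.self_of_nhds
  have kc := HasFDerivAt.comp (g := F') (f := fun y => m y • y) x k2 hΦx
  refine ⟨fun y => m y • F' (m y • y) + (F' (m y • y) y) • m' y, _, ?_,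
    (hm1.smul kc).add ((kc.clm_apply (hasFDerivAt_id x)).smul h2), ?_, ?_⟩
  · filter_upwards [h1, hΦx.continuousAt.eventually k1] with y a b
    have kb := HasFDerivAt.comp (g := F) (f := fun y => m y • y) y b (hΦ y a)
    refine kb.congr_fderiv ?_
    ext w
    simp
    ring
  · simp [k3, h3]
  · have hx2 : ‖x‖ ^ 2 ≠ 0 := by simpa using hx
    have expand : ∀ (A : Euc n →L[ℝ] Euc n →L[ℝ] ℝ) (v w : Euc n),
        ∑ j, A v (EuclideanSpace.single j 1) * w j = A v w := by
      intro A v w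
      conv_rhs => rw [← (EuclideanSpace.basisFun (Fin n) ℝ).sum_repr w]
      simp [mul_comm]
    have expand2 : ∀ (A : Euc n →L[ℝ] Euc n →L[ℝ] ℝ) (v w : Euc n),
        ∑ j, A (EuclideanSpace.single j 1) v * w j = A w v := by
      intro A v w
      exact expand A.flip v w
    have e3 := sum_inner_single γ g
    have e4 := sum_inner_single γ x
    have e5 := sum_inner_single x x
    simp only [EuclideanSpace.inner_single_right, one_mul, conj_trivial] at e3 e4 e5
    have e1 := expand B x x
    have e2 := expand2 B x x
    have hc := hg
    set c := -(2 * m x / ‖x‖ ^ 2) with hcdef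
    have hgj : ∀ j, g j = c * x j := fun j => by rw [hg]; simp
    calc _ = ∑ j, (m x ^ 2 * B (EuclideanSpace.single j 1) (EuclideanSpace.single j 1)
          + (m x * c) * (B x (EuclideanSpace.single j 1) * x j)
          + (m x * c) * (B (EuclideanSpace.single j 1) x * x j)
          + (c ^ 2 * B x x) * (x j * x j) + 2 * (γ j * g j)
          + ⟪γ, x⟫ * M (EuclideanSpace.single j 1) (EuclideanSpace.single j 1)) := by
          refine Finset.sum_congr rfl fun j _ => ?_
          simp [k3, h3, EuclideanSpace.inner_single_right, hgj]
          ring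
      _ = m x ^ 2 * L + (m x * c) * B x x + (m x * c) * B x x + (c ^ 2 * B x x) * ⟪x, x⟫
          + 2 * ⟪γ, g⟫ + ⟪γ, x⟫ * Lm := by
          simp only [Finset.sum_add_distrib, ← Finset.mul_sum, e1, e2, e3, e5, k4, h4]
      _ = _ := by
          rw [real_inner_self_eq_norm_sq, hcdef]
          field_simp
          ring

lemma nonneg_of_isLocalMin (hF : HasLap F x g L) (hmin : IsLocalMin F x) : 0 ≤ L := by
  obtain ⟨F', B, h1, h2, h3, h4⟩ := hF
  rw [← h4]
  refine Finset.sum_nonneg fun j _ => ?_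
  by_contra! hneg
  set b : Euc n := EuclideanSpace.single j 1
  have hline : ∀ t : ℝ, HasDerivAt (fun t : ℝ => x + t • b) b t := fun t => by
    simpa using ((hasDerivAt_id t).smul_const b).const_add x
  have h0 : x + (0 : ℝ) • b = x := by simp
  have hcont : Tendsto (fun t : ℝ => x + t • b) (𝓝 0) (𝓝 x) := by
    have := (hline 0).continuousAt.tendsto
    rwa [h0] at this
  have d1 : ∀ᶠ t in 𝓝 (0 : ℝ), HasDerivAt (fun t => F (x + t • b)) (F' (x + t • b) b) t := by
    filter_upwards [hcont.eventually h1] with t ht using ht.comp_hasDerivAt t (hline t)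
  have d1' : deriv (fun t => F (x + t • b)) =ᶠ[𝓝 (0 : ℝ)] fun t => F' (x + t • b) b := by
    filter_upwards [d1] with t ht using ht.deriv
  have d2 : HasDerivAt (fun t : ℝ => F' (x + t • b) b) (B b b) 0 := by
    have := (HasFDerivAt.comp_hasDerivAt (x := (0:ℝ)) (f := fun t : ℝ => x + t • b)
      (l := F') (by rw [h0]; exact h2) (hline 0))
    exact ((ContinuousLinearMap.apply ℝ ℝ b).hasFDerivAt.comp_hasDerivAt _ this)
  have hlm : IsLocalMin (fun t : ℝ => F (x + t • b)) 0 := by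
    have := hcont.eventually hmin
    simpa [IsLocalMin, IsMinFilter] using this
  have hmax := isLocalMax_of_deriv_deriv_neg (f := fun t : ℝ => F (x + t • b)) (x₀ := 0)
    (by rw [d1'.deriv_eq, d2.deriv]; exact hneg) hlm.deriv_eq_zero
    d1.self_of_nhds.continuousAt
  have hconst : (fun t : ℝ => F (x + t • b)) =ᶠ[𝓝 (0 : ℝ)] fun _ => F x := by
    filter_upwards [hlm, hmax] with t a c
    simp only [h0] at a c
    exact le_antisymm c a
  have : deriv (fun t => F (x + t • b)) =ᶠ[𝓝 (0 : ℝ)] fun _ => 0 := by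
    simpa using hconst.deriv
  have h6 := (d1'.symm.trans this).deriv_eq
  rw [d2.deriv] at h6
  simp at h6
  linarith

end HasLap

section Kelvin

variable {n : ℕ}

/-- The Kelvin transform of `V` in the sphere of radius `l` about the origin. -/
def kelvin (μ l : ℝ) (V : Euc n → ℝ) (z : Euc n) : ℝ :=
  (l ^ 2 * (‖z‖ ^ 2)⁻¹) ^ μ * V ((l ^ 2 * (‖z‖ ^ 2)⁻¹) • z)

lemma hasLap_inv_norm_sq (l : ℝ) {z : Euc n} (hz : z ≠ 0) :
    HasLap (fun y => l ^ 2 * (‖y‖ ^ 2)⁻¹) z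
      (-(2 * (l ^ 2 * (‖z‖ ^ 2)⁻¹) / ‖z‖ ^ 2) • z)
      ((l ^ 2 * (‖z‖ ^ 2)⁻¹) / ‖z‖ ^ 2 * (8 - 2 * n)) := by
  have hz2 : ‖z‖ ^ 2 ≠ 0 := by simpa using hz
  have h1 : ∀ᶠ t in 𝓝 (‖z‖ ^ 2), HasDerivAt (fun t : ℝ => t⁻¹) (-(t ^ 2)⁻¹) t := by
    filter_upwards [isOpen_ne.mem_nhds hz2] with t ht using hasDerivAt_inv ht
  have h2 : HasDerivAt (fun t : ℝ => -(t ^ 2)⁻¹) (2 * ((‖z‖ ^ 2) ^ 3)⁻¹) (‖z‖ ^ 2) := by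
    refine ((hasDerivAt_pow 2 (‖z‖ ^ 2)).inv (by positivity)).neg.congr_deriv ?_
    field_simp
    norm_num
    ring
  refine (((HasLap.norm_sq z).comp h1 h2).const_mul (l ^ 2)).congr ?_ ?_
  · rw [smul_smul, smul_smul]
    congr 1
    field_simp
  · rw [inner_smul_left, inner_smul_right, real_inner_self_eq_norm_sq]
    simp only [conj_trivial]
    field_simp
    ring

lemma hasLap_kelvin {μ l : ℝ} (hμ : μ = ((n : ℝ) - 2) / 2) (hl : 0 < l) {V : Euc n → ℝ}
    {z γ : Euc n} {L : ℝ} (hz : z ≠ 0)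
    (hV : HasLap V ((l ^ 2 * (‖z‖ ^ 2)⁻¹) • z) γ L) :
    HasLap (kelvin μ l V) z
      ((l ^ 2 * (‖z‖ ^ 2)⁻¹) ^ μ • ((l ^ 2 * (‖z‖ ^ 2)⁻¹) • γ
          - (2 * (l ^ 2 * (‖z‖ ^ 2)⁻¹) * ⟪γ, z⟫ / ‖z‖ ^ 2) • z)
        - (2 * μ * kelvin μ l V z / ‖z‖ ^ 2) • z)
      ((l ^ 2 * (‖z‖ ^ 2)⁻¹) ^ (μ + 2) * L) := by
  have hz2 : 0 < ‖z‖ ^ 2 := by positivity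
  have hm := hasLap_inv_norm_sq l hz
  have hm0 : 0 < l ^ 2 * (‖z‖ ^ 2)⁻¹ := by positivity
  have h1 : ∀ᶠ t in 𝓝 (l ^ 2 * (‖z‖ ^ 2)⁻¹),
      HasDerivAt (fun t : ℝ => t ^ μ) (μ * t ^ (μ - 1)) t := by
    filter_upwards [lt_mem_nhds hm0] with t ht using Real.hasDerivAt_rpow_const (.inl ht.ne')
  have h2 : HasDerivAt (fun t : ℝ => μ * t ^ (μ - 1))
      (μ * ((μ - 1) * (l ^ 2 * (‖z‖ ^ 2)⁻¹) ^ (μ - 1 - 1))) (l ^ 2 * (‖z‖ ^ 2)⁻¹) :=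
    (Real.hasDerivAt_rpow_const (.inl hm0.ne')).const_mul _
  refine ((hm.comp h1 h2).mul (hm.comp_smul hV hz rfl)).congr ?_ ?_
  · simp only [kelvin]
    set m := l ^ 2 * (‖z‖ ^ 2)⁻¹
    rw [Real.rpow_sub_one hm0.ne']
    match_scalars
    · ring
    · field_simp
      ring
  · simp only [inner_smul_left, inner_smul_right, inner_add_right, real_inner_self_eq_norm_sq,
      conj_trivial, real_inner_comm γ z]
    set m := l ^ 2 * (‖z‖ ^ 2)⁻¹
    simp only [Real.rpow_sub_one hm0.ne']
    rw [show m ^ (μ + 2) = m ^ μ * m ^ 2 by rw [Real.rpow_add hm0]; norm_num]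
    have hn : (n : ℝ) = 2 * μ + 2 := by rw [hμ]; ring
    rw [hn]
    field_simp
    ring

end Kelvin

section Barrier

variable {n : ℕ}

/-- The conformal factor of the bubble attached to the sphere of radius `l`. -/
def bubBase (l : ℝ) (e z : Euc n) : ℝ := ‖z‖ ^ 2 + l ^ 2 - 24 / 13 * l * ⟪e, z⟫

/-- The auxiliary function compensating the wrong sign of the curvature term. -/
def barrier (μ l : ℝ) (e z : Euc n) : ℝ :=
  (7 / (4 * (n : ℝ))) * ((‖z‖ ^ 2 - l ^ 2) * bubBase l e z ^ (-(μ + 1)) *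
    ((⟪e, z⟫ + ‖z‖) * (‖z‖ ^ 2 + l ^ 2)⁻¹))

lemma abs_inner_le {e : Euc n} (he : ‖e‖ = 1) (z : Euc n) : |⟪e, z⟫| ≤ ‖z‖ := by
  simpa [he] using abs_real_inner_le_norm e z

lemma bubBase_ge {l : ℝ} (hl : 0 < l) {e : Euc n} (he : ‖e‖ = 1) (z : Euc n) :
    (‖z‖ ^ 2 + l ^ 2) / 13 ≤ bubBase l e z := by
  have := abs_le.1 (abs_inner_le he z)
  unfold bubBase
  nlinarith [sq_nonneg (‖z‖ - l), mul_le_mul_of_nonneg_left this.2 hl.le]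

lemma bubBase_pos {l : ℝ} (hl : 0 < l) {e : Euc n} (he : ‖e‖ = 1) (z : Euc n) :
    0 < bubBase l e z :=
  lt_of_lt_of_le (by positivity) (bubBase_ge hl he z)

lemma barrier_poly {q c N : ℝ} (hN : 4 ≤ N) (hq0 : 0 ≤ q) (hq1 : q ≤ 1) (hc0 : -1 ≤ c)
    (hc1 : c ≤ 1) :
    1 / 5 ≤ 7 / 4 * ((1 - q ^ 2) * (c + 1) + 12 / 13 * q - c
      - (1 - 12 / 13 * c * q) * (1 + 2 * (c + 1) * q ^ 2) / N) + c := by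
  have h4 : 1 / 5 ≤ 7 / 4 * ((1 - q ^ 2) * (c + 1) + 12 / 13 * q - c
      - (1 - 12 / 13 * c * q) * (1 + 2 * (c + 1) * q ^ 2) / 4) + c := by
    nlinarith [mul_nonneg hq0 (sub_nonneg.2 hq1),
      mul_nonneg (sub_nonneg.2 hc0) (sub_nonneg.2 hc1),
      mul_nonneg (pow_nonneg hq0 2) (sub_nonneg.2 hq1),
      mul_nonneg (mul_nonneg hq0 (sub_nonneg.2 hq1)) (sub_nonneg.2 hc1),
      mul_nonneg (mul_nonneg hq0 (sub_nonneg.2 hq1)) (sub_nonneg.2 hc0),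
      mul_nonneg (sub_nonneg.2 hq1) (sub_nonneg.2 hc0),
      mul_nonneg (sub_nonneg.2 hq1) (sub_nonneg.2 hc1), mul_nonneg hq0 (sub_nonneg.2 hc1),
      mul_nonneg hq0 (sub_nonneg.2 hc0), mul_nonneg (pow_nonneg hq0 3) (sq_nonneg (c + 1 / 2)),
      mul_nonneg (pow_nonneg hq0 3) (sq_nonneg (c - 1 / 2)), sq_nonneg (q * (c + 1 / 2)),
      sq_nonneg (q - 1)]
  have hcq : c * q ≤ 1 := by nlinarith
  have hA : 0 ≤ (1 - 12 / 13 * c * q) * (1 + 2 * (c + 1) * q ^ 2) := by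
    refine mul_nonneg (by nlinarith) ?_
    have : 0 ≤ (c + 1) * q ^ 2 := mul_nonneg (by linarith) (by positivity)
    linarith
  have := div_le_div_of_nonneg_left hA (by norm_num) hN
  linarith

lemma hasLap_barrier {μ l : ℝ} (hμ : μ = ((n : ℝ) - 2) / 2) (hn : 4 ≤ n) (hl : 0 < l)
    {e z : Euc n} (he : ‖e‖ = 1) (hz : l ≤ ‖z‖) :
    ∃ g L, HasLap (barrier μ l e) z g L ∧
      ‖g‖ ≤ 1000 * (μ + 2) * bubBase l e z ^ (-(μ + 1)) ∧
      1 / 5 * ((‖z‖ ^ 2 - l ^ 2) / ‖z‖ * bubBase l e z ^ (-(μ + 2)))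
        ≤ L + n * (n + 2) * (25 / 169 * l ^ 2) * (bubBase l e z ^ 2)⁻¹ * barrier μ l e z
          + ⟪e, z⟫ * ((‖z‖ ^ 2 - l ^ 2) / ‖z‖ ^ 2) * bubBase l e z ^ (-(μ + 2)) := by
  have hr : 0 < ‖z‖ := hl.trans_le hz
  have hz0 : z ≠ 0 := norm_pos_iff.1 hr
  have hs := bubBase_pos hl he z
  have hsge := bubBase_ge hl he z
  have hn4 : (4 : ℝ) ≤ n := by exact_mod_cast hn
  have jr2 := HasLap.norm_sq z
  have jD := jr2.sub (HasLap.const (l ^ 2) z)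
  have jw := HasLap.inner_left e z
  have js : HasLap (bubBase l e) z _ _ :=
    (jr2.add (HasLap.const (l ^ 2) z)).sub (jw.const_mul (24 / 13 * l))
  set s := bubBase l e z with hsdef
  have jS := js.comp (ψ := fun t => t ^ (-(μ + 1))) (ψ' := fun t => -(μ + 1) * t ^ (-(μ + 1) - 1))
    (c := -(μ + 1) * ((-(μ + 1) - 1) * s ^ (-(μ + 1) - 1 - 1)))
    (by filter_upwards [lt_mem_nhds hs] with t ht using
          Real.hasDerivAt_rpow_const (.inl ht.ne'))
    ((Real.hasDerivAt_rpow_const (.inl hs.ne')).const_mul _)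
  have jr : HasLap (fun y : Euc n => ‖y‖) z (‖z‖⁻¹ • z) (((n : ℝ) - 1) / ‖z‖) := by
    have hz2 : 0 < ‖z‖ ^ 2 := by positivity
    have := jr2.comp (ψ := Real.sqrt) (ψ' := fun t => 1 / (2 * Real.sqrt t))
      (c := -1 / (4 * ‖z‖ ^ 3))
      (by filter_upwards [lt_mem_nhds hz2] with t ht using Real.hasDerivAt_sqrt ht.ne')
      (by
        have h := (((Real.hasDerivAt_sqrt hz2.ne').const_mul 2).inv
          (by rw [Real.sqrt_sq hr.le]; positivity))
        simp only [← one_div] at h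
        refine h.congr_deriv ?_
        rw [Real.sqrt_sq hr.le]
        field_simp
        norm_num)
    simp only [Real.sqrt_sq (norm_nonneg _)] at this
    refine this.congr ?_ ?_
    · rw [smul_smul]
      congr 1
      field_simp
    · rw [inner_smul_left, inner_smul_right, real_inner_self_eq_norm_sq]
      simp only [conj_trivial]
      field_simp
      ring
  have hQ : 0 < ‖z‖ ^ 2 + l ^ 2 := by positivity
  have jQ := (jr2.add (HasLap.const (l ^ 2) z)).comp (ψ := fun t => t⁻¹)
    (ψ' := fun t => -(t ^ 2)⁻¹) (c := 2 * ((‖z‖ ^ 2 + l ^ 2) ^ 3)⁻¹)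
    (by filter_upwards [isOpen_ne.mem_nhds hQ.ne'] with t ht using hasDerivAt_inv ht)
    (by
      refine ((hasDerivAt_pow 2 (‖z‖ ^ 2 + l ^ 2)).inv (by positivity)).neg.congr_deriv ?_
      field_simp
      norm_num
      ring)
  have jH := ((jD.mul jS).mul ((jw.add jr).mul jQ)).const_mul (7 / (4 * (n : ℝ)))
  have hμ1 : 1 ≤ μ := by rw [hμ]; linarith
  have hw := abs_inner_le he z
  refine ⟨_, _, jH, ?_, ?_⟩
  · simp only [add_zero, sub_zero, ← hsdef]
    rw [Real.rpow_sub_one hs.ne']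
    set S := s ^ (-(μ + 1))
    have hS : 0 < S := by positivity
    set w := ⟪e, z⟫
    set r := ‖z‖ with hrdef
    set Q := r ^ 2 + l ^ 2
    have hwr : |w + r| ≤ 2 * r := by
      rw [abs_le] at hw ⊢
      constructor <;> linarith
    have hD0 : 0 ≤ r ^ 2 - l ^ 2 := by nlinarith
    have hDQ : r ^ 2 - l ^ 2 ≤ Q := by simp only [Q]; nlinarith
    have hrQ : r ^ 2 ≤ Q := by simp only [Q]; nlinarith
    have n1 : ‖(w + r) • -(Q ^ 2)⁻¹ • (2 : ℝ) • z‖ ≤ 4 * Q⁻¹ := by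
      rw [norm_smul, norm_smul, norm_smul, norm_neg, norm_inv, Real.norm_eq_abs, Real.norm_eq_abs,
        Real.norm_eq_abs, abs_of_pos (show 0 < Q ^ 2 by positivity), abs_two, ← hrdef]
      calc |w + r| * ((Q ^ 2)⁻¹ * (2 * r)) ≤ 2 * r * ((Q ^ 2)⁻¹ * (2 * r)) := by gcongr
        _ = 4 * (Q ^ 2)⁻¹ * r ^ 2 := by ring
        _ ≤ 4 * (Q ^ 2)⁻¹ * Q := by gcongr
        _ = 4 * Q⁻¹ := by field_simp
    have n2 : ‖Q⁻¹ • (e + r⁻¹ • z)‖ ≤ 2 * Q⁻¹ := by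
      have h1 : ‖e + r⁻¹ • z‖ ≤ 2 := by
        refine (norm_add_le _ _).trans ?_
        rw [norm_smul, norm_inv, he, Real.norm_of_nonneg hr.le, ← hrdef, inv_mul_cancel₀ hr.ne']
        norm_num
      rw [norm_smul, norm_inv, Real.norm_of_nonneg hQ.le, mul_comm]
      gcongr
    have n3 : ‖(2 : ℝ) • z - (24 / 13 * l) • e‖ ≤ 4 * r := by
      refine (norm_sub_le _ _).trans ?_
      rw [norm_smul, norm_smul, he, ← hrdef, Real.norm_of_nonneg (by positivity),
        Real.norm_of_nonneg (by positivity)]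
      linarith
    have n4 : ‖(r ^ 2 - l ^ 2) • (-(μ + 1) * (S / s)) • ((2 : ℝ) • z - (24 / 13 * l) • e)‖
        ≤ 52 * (μ + 1) * S * r := by
      rw [norm_smul, norm_smul, norm_mul, norm_neg, Real.norm_of_nonneg hD0,
        Real.norm_of_nonneg (by positivity), Real.norm_of_nonneg (by positivity)]
      have h1 : r ^ 2 - l ^ 2 ≤ 13 * s := by linarith
      calc _ ≤ 13 * s * ((μ + 1) * (S / s) * (4 * r)) := by gcongr
        _ = _ := by field_simp; norm_num
    have n5 : ‖S • (2 : ℝ) • z‖ ≤ 2 * S * r := by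
      rw [norm_smul, norm_smul, Real.norm_of_nonneg hS.le, ← hrdef, Real.norm_of_nonneg (by norm_num)]
      linarith
    have n6 : |(w + r) * Q⁻¹| * r ≤ 2 := by
      rw [abs_mul, abs_of_pos (inv_pos.2 hQ)]
      calc |w + r| * Q⁻¹ * r ≤ 2 * r * Q⁻¹ * r := by gcongr
        _ = 2 * r ^ 2 * Q⁻¹ := by ring
        _ ≤ 2 * Q * Q⁻¹ := by gcongr
        _ = 2 := by field_simp
    have n7 : ‖((r ^ 2 - l ^ 2) * S) • ((w + r) • -(Q ^ 2)⁻¹ • (2 : ℝ) • z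
        + Q⁻¹ • (e + r⁻¹ • z))‖ ≤ 6 * S := by
      rw [norm_smul, Real.norm_of_nonneg (by positivity)]
      calc _ ≤ Q * S * (4 * Q⁻¹ + 2 * Q⁻¹) := by
            gcongr
            exact (norm_add_le _ _).trans (add_le_add n1 n2)
        _ = _ := by field_simp; ring
    have n8 : ‖((w + r) * Q⁻¹) • ((r ^ 2 - l ^ 2) • (-(μ + 1) * (S / s)) •
        ((2 : ℝ) • z - (24 / 13 * l) • e) + S • (2 : ℝ) • z)‖ ≤ (104 * (μ + 1) + 4) * S := by
      rw [norm_smul, Real.norm_eq_abs]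
      calc _ ≤ |(w + r) * Q⁻¹| * (52 * (μ + 1) * S * r + 2 * S * r) := by
            gcongr
            exact (norm_add_le _ _).trans (add_le_add n4 n5)
        _ = (52 * (μ + 1) + 2) * S * (|(w + r) * Q⁻¹| * r) := by ring
        _ ≤ (52 * (μ + 1) + 2) * S * 2 := by gcongr
        _ = _ := by ring
    have n9 : 7 / (4 * (n : ℝ)) ≤ 1 := by
      rw [div_le_one (by positivity)]; linarith
    rw [norm_smul, Real.norm_of_nonneg (by positivity)]
    calc _ ≤ 1 * (6 * S + (104 * (μ + 1) + 4) * S) := by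
          gcongr
          exact (norm_add_le _ _).trans (add_le_add n7 n8)
      _ ≤ _ := by nlinarith
  · rw [abs_le] at hw
    have e1 : ⟪z, z⟫ = ‖z‖ ^ 2 := real_inner_self_eq_norm_sq z
    have e2 : ⟪e, e⟫ = 1 := by rw [real_inner_self_eq_norm_sq, he]; norm_num
    have e3 : ⟪z, e⟫ = ⟪e, z⟫ := real_inner_comm _ _
    simp only [inner_smul_left, inner_smul_right, inner_add_right, inner_add_left, inner_sub_left,
      inner_sub_right, conj_trivial, e1, e2, e3, add_zero, sub_zero, mul_zero, barrier, ← hsdef]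
    have hseq : s = ‖z‖ ^ 2 + l ^ 2 - 24 / 13 * l * ⟪e, z⟫ := hsdef
    clear jH jQ jr jS js jw jD jr2
    have p2 : s ^ (-(μ + 1) - 1) = s ^ (-(μ + 1)) / s := Real.rpow_sub_one hs.ne' _
    have p3 : s ^ (-(μ + 1) - 1 - 1) = s ^ (-(μ + 1)) / s / s := by
      rw [Real.rpow_sub_one hs.ne', p2]
    have p4 : s ^ (-(μ + 2)) = s ^ (-(μ + 1)) / s := by
      rw [← p2]; congr 1; ring
    rw [p3, p2, p4]
    have hSp : 0 < s ^ (-(μ + 1)) := by positivity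
    generalize s ^ (-(μ + 1)) = S at *
    generalize ⟪e, z⟫ = w at *
    clear hsdef e1 e2 e3
    generalize ‖z‖ = r at *
    have hq1 : 2 * l * r / (r ^ 2 + l ^ 2) ≤ 1 := by
      rw [div_le_one hQ]; nlinarith [sq_nonneg (r - l)]
    have hpoly := barrier_poly (q := 2 * l * r / (r ^ 2 + l ^ 2)) (c := w / r) hn4
      (by positivity) hq1 (by rw [le_div_iff₀ hr]; linarith) (by rw [div_le_one hr]; exact hw.2)
    have hD0 : 0 ≤ r ^ 2 - l ^ 2 := by nlinarith
    have hn2 : (n : ℝ) = 2 * μ + 2 := by rw [hμ]; ring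
    have hμ1' : 0 < 2 * μ + 2 := by linarith
    clear hμ
    rw [hn2] at hpoly ⊢
    calc _ = (r ^ 2 - l ^ 2) / r * (S / s) * (1 / 5) := by ring
      _ ≤ _ := mul_le_mul_of_nonneg_left hpoly (by positivity)
      _ = _ := by
        have hw' : w = 13 / (24 * l) * (r ^ 2 + l ^ 2 - s) := by
          rw [hseq]; field_simp; ring
        rw [hw']
        field_simp
        ring

end Barrier

section Setup

variable {n : ℕ}

/-- The closed ball of radius `ρ` truncated at height `-T` in the direction of index `i`. -/
def dom (i : Fin n) (T ρ : ℝ) : Set (Euc n) := {z | ‖z‖ ≤ ρ ∧ -T ≤ z i}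

/-- Normalised data for the moving sphere argument, with smallness parameter `η`. -/
structure Setup (i : Fin n) (μ η T ρ τ : ℝ) (e : Euc n) (V K : Euc n → ℝ) : Prop where
  hn : 4 ≤ n
  hμ : μ = ((n : ℝ) - 2) / 2
  hη : 0 < η
  hT : η⁻¹ ≤ T
  hρ : η⁻¹ ≤ ρ
  hτ : 0 < τ
  hτη : τ ≤ η
  he : ‖e‖ = 1
  cont : ContinuousOn V (dom i T ρ)
  pos : ∀ z ∈ dom i T ρ, 0 < V z
  smooth : ∀ z, ‖z‖ < ρ → -T < z i → ContDiffAt ℝ 2 V z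
  lap : ∀ z, ‖z‖ < ρ → -T < z i → ∃ g, HasLap V z g (-(K z * V z ^ ((μ + 2) / μ)))
  flat : ∀ z, ‖z‖ < ρ → z i = -T → ∃ d ≤ η * T * V z ^ ((μ + 1) / μ),
    HasDerivWithinAt (fun t : ℝ => V (z + t • EuclideanSpace.single i 1)) d (Ici 0) 0
  outer : ∀ z ∈ dom i T ρ, ‖z‖ = ρ → η⁻¹ * (ρ ^ 2) ^ (-μ) ≤ V z
  close : ∀ z, ‖z‖ ≤ η⁻¹ → |V z - bubBase (13 / 5) e z ^ (-μ)| ≤ η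
  closeLip : ∀ z z', ‖z‖ ≤ η⁻¹ → ‖z'‖ ≤ η⁻¹ →
    |(V z - bubBase (13 / 5) e z ^ (-μ)) - (V z' - bubBase (13 / 5) e z' ^ (-μ))| ≤ η * ‖z - z'‖
  Kclose : ∀ z ∈ dom i T ρ, |K z - n * (n - 2)| ≤ η
  Klin : ∀ z ∈ dom i T ρ, ∀ z' ∈ dom i T ρ, |K z - K z' - τ * ⟪e, z - z'⟫| ≤ η * τ * ‖z - z'‖

lemma Setup.one_le {i : Fin n} {μ η T ρ τ : ℝ} {e : Euc n} {V K : Euc n → ℝ}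
    (S : Setup i μ η T ρ τ e V K) : 1 ≤ μ := by
  have : (4 : ℝ) ≤ n := by exact_mod_cast S.hn
  rw [S.hμ]; linarith

lemma mem_dom_of_norm_le {i : Fin n} {T ρ : ℝ} {z : Euc n} (h1 : ‖z‖ ≤ ρ) (h2 : ‖z‖ ≤ T) :
    z ∈ dom i T ρ :=
  ⟨h1, by have := abs_le.1 ((PiLp.norm_apply_le z i).trans h2); exact this.1⟩

/-- The conformal factor of the Kelvin transform of the limiting bubble. -/
def kelBase (l : ℝ) (e z : Euc n) : ℝ :=
  ‖z‖ ^ 2 * (169 / 25) / l ^ 2 + l ^ 2 - 24 / 5 * ⟪e, z⟫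

lemma bubBase_smul {l : ℝ} (hl : 0 < l) (e : Euc n) {z : Euc n} (hz : z ≠ 0) :
    bubBase (13 / 5) e ((l ^ 2 * (‖z‖ ^ 2)⁻¹) • z) = l ^ 2 * (‖z‖ ^ 2)⁻¹ * kelBase l e z := by
  have : ‖z‖ ≠ 0 := by simpa using hz
  rw [bubBase, kelBase, norm_smul, inner_smul_right, Real.norm_of_nonneg (by positivity)]
  field_simp
  ring

lemma kelBase_pos {l : ℝ} (hl : 0 < l) {e z : Euc n} (he : ‖e‖ = 1) (hz : z ≠ 0) :
    0 < kelBase l e z := by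
  have h := bubBase_pos (l := 13 / 5) (by norm_num) he ((l ^ 2 * (‖z‖ ^ 2)⁻¹) • z)
  rw [bubBase_smul hl e hz] at h
  have : 0 < ‖z‖ := by positivity
  exact pos_of_mul_pos_right h (by positivity)

lemma kelvin_bub (μ : ℝ) {l : ℝ} (hl : 0 < l) {e z : Euc n} (he : ‖e‖ = 1) (hz : z ≠ 0) :
    (l ^ 2 * (‖z‖ ^ 2)⁻¹) ^ μ * bubBase (13 / 5) e ((l ^ 2 * (‖z‖ ^ 2)⁻¹) • z) ^ (-μ)
      = kelBase l e z ^ (-μ) := by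
  have : 0 < ‖z‖ := by positivity
  have hm : 0 < l ^ 2 * (‖z‖ ^ 2)⁻¹ := by positivity
  rw [bubBase_smul hl e hz, Real.mul_rpow hm.le (kelBase_pos hl he hz).le, ← mul_assoc,
    ← Real.rpow_add hm, add_neg_cancel, Real.rpow_zero, one_mul]

lemma norm_reflect {l : ℝ} {z : Euc n} (hl : 0 < l) (hz : l ≤ ‖z‖) :
    ‖(l ^ 2 * (‖z‖ ^ 2)⁻¹) • z‖ = l ^ 2 / ‖z‖ ∧ l ^ 2 / ‖z‖ ≤ l := by
  have hr : 0 < ‖z‖ := hl.trans_le hz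
  constructor
  · rw [norm_smul, Real.norm_of_nonneg (by positivity)]
    field_simp
  · rw [div_le_iff₀ hr]
    nlinarith

lemma bubBase_le_of_norm_le {e y : Euc n} (he : ‖e‖ = 1) (hy : ‖y‖ ≤ 3) :
    bubBase (13 / 5) e y ≤ 42 := by
  have h := abs_le.1 (abs_inner_le he y)
  unfold bubBase
  nlinarith [norm_nonneg y]

lemma kelBase_close {l θ : ℝ} {e z : Euc n} (he : ‖e‖ = 1) (hθ : θ ≤ 1 / 10)
    (hl : |l - 13 / 5| ≤ θ) (hz : l ≤ ‖z‖) :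
    |kelBase l e z - bubBase l e z| ≤ 26 * θ * bubBase l e z := by
  obtain ⟨h1, h2⟩ := abs_le.1 hl
  have hl0 : 0 < l := by linarith
  have hs := bubBase_ge hl0 he z
  have hθ0 : 0 ≤ θ := (abs_nonneg _).trans hl
  have hw := abs_inner_le he z
  have hr : 5 / 2 ≤ ‖z‖ := by linarith
  have e1 : kelBase l e z - bubBase l e z
      = ‖z‖ ^ 2 * ((13 / 5 - l) * ((13 / 5 + l) / l ^ 2)) - 24 / 13 * (13 / 5 - l) * ⟪e, z⟫ := by
    unfold kelBase bubBase
    field_simp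
    ring
  have hq : (13 / 5 + l) / l ^ 2 ≤ 1 := by
    rw [div_le_one (by positivity)]; nlinarith
  have hl' : |13 / 5 - l| ≤ θ := by rwa [abs_sub_comm]
  have a1 : |‖z‖ ^ 2 * ((13 / 5 - l) * ((13 / 5 + l) / l ^ 2))| ≤ ‖z‖ ^ 2 * (θ * 1) := by
    rw [abs_mul, abs_mul, abs_of_nonneg (by positivity : 0 ≤ ‖z‖ ^ 2),
      abs_of_nonneg (by positivity : 0 ≤ (13 / 5 + l) / l ^ 2)]
    gcongr
  have a2 : |24 / 13 * (13 / 5 - l) * ⟪e, z⟫| ≤ 24 / 13 * θ * ‖z‖ := by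
    rw [abs_mul, abs_mul, abs_of_nonneg (by norm_num : (0 : ℝ) ≤ 24 / 13)]
    gcongr
  rw [e1]
  refine (abs_sub _ _).trans ((add_le_add a1 a2).trans ?_)
  have : θ * (2 * ‖z‖ ^ 2) ≤ θ * (26 * bubBase l e z) :=
    mul_le_mul_of_nonneg_left (by nlinarith) hθ0
  have : θ * (24 / 13 * ‖z‖) ≤ θ * ‖z‖ ^ 2 := mul_le_mul_of_nonneg_left (by nlinarith) hθ0
  nlinarith

lemma Setup.kelvin_close {μ : ℝ} (hμ : 0 < μ) {ζ : ℝ} (hζ : 0 < ζ) :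
    ∃ θ > 0, θ ≤ 1 / 10 ∧ ∀ᶠ η in 𝓝[>] (0 : ℝ), ∀ (i : Fin n) (T ρ τ : ℝ) (e : Euc n)
      (V K : Euc n → ℝ), Setup i μ η T ρ τ e V K → ∀ l, |l - 13 / 5| ≤ θ →
        25 / 169 * l ^ 2 ≤ 1 + ζ ∧ ∀ z, l ≤ ‖z‖ →
          (1 - ζ) * bubBase l e z ^ (-μ) ≤ kelvin μ l V z ∧
          kelvin μ l V z ≤ (1 + ζ) * bubBase l e z ^ (-μ) := by
  have hc : ∀ s : ℝ, ContinuousAt (fun δ : ℝ => (1 + s * δ) * (1 - s * δ) ^ (-μ)) 0 := fun s =>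
    ContinuousAt.mul (by fun_prop)
      (ContinuousAt.rpow_const (by fun_prop) (.inl (by simp)))
  have c1 : ∀ᶠ δ in 𝓝[>] (0 : ℝ), (1 + 1 * δ) * (1 - 1 * δ) ^ (-μ) < 1 + ζ :=
    ((hc 1).tendsto.eventually_lt_const (by simpa using hζ)).filter_mono nhdsWithin_le_nhds
  have c2 : ∀ᶠ δ in 𝓝[>] (0 : ℝ), 1 - ζ < (1 + (-1) * δ) * (1 - (-1) * δ) ^ (-μ) :=
    ((hc (-1)).tendsto.eventually_const_lt (by simpa using hζ)).filter_mono nhdsWithin_le_nhds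
  have c3 : ∀ᶠ δ in 𝓝[>] (0 : ℝ), δ < min ζ (1 / 2) :=
    (eventually_lt_nhds (by positivity)).filter_mono nhdsWithin_le_nhds
  obtain ⟨δ, h1, h2, h3, hδ : 0 < δ⟩ := (c1.and (c2.and (c3.and self_mem_nhdsWithin))).exists
  obtain ⟨h3, h4⟩ := lt_min_iff.1 h3
  refine ⟨δ / 26, by positivity, by linarith, ?_⟩
  have c4 : ∀ᶠ η in 𝓝[>] (0 : ℝ), η < min (δ * 42 ^ (-μ)) (1 / 3) :=
    (eventually_lt_nhds (by positivity)).filter_mono nhdsWithin_le_nhds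
  filter_upwards [c4, self_mem_nhdsWithin] with η hη (hη0 : 0 < η) i T ρ τ e V K S l hl
  obtain ⟨hη1, hη2⟩ := lt_min_iff.1 hη
  obtain ⟨hl1, hl2⟩ := abs_le.1 hl
  have hl0 : 0 < l := by linarith
  refine ⟨by nlinarith, fun z hz => ?_⟩
  have hr : 0 < ‖z‖ := hl0.trans_le hz
  have hz0 : z ≠ 0 := norm_pos_iff.1 hr
  have hkb := kelvin_bub μ hl0 S.he hz0
  obtain ⟨hy1, hy2⟩ := norm_reflect hl0 hz
  unfold kelvin
  set m := l ^ 2 * (‖z‖ ^ 2)⁻¹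
  have hm : 0 < m := by positivity
  set y := m • z
  have hy3 : ‖y‖ ≤ 3 := by linarith
  have h3η : 3 ≤ η⁻¹ := by
    rw [le_inv_comm₀ (by norm_num) hη0]; linarith
  have hU0 := bubBase_pos (l := 13 / 5) (by norm_num) S.he y
  have hU : 42 ^ (-μ) ≤ bubBase (13 / 5) e y ^ (-μ) :=
    Real.rpow_le_rpow_of_nonpos hU0 (bubBase_le_of_norm_le S.he hy3) (by linarith)
  have hV := abs_le.1 (S.close y (hy3.trans h3η))
  have hs0 := bubBase_pos hl0 S.he z
  have hk0 := kelBase_pos hl0 S.he hz0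
  have hk := abs_le.1 (kelBase_close S.he (by linarith) hl hz)
  set s := bubBase l e z
  set k := kelBase l e z
  set u := bubBase (13 / 5) e y ^ (-μ)
  have hδU : δ * 42 ^ (-μ) ≤ δ * u := by gcongr
  have hp : 0 < s ^ (-μ) := by positivity
  have hmμ : 0 < m ^ μ := by positivity
  constructor
  · calc (1 - ζ) * s ^ (-μ) ≤ ((1 + (-1) * δ) * (1 - (-1) * δ) ^ (-μ)) * s ^ (-μ) := by gcongr
      _ = (1 - δ) * ((1 + δ) * s) ^ (-μ) := by
        rw [Real.mul_rpow (by positivity) hs0.le]; ring_nf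
      _ ≤ (1 - δ) * k ^ (-μ) := by
        gcongr ?_ * ?_
        · linarith
        · exact Real.rpow_le_rpow_of_nonpos hk0 (by linarith [hk.2]) (by linarith)
      _ = m ^ μ * ((1 - δ) * u) := by rw [← hkb]; ring
      _ ≤ _ := by gcongr; linarith [hV.1]
  · calc m ^ μ * V y ≤ m ^ μ * ((1 + δ) * u) := by gcongr; linarith [hV.2]
      _ = (1 + δ) * k ^ (-μ) := by rw [← hkb]; ring
      _ ≤ (1 + δ) * ((1 - δ) * s) ^ (-μ) := by
        gcongr ?_ * ?_
        exact Real.rpow_le_rpow_of_nonpos (mul_pos (by linarith) hs0) (by linarith [hk.1])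
          (by linarith)
      _ = ((1 + 1 * δ) * (1 - 1 * δ) ^ (-μ)) * s ^ (-μ) := by
        rw [Real.mul_rpow (by linarith) hs0.le]; ring_nf
      _ ≤ _ := by gcongr

end Setup

section Interior

variable {n : ℕ}

/-- The difference between `V`, its Kelvin transform and the compensating barrier. -/
def sphereDiff (μ τ l : ℝ) (e : Euc n) (V : Euc n → ℝ) (z : Euc n) : ℝ :=
  V z - kelvin μ l V z - τ * barrier μ l e z

lemma barrier_nonneg {μ l : ℝ} (hl : 0 < l) {e z : Euc n} (he : ‖e‖ = 1) (hz : l ≤ ‖z‖) :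
    0 ≤ barrier μ l e z := by
  have hs := bubBase_pos hl he z
  have hw := abs_le.1 (abs_inner_le he z)
  have hD : 0 ≤ ‖z‖ ^ 2 - l ^ 2 := by nlinarith
  have hwr : 0 ≤ ⟪e, z⟫ + ‖z‖ := by linarith
  unfold barrier
  positivity

lemma barrier_le {μ l : ℝ} (hn : 4 ≤ n) (hl : 0 < l) {e z : Euc n} (he : ‖e‖ = 1)
    (hz : l ≤ ‖z‖) :
    barrier μ l e z ≤ 2 * ((‖z‖ ^ 2 - l ^ 2) / ‖z‖) * bubBase l e z ^ (-(μ + 1)) := by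
  have hs := bubBase_pos hl he z
  have hw := abs_le.1 (abs_inner_le he z)
  have hr : 0 < ‖z‖ := hl.trans_le hz
  have hD : 0 ≤ ‖z‖ ^ 2 - l ^ 2 := by nlinarith
  have hn4 : (4 : ℝ) ≤ n := by exact_mod_cast hn
  have h1 : 7 / (4 * (n : ℝ)) ≤ 1 := by
    rw [div_le_one (by positivity)]; linarith
  have hwr : 0 ≤ ⟪e, z⟫ + ‖z‖ := by linarith
  have h2 : (⟪e, z⟫ + ‖z‖) * (‖z‖ ^ 2 + l ^ 2)⁻¹ ≤ 2 / ‖z‖ := by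
    rw [← div_eq_mul_inv, div_le_div_iff₀ (by positivity) hr]
    nlinarith
  unfold barrier
  calc _ ≤ 1 * ((‖z‖ ^ 2 - l ^ 2) * bubBase l e z ^ (-(μ + 1)) * (2 / ‖z‖)) := by gcongr
    _ = _ := by ring

lemma barrier_le' {μ l : ℝ} (hn : 4 ≤ n) (hl : 2 ≤ l) {e z : Euc n} (he : ‖e‖ = 1)
    (hz : l ≤ ‖z‖) : barrier μ l e z ≤ 13 * bubBase l e z ^ (-μ) := by
  have hl0 : 0 < l := by linarith
  have hs := bubBase_pos hl0 he z
  have hr : 0 < ‖z‖ := hl0.trans_le hz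
  have hsge := bubBase_ge hl0 he z
  refine (barrier_le hn hl0 he hz).trans ?_
  have h1 : 2 * ((‖z‖ ^ 2 - l ^ 2) / ‖z‖) ≤ 13 * bubBase l e z := by
    rw [mul_div_assoc', div_le_iff₀ hr]
    nlinarith
  calc _ ≤ 13 * bubBase l e z * bubBase l e z ^ (-(μ + 1)) := by gcongr
    _ = 13 * (bubBase l e z ^ (1 : ℝ) * bubBase l e z ^ (-(μ + 1))) := by rw [Real.rpow_one]; ring
    _ = _ := by rw [← Real.rpow_add hs]; ring_nf

/-- Admissible closeness parameters for the maximum principle. -/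
structure Good (n : ℕ) (μ ζ : ℝ) : Prop where
  pos : 0 < ζ
  le : ζ ≤ 1 / 100
  upper : (1 + ζ) ^ ((μ + 2) / μ) ≤ 101 / 100
  lower : 99 / 100 ≤ (1 - ζ) ^ ((μ + 2) / μ)
  lin : n * (n + 2) * (1 + ζ)
    - (n * (n - 2) - ζ) * ((μ + 2) / μ) * (1 - ζ) ^ ((μ + 2) / μ - 1) ≤ 1 / 1000

lemma exists_good {μ : ℝ} (hn : 4 ≤ n) (hμ : μ = ((n : ℝ) - 2) / 2) : ∃ ζ, Good n μ ζ := by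
  have hn4 : (4 : ℝ) ≤ n := by exact_mod_cast hn
  have hμ0 : 0 < μ := by rw [hμ]; linarith
  have hc : ∀ a b : ℝ, ContinuousAt (fun δ : ℝ => (1 + a * δ) ^ b) 0 := fun a b =>
    ContinuousAt.rpow_const (by fun_prop) (.inl (by simp))
  have c1 : ∀ᶠ ζ in 𝓝[>] (0 : ℝ), (1 + 1 * ζ) ^ ((μ + 2) / μ) < 101 / 100 :=
    ((hc 1 _).tendsto.eventually_lt_const (by norm_num)).filter_mono nhdsWithin_le_nhds
  have c2 : ∀ᶠ ζ in 𝓝[>] (0 : ℝ), 99 / 100 < (1 + (-1) * ζ) ^ ((μ + 2) / μ) :=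
    ((hc (-1) _).tendsto.eventually_const_lt (by norm_num)).filter_mono nhdsWithin_le_nhds
  have c3 : ∀ᶠ ζ in 𝓝[>] (0 : ℝ), n * (n + 2) * (1 + ζ)
      - (n * (n - 2) - ζ) * ((μ + 2) / μ) * (1 + (-1) * ζ) ^ ((μ + 2) / μ - 1) < 1 / 1000 := by
    have : ContinuousAt (fun ζ : ℝ => n * (n + 2) * (1 + ζ)
      - (n * (n - 2) - ζ) * ((μ + 2) / μ) * (1 + (-1) * ζ) ^ ((μ + 2) / μ - 1)) 0 :=
      ContinuousAt.sub (by fun_prop) (ContinuousAt.mul (by fun_prop) (hc _ _))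
    refine (this.tendsto.eventually_lt_const ?_).filter_mono nhdsWithin_le_nhds
    have hn2 : (n : ℝ) = 2 * μ + 2 := by rw [hμ]; ring
    simp only [hn2, mul_zero, add_zero, sub_zero, Real.one_rpow, mul_one]
    have : (2 * μ + 2) * (2 * μ + 2 + 2) - (2 * μ + 2) * (2 * μ + 2 - 2) * ((μ + 2) / μ) = 0 := by
      field_simp
      ring
    linarith
  have c4 : ∀ᶠ ζ in 𝓝[>] (0 : ℝ), ζ < 1 / 100 :=
    (eventually_lt_nhds (by positivity)).filter_mono nhdsWithin_le_nhds
  obtain ⟨ζ, h1, h2, h3, h4, h5⟩ :=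
    (c1.and (c2.and (c3.and (c4.and self_mem_nhdsWithin)))).exists
  simp only [one_mul, neg_one_mul, ← sub_eq_add_neg] at h1 h2 h3
  exact ⟨ζ, h5, h4.le, h1.le, h2.le, h3.le⟩

lemma Setup.hundred_le {i : Fin n} {μ η T ρ τ : ℝ} {e : Euc n} {V K : Euc n → ℝ}
    (S : Setup i μ η T ρ τ e V K) (hη : η ≤ 1 / 100) : 100 ≤ T ∧ 100 ≤ ρ ∧ 100 ≤ η⁻¹ := by
  have h : 100 ≤ η⁻¹ := by
    rw [le_inv_comm₀ (by norm_num) S.hη]; linarith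
  exact ⟨h.trans S.hT, h.trans S.hρ, h⟩

lemma Setup.small_mem {i : Fin n} {μ η T ρ τ : ℝ} {e : Euc n} {V K : Euc n → ℝ}
    (S : Setup i μ η T ρ τ e V K) (hη : η ≤ 1 / 100) {y : Euc n} (hy : ‖y‖ ≤ 50) :
    y ∈ dom i T ρ ∧ ‖y‖ < ρ ∧ -T < y i ∧ ‖y‖ ≤ η⁻¹ := by
  obtain ⟨h1, h2, h3⟩ := S.hundred_le hη
  have := (abs_le.1 ((PiLp.norm_apply_le y i).trans hy)).1
  exact ⟨mem_dom_of_norm_le (by linarith) (by linarith), by linarith, by linarith, by linarith⟩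

lemma rpow_add_ge {X H p : ℝ} (hX : 0 < X) (hH : 0 ≤ H) (hp : 1 ≤ p) :
    X ^ p + p * X ^ (p - 1) * H ≤ (X + H) ^ p := by
  have h1 : X + H = X * (1 + H / X) := by field_simp
  have h2 : X ^ p = X * X ^ (p - 1) := by
    rw [Real.rpow_sub_one hX.ne']; field_simp
  have h0 : 0 ≤ H / X := by positivity
  have h3 := one_add_mul_self_le_rpow_one_add (s := H / X) (by linarith) hp
  rw [h1, Real.mul_rpow hX.le (by positivity)]
  calc X ^ p + p * X ^ (p - 1) * H = X ^ p * (1 + p * (H / X)) := by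
        rw [h2]; field_simp
    _ ≤ _ := by gcongr

set_option maxHeartbeats 1000000 in
lemma lap_neg_arith {μ η τ ζ l r s w X v b Lb Kz Ky : ℝ} (hn : 4 ≤ n) (hμ0 : 0 < μ)
    (G : Good n μ ζ) (hη0 : 0 < η) (hη : η ≤ ζ) (hτ : 0 < τ) (hl0 : 5 / 2 ≤ l)
    (hl2 : 25 / 169 * l ^ 2 ≤ 1 + ζ) (hz : l < r) (hs : 0 < s) (hsge : (r ^ 2 + l ^ 2) / 13 ≤ s)
    (hX1 : (1 - ζ) * s ^ (-μ) ≤ X) (hX2 : X ≤ (1 + ζ) * s ^ (-μ)) (hWz : X + τ * b ≤ v)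
    (hb0 : 0 ≤ b) (hb1 : b ≤ 2 * ((r ^ 2 - l ^ 2) / r) * s ^ (-(μ + 1)))
    (hw : -r ≤ w ∧ w ≤ r) (hKz : n * (n - 2) - η ≤ Kz)
    (hKl : τ * ((r ^ 2 - l ^ 2) / r ^ 2 * w) - η * τ * ((r ^ 2 - l ^ 2) / r) ≤ Kz - Ky)
    (hLb : 1 / 5 * ((r ^ 2 - l ^ 2) / r * s ^ (-(μ + 2)))
      ≤ Lb + n * (n + 2) * (25 / 169 * l ^ 2) * (s ^ 2)⁻¹ * b
        + w * ((r ^ 2 - l ^ 2) / r ^ 2) * s ^ (-(μ + 2))) :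
    -(Kz * v ^ ((μ + 2) / μ)) - -(Ky * X ^ ((μ + 2) / μ)) - τ * Lb < 0 := by
  have hr : 0 < r := by linarith
  have hn4 : (4 : ℝ) ≤ n := by exact_mod_cast hn
  have hnn : 8 ≤ (n : ℝ) * (n - 2) := by nlinarith only [hn4]
  have hD0 : 0 < r ^ 2 - l ^ 2 := by nlinarith
  obtain ⟨hζ, hζ1, Gu, Gl, Glin⟩ := G
  set p := (μ + 2) / μ with hp
  have hp1 : 1 ≤ p := by rw [hp, le_div_iff₀ hμ0]; linarith
  have hX0 : 0 < X := lt_of_lt_of_le (mul_pos (by linarith) (by positivity)) hX1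
  have hVp : X ^ p + p * X ^ (p - 1) * (τ * b) ≤ v ^ p :=
    (rpow_add_ge hX0 (by positivity) hp1).trans
      (Real.rpow_le_rpow (by positivity) hWz (by linarith))
  have hμp : -μ * p = -(μ + 2) := by rw [hp]; field_simp
  have hμp' : -μ * (p - 1) = -2 := by rw [hp]; field_simp; ring
  have hB1 : X ^ p ≤ 101 / 100 * s ^ (-(μ + 2)) := by
    refine (Real.rpow_le_rpow hX0.le hX2 (by linarith)).trans ?_
    rw [Real.mul_rpow (by linarith) (by positivity), ← Real.rpow_mul hs.le, hμp]
    gcongr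
  have hB2 : 99 / 100 * s ^ (-(μ + 2)) ≤ X ^ p := by
    refine le_trans ?_ (Real.rpow_le_rpow (mul_nonneg (by linarith) (by positivity)) hX1
      (by linarith))
    rw [Real.mul_rpow (by linarith) (by positivity), ← Real.rpow_mul hs.le, hμp]
    gcongr
  have hB3 : (1 - ζ) ^ (p - 1) * (s ^ 2)⁻¹ ≤ X ^ (p - 1) := by
    refine le_trans ?_ (Real.rpow_le_rpow (mul_nonneg (by linarith) (by positivity)) hX1
      (by linarith))
    rw [Real.mul_rpow (by linarith) (by positivity), ← Real.rpow_mul hs.le, hμp',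
      Real.rpow_neg hs.le]
    norm_num
  have hsb : (s ^ 2)⁻¹ * b ≤ 3 * ((r ^ 2 - l ^ 2) / r * s ^ (-(μ + 2))) := by
    have h1 : s ^ (-(μ + 1)) = s * s ^ (-(μ + 2)) := by
      rw [← Real.rpow_one_add' hs.le (by linarith)]; ring_nf
    have h2 : 1 ≤ 3 / 2 * s := by nlinarith
    calc _ ≤ (s ^ 2)⁻¹ * (2 * ((r ^ 2 - l ^ 2) / r) * s ^ (-(μ + 1))) := by gcongr
      _ = 2 * ((r ^ 2 - l ^ 2) / r) * s ^ (-(μ + 2)) * (s⁻¹ * 1) := by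
        rw [h1]; field_simp
      _ ≤ 2 * ((r ^ 2 - l ^ 2) / r) * s ^ (-(μ + 2)) * (s⁻¹ * (3 / 2 * s)) := by gcongr
      _ = _ := by field_simp
  set B := s ^ (-(μ + 2))
  have hB0 : 0 < B := by positivity
  set q := (r ^ 2 - l ^ 2) / r with hq
  have hq0 : 0 < q := by positivity
  have hqw : (r ^ 2 - l ^ 2) / r ^ 2 * w = q * (w / r) := by rw [hq]; field_simp
  have hqw' : w * ((r ^ 2 - l ^ 2) / r ^ 2) = q * (w / r) := by rw [hq]; field_simp
  rw [hqw] at hKl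
  rw [hqw'] at hLb
  have hc1 : -1 ≤ w / r := by rw [le_div_iff₀ hr]; linarith
  have hc2 : w / r ≤ 1 := by rw [div_le_one hr]; linarith
  generalize w / r = c at *
  have hKpos : 0 < n * (n - 2) - ζ := by linarith
  have f1 : (n * (n - 2) - ζ) * (p * ((1 - ζ) ^ (p - 1) * (s ^ 2)⁻¹) * (τ * b))
      ≤ Kz * (p * X ^ (p - 1) * (τ * b)) := by
    have h1 : n * (n - 2) - ζ ≤ Kz := by linarith
    have h2 : (0 : ℝ) ≤ Kz := by linarith
    have h3 : (0 : ℝ) ≤ 1 - ζ := by linarith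
    gcongr
  have f2 : Kz * (X ^ p + p * X ^ (p - 1) * (τ * b)) ≤ Kz * v ^ p :=
    mul_le_mul_of_nonneg_left hVp (by linarith)
  have f3 : n * (n + 2) * (25 / 169 * l ^ 2) * ((s ^ 2)⁻¹ * b)
      ≤ n * (n + 2) * (1 + ζ) * ((s ^ 2)⁻¹ * b) := by gcongr
  have f4 : (n * (n + 2) * (1 + ζ) - (n * (n - 2) - ζ) * p * (1 - ζ) ^ (p - 1)) * ((s ^ 2)⁻¹ * b)
      ≤ 1 / 1000 * (3 * (q * B)) :=
    (mul_le_mul_of_nonneg_right Glin (by positivity)).trans (by gcongr)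
  have f5 : (τ * (q * c) - η * τ * q) * X ^ p ≤ (Kz - Ky) * X ^ p :=
    mul_le_mul_of_nonneg_right hKl (by positivity)
  have f6 : q * (c * (B - X ^ p)) ≤ q * (1 / 100 * B) := by
    refine mul_le_mul_of_nonneg_left ?_ hq0.le
    calc c * (B - X ^ p) ≤ |c| * |B - X ^ p| := by rw [← abs_mul]; exact le_abs_self _
      _ ≤ 1 * (1 / 100 * B) :=
        mul_le_mul (abs_le.2 ⟨hc1, hc2⟩) (abs_le.2 ⟨by linarith, by linarith⟩) (abs_nonneg _)
          zero_le_one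
      _ = _ := one_mul _
  have f7 : η * (q * X ^ p) ≤ 1 / 100 * (q * (101 / 100 * B)) :=
    mul_le_mul (hη.trans hζ1) (mul_le_mul_of_nonneg_left hB1 hq0.le) (by positivity) (by norm_num)
  have hfin : 0 < τ * (q * B) := by positivity
  have g1 := mul_le_mul_of_nonneg_left (add_le_add (add_le_add f4 f3)
    (add_le_add (add_le_add f6 f7) hLb)) hτ.le
  have g2 := add_le_add (add_le_add f1 f2) f5
  have g3 : -(Kz * v ^ p) - -(Ky * X ^ p) - τ * Lb ≤ -(1 / 10) * (τ * (q * B)) := by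
    linear_combination g1 + g2 + 769 / 10000 * hfin
  linarith

lemma Setup.lap_neg {i : Fin n} {μ η T ρ τ ζ l : ℝ} {e : Euc n} {V K : Euc n → ℝ}
    (S : Setup i μ η T ρ τ e V K) (G : Good n μ ζ) (hη : η ≤ ζ) (hl0 : 5 / 2 ≤ l)
    (hl1 : l ≤ 3) (hl2 : 25 / 169 * l ^ 2 ≤ 1 + ζ) {z : Euc n} (hz : l < ‖z‖) (hzρ : ‖z‖ < ρ)
    (hzT : -T < z i) (hX1 : (1 - ζ) * bubBase l e z ^ (-μ) ≤ kelvin μ l V z)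
    (hX2 : kelvin μ l V z ≤ (1 + ζ) * bubBase l e z ^ (-μ))
    (hW : 0 ≤ sphereDiff μ τ l e V z) :
    ∃ g L, HasLap (sphereDiff μ τ l e V) z g L ∧ L < 0 := by
  have hη1 : η ≤ 1 / 100 := hη.trans G.le
  have hl : 0 < l := by linarith
  have hr : 0 < ‖z‖ := hl.trans hz
  have hz0 : z ≠ 0 := norm_pos_iff.1 hr
  have hμ := S.one_le
  have hμ0 : 0 < μ := by linarith
  have hn4 : (4 : ℝ) ≤ n := by exact_mod_cast S.hn
  obtain ⟨hy1, hy2⟩ := norm_reflect hl hz.le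
  obtain ⟨hyd, hyρ, hyT, -⟩ :=
    S.small_mem hη1 (y := (l ^ 2 * (‖z‖ ^ 2)⁻¹) • z) (by linarith)
  obtain ⟨gV, hV⟩ := S.lap z hzρ hzT
  obtain ⟨gy, hVy⟩ := S.lap _ hyρ hyT
  have hK := hasLap_kelvin S.hμ hl hz0 hVy
  obtain ⟨gb, Lb, hB, -, hLb⟩ := hasLap_barrier S.hμ S.hn hl S.he hz.le
  refine ⟨_, _, (hV.sub hK).sub (hB.const_mul τ), ?_⟩
  have hb0 := barrier_nonneg (μ := μ) hl S.he hz.le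
  have hb1 := barrier_le (μ := μ) S.hn hl S.he hz.le
  have hs := bubBase_pos hl S.he z
  have hsge := bubBase_ge hl S.he z
  have hVy0 := S.pos _ hyd
  have hzd : z ∈ dom i T ρ := ⟨hzρ.le, hzT.le⟩
  have hKz := abs_le.1 (S.Kclose z hzd)
  have hKl := abs_le.1 (S.Klin z hzd _ hyd)
  have hw := abs_le.1 (abs_inner_le S.he z)
  have hm1 : l ^ 2 * (‖z‖ ^ 2)⁻¹ ≤ 1 := by
    rw [← div_eq_mul_inv, div_le_one (by positivity)]; nlinarith
  have hzy : z - (l ^ 2 * (‖z‖ ^ 2)⁻¹) • z = (1 - l ^ 2 * (‖z‖ ^ 2)⁻¹) • z := by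
    rw [sub_smul, one_smul]
  rw [hzy, norm_smul, inner_smul_right, Real.norm_of_nonneg (by linarith)] at hKl
  have hXdef : (l ^ 2 * (‖z‖ ^ 2)⁻¹) ^ (μ + 2) * -(K ((l ^ 2 * (‖z‖ ^ 2)⁻¹) • z) *
      V ((l ^ 2 * (‖z‖ ^ 2)⁻¹) • z) ^ ((μ + 2) / μ))
      = -(K ((l ^ 2 * (‖z‖ ^ 2)⁻¹) • z) * kelvin μ l V z ^ ((μ + 2) / μ)) := by
    unfold kelvin
    rw [Real.mul_rpow (by positivity) hVy0.le, ← Real.rpow_mul (by positivity)]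
    rw [show μ * ((μ + 2) / μ) = μ + 2 by field_simp]
    ring
  rw [hXdef]
  have hD : (1 - l ^ 2 * (‖z‖ ^ 2)⁻¹) = (‖z‖ ^ 2 - l ^ 2) / ‖z‖ ^ 2 := by field_simp
  rw [hD] at hKl
  have hDr : (‖z‖ ^ 2 - l ^ 2) / ‖z‖ ^ 2 * ‖z‖ = (‖z‖ ^ 2 - l ^ 2) / ‖z‖ := by field_simp
  rw [hDr] at hKl
  have hWz : kelvin μ l V z + τ * barrier μ l e z ≤ V z := by
    have := hW
    unfold sphereDiff at this
    linarith
  exact lap_neg_arith S.hn hμ0 G S.hη hη S.hτ hl0 hl2 hz hs hsge hX1 hX2 hWz hb0 hb1 hw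
    (by linarith [hKz.1]) (by linarith [hKl.1]) hLb

end Interior

section Boundary

variable {n : ℕ}

lemma nonneg_of_hasDerivWithinAt_Ici {f : ℝ → ℝ} {d : ℝ} (h : HasDerivWithinAt f d (Ici 0) 0)
    (hf : ∀ᶠ t in 𝓝[>] 0, f 0 ≤ f t) : 0 ≤ d := by
  have hslope := h.mono Ioi_subset_Ici_self
  rw [hasDerivWithinAt_iff_tendsto_slope' (by simp)] at hslope
  refine ge_of_tendsto hslope ?_
  filter_upwards [hf, self_mem_nhdsWithin] with t ht (ht0 : 0 < t)
  rw [slope_def_field]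
  exact div_nonneg (by linarith) (by linarith)

lemma HasLap.hasDerivWithinAt_line {F : Euc n → ℝ} {z g : Euc n} {L : ℝ} (h : HasLap F z g L)
    (w : Euc n) : HasDerivWithinAt (fun t : ℝ => F (z + t • w)) ⟪g, w⟫ (Ici 0) 0 := by
  have hline : HasDerivAt (fun t : ℝ => z + t • w) w 0 := by
    simpa using ((hasDerivAt_id (0 : ℝ)).smul_const w).const_add z
  have h' : HasFDerivAt F (innerSL ℝ g) (z + (0 : ℝ) • w) := by simpa using h.hasFDerivAt
  exact (h'.comp_hasDerivAt (0 : ℝ) hline).hasDerivWithinAt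

/-- The Kelvin transform of `V` with radius `l` is `ζ`-close to that of the limiting bubble. -/
structure Near (μ ζ l : ℝ) (e : Euc n) (V : Euc n → ℝ) : Prop where
  lo : 5 / 2 ≤ l
  hi : l ≤ 27 / 10
  sq : 25 / 169 * l ^ 2 ≤ 1 + ζ
  ge : ∀ z, l ≤ ‖z‖ → (1 - ζ) * bubBase l e z ^ (-μ) ≤ kelvin μ l V z
  le : ∀ z, l ≤ ‖z‖ → kelvin μ l V z ≤ (1 + ζ) * bubBase l e z ^ (-μ)

lemma Near.pos {μ ζ l : ℝ} {e : Euc n} {V : Euc n → ℝ} (N : Near μ ζ l e V) : 0 < l := by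
  linarith [N.lo]

lemma kelvin_add_barrier_le {i : Fin n} {μ η T ρ τ ζ l : ℝ} {e : Euc n} {V K : Euc n → ℝ}
    (S : Setup i μ η T ρ τ e V K) (G : Good n μ ζ) (N : Near μ ζ l e V) (hη : η ≤ 1 / 100)
    {z : Euc n} (hz : l ≤ ‖z‖) :
    kelvin μ l V z + τ * barrier μ l e z ≤ 2 * bubBase l e z ^ (-μ) := by
  have h1 := N.le z hz
  have h2 := barrier_le' (μ := μ) S.hn (by linarith [N.lo]) S.he hz
  have hs := bubBase_pos N.pos S.he z
  have hB : 0 < bubBase l e z ^ (-μ) := by positivity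
  have h3 : τ * barrier μ l e z ≤ 1 / 100 * (13 * bubBase l e z ^ (-μ)) :=
    mul_le_mul (S.hτη.trans hη) h2 (barrier_nonneg N.pos S.he hz) (by norm_num)
  nlinarith [G.le]

lemma bubBase_rpow_neg_le {μ l : ℝ} (hμ : 0 ≤ μ) (hl : 0 < l) {e z : Euc n} (he : ‖e‖ = 1)
    (hz : z ≠ 0) : bubBase l e z ^ (-μ) ≤ 13 ^ μ * (‖z‖ ^ 2) ^ (-μ) := by
  have hr : 0 < ‖z‖ := norm_pos_iff.2 hz
  have h := bubBase_ge hl he z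
  have h1 : ‖z‖ ^ 2 / 13 ≤ bubBase l e z := by nlinarith
  calc _ ≤ (‖z‖ ^ 2 / 13) ^ (-μ) :=
        Real.rpow_le_rpow_of_nonpos (by positivity) h1 (by linarith)
    _ = _ := by
        rw [Real.div_rpow (by positivity) (by norm_num), Real.rpow_neg (by norm_num : (0:ℝ) ≤ 13)]
        field_simp

lemma outer_pos {μ ζ : ℝ} (hμ : 0 < μ) (G : Good n μ ζ) : ∀ᶠ η in 𝓝[>] (0 : ℝ),
    ∀ (i : Fin n) (T ρ τ : ℝ) (e : Euc n) (V K : Euc n → ℝ), Setup i μ η T ρ τ e V K →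
      ∀ l, Near μ ζ l e V → ∀ z ∈ dom i T ρ, ‖z‖ = ρ → 0 < sphereDiff μ τ l e V z := by
  have c1 : ∀ᶠ η in 𝓝[>] (0 : ℝ), η < min (1 / 100) ((2 * 13 ^ μ)⁻¹) :=
    (eventually_lt_nhds (by positivity)).filter_mono nhdsWithin_le_nhds
  filter_upwards [c1] with η hη i T ρ τ e V K S l N z hz hzρ
  obtain ⟨hη1, hη2⟩ := lt_min_iff.1 hη
  have hr : l ≤ ‖z‖ := by linarith [(S.hundred_le hη1.le).2.1, N.hi]
  have hz0 : z ≠ 0 := norm_pos_iff.1 (N.pos.trans_le hr)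
  have h1 := kelvin_add_barrier_le S G N hη1.le hr
  have h2 := bubBase_rpow_neg_le hμ.le N.pos S.he hz0
  have h3 := S.outer z hz hzρ
  have h4 : 2 * 13 ^ μ < η⁻¹ := by
    rwa [lt_inv_comm₀ (by positivity) S.hη]
  have hr0 : 0 < (‖z‖ ^ 2) ^ (-μ) := by
    have : 0 < ‖z‖ := N.pos.trans_le hr
    positivity
  have h5 := mul_lt_mul_of_pos_right h4 hr0
  rw [← hzρ] at h3
  unfold sphereDiff
  linarith

/-- A bound for the gradient of the limiting bubble near the origin. -/
def gradBound (μ : ℝ) : ℝ := 1 + 11 * μ * 2 ^ (μ + 1)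

lemma Setup.norm_grad_le {i : Fin n} {μ η T ρ τ : ℝ} {e : Euc n} {V K : Euc n → ℝ}
    (S : Setup i μ η T ρ τ e V K) (hη : η ≤ 1 / 100) {y γ : Euc n} {L : ℝ} (hy : ‖y‖ ≤ 3)
    (hV : HasLap V y γ L) : ‖γ‖ ≤ gradBound μ := by
  have hμ := S.one_le
  obtain ⟨-, -, h100⟩ := S.hundred_le hη
  have hs := bubBase_pos (l := 13 / 5) (by norm_num) S.he y
  have hsge := bubBase_ge (l := 13 / 5) (by norm_num) S.he y
  have hs2 : (1 / 2 : ℝ) ≤ bubBase (13 / 5) e y := by nlinarith [sq_nonneg ‖y‖]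
  have hb : HasFDerivAt (fun z => bubBase (13 / 5) e z) (innerSL ℝ ((2 : ℝ) • y - (24 / 5 : ℝ) • e)) y := by
    have h1 : HasFDerivAt (fun z : Euc n => ‖z‖ ^ 2) (2 • innerSL ℝ y) y :=
      (hasStrictFDerivAt_norm_sq y).hasFDerivAt
    have h2 : HasFDerivAt (fun z : Euc n => ⟪e, z⟫) (innerSL ℝ e) y := (innerSL ℝ e).hasFDerivAt
    have h3 := (h1.add_const ((13 / 5 : ℝ) ^ 2)).sub (h2.const_mul (24 / 13 * (13 / 5)))
    refine (h3.congr_fderiv ?_).congr_of_eventuallyEq (.of_forall fun z => ?_)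
    · ext w
      simp
      norm_num
    · simp [bubBase]
  have hb2 := hb.rpow_const (p := -μ) (.inl hs.ne')
  have hd := hV.hasFDerivAt.sub hb2
  have hle : ‖innerSL ℝ γ - (-μ * bubBase (13 / 5) e y ^ (-μ - 1)) •
      innerSL ℝ ((2 : ℝ) • y - (24 / 5 : ℝ) • e)‖ ≤ η := by
    refine hd.le_of_lip' S.hη.le ?_
    filter_upwards [Metric.ball_mem_nhds y one_pos] with z hz
    have hz' : ‖z - y‖ < 1 := by simpa [dist_eq_norm] using hz
    have : ‖z‖ ≤ 4 := by
      have := norm_add_le (z - y) y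
      simp only [sub_add_cancel] at this
      linarith
    simpa using S.closeLip z y (by linarith) (by linarith)
  have h2 : ‖(-μ * bubBase (13 / 5) e y ^ (-μ - 1)) •
      innerSL ℝ ((2 : ℝ) • y - (24 / 5 : ℝ) • e)‖ ≤ μ * 2 ^ (μ + 1) * 11 := by
    rw [norm_smul, innerSL_apply_norm, neg_mul, norm_neg,
      Real.norm_of_nonneg (by positivity)]
    have h3 : bubBase (13 / 5) e y ^ (-μ - 1) ≤ 2 ^ (μ + 1) := by
      calc _ ≤ (1 / 2 : ℝ) ^ (-μ - 1) :=
            Real.rpow_le_rpow_of_nonpos (by norm_num) hs2 (by linarith)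
        _ = _ := by
            rw [one_div, Real.inv_rpow (by norm_num), ← Real.rpow_neg (by norm_num)]
            ring_nf
    have h4 : ‖(2 : ℝ) • y - (24 / 5 : ℝ) • e‖ ≤ 11 := by
      refine (norm_sub_le _ _).trans ?_
      rw [norm_smul, norm_smul, S.he]
      norm_num
      linarith
    gcongr
  have h3 := norm_sub_norm_le (innerSL ℝ γ) ((-μ * bubBase (13 / 5) e y ^ (-μ - 1)) •
      innerSL ℝ ((2 : ℝ) • y - (24 / 5 : ℝ) • e))
  rw [innerSL_apply_norm] at h3
  unfold gradBound
  linarith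

lemma flat_ne_zero {μ ζ : ℝ} (hμ : 0 < μ) (G : Good n μ ζ) : ∀ᶠ η in 𝓝[>] (0 : ℝ),
    ∀ (i : Fin n) (T ρ τ : ℝ) (e : Euc n) (V K : Euc n → ℝ), Setup i μ η T ρ τ e V K →
      ∀ l, Near μ ζ l e V → (∀ z ∈ dom i T ρ, ‖z‖ ≤ l ∨ 0 ≤ sphereDiff μ τ l e V z) →
        ∀ z, ‖z‖ < ρ → z i = -T → sphereDiff μ τ l e V z ≠ 0 := by
  set C := 3 * 36 ^ (μ + 1) * gradBound μ + 1000 * (μ + 2) with hC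
  have hg : 0 < gradBound μ := by unfold gradBound; positivity
  have hC0 : 0 < C := by positivity
  have c1 : ∀ᶠ η in 𝓝[>] (0 : ℝ), η < min (1 / 104) ((26 * C)⁻¹) :=
    (eventually_lt_nhds (by positivity)).filter_mono nhdsWithin_le_nhds
  filter_upwards [c1] with η hη i T ρ τ e V K S l N hA z hzρ hzT hW
  obtain ⟨hη1, hη2⟩ := lt_min_iff.1 hη
  have hη3 : η ≤ 1 / 100 := by linarith
  have hμ1 := S.one_le
  obtain ⟨hT, hρ, -⟩ := S.hundred_le hη3
  have hTC : 26 * C < T := by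
    refine lt_of_lt_of_le ?_ S.hT
    rwa [lt_inv_comm₀ (by positivity) S.hη]
  have hTr : T ≤ ‖z‖ := by
    have := PiLp.norm_apply_le z i
    rw [hzT, norm_neg] at this
    exact (le_abs_self T).trans this
  have hl := N.pos
  have hlr : l < ‖z‖ := by linarith [N.hi]
  have hr : 0 < ‖z‖ := hl.trans hlr
  have hz0 : z ≠ 0 := norm_pos_iff.1 hr
  obtain ⟨hy1, hy2⟩ := norm_reflect hl hlr.le
  have hy3 : ‖(l ^ 2 * (‖z‖ ^ 2)⁻¹) • z‖ ≤ 3 := by linarith [N.hi]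
  obtain ⟨hyd, hyρ, hyT, -⟩ := S.small_mem hη3 (hy3.trans (by norm_num))
  obtain ⟨γ, hVy⟩ := S.lap _ hyρ hyT
  have hγ := S.norm_grad_le hη3 hy3 hVy
  have hK := hasLap_kelvin S.hμ hl hz0 hVy
  obtain ⟨gb, Lb, hB, hgb, -⟩ := hasLap_barrier S.hμ S.hn hl S.he hlr.le
  obtain ⟨d, hd, hVd⟩ := S.flat z hzρ hzT
  set ei : Euc n := EuclideanSpace.single i 1 with hei
  have hWd := (hVd.sub (hK.hasDerivWithinAt_line ei)).sub ((hB.hasDerivWithinAt_line ei).const_mul τ)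
  have hs := bubBase_pos hl S.he z
  have hsge := bubBase_ge hl S.he z
  have hsle : bubBase l e z ≤ 4 * ‖z‖ ^ 2 := by
    have := (abs_le.1 (abs_inner_le S.he z)).1
    unfold bubBase
    nlinarith
  have hX := N.ge z hlr.le
  have hV2 : V z ≤ 2 * bubBase l e z ^ (-μ) := by
    have := kelvin_add_barrier_le S G N hη3 hlr.le
    unfold sphereDiff at hW
    linarith
  have hzd : z ∈ dom i T ρ := ⟨hzρ.le, hzT.ge⟩
  have hVp : V z ^ ((μ + 1) / μ) ≤ 4 * bubBase l e z ^ (-(μ + 1)) := by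
    calc _ ≤ (2 * bubBase l e z ^ (-μ)) ^ ((μ + 1) / μ) :=
          Real.rpow_le_rpow (S.pos z hzd).le hV2 (by positivity)
      _ = 2 ^ ((μ + 1) / μ) * bubBase l e z ^ (-(μ + 1)) := by
          rw [Real.mul_rpow (by norm_num) (by positivity), ← Real.rpow_mul hs.le]
          congr 2
          field_simp
      _ ≤ 2 ^ (2 : ℝ) * bubBase l e z ^ (-(μ + 1)) := by
          gcongr
          · norm_num
          · rw [div_le_iff₀ hμ]; linarith
      _ = _ := by norm_num
  have hneg : d - ⟪(l ^ 2 * (‖z‖ ^ 2)⁻¹) ^ μ • ((l ^ 2 * (‖z‖ ^ 2)⁻¹) • γ -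
      (2 * (l ^ 2 * (‖z‖ ^ 2)⁻¹) * ⟪γ, z⟫ / ‖z‖ ^ 2) • z) -
      (2 * μ * kelvin μ l V z / ‖z‖ ^ 2) • z, ei⟫ - τ * ⟪gb, ei⟫ < 0 := by
    set s := bubBase l e z
    set m := l ^ 2 * (‖z‖ ^ 2)⁻¹ with hm
    have hm0 : 0 < m := by positivity
    have hms : m ≤ 36 * s⁻¹ := by
      rw [hm, ← div_eq_mul_inv, ← div_eq_mul_inv, div_le_div_iff₀ (by positivity) hs]
      have h9 : l ^ 2 ≤ 9 := by nlinarith only [N.hi, hl]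
      calc l ^ 2 * s ≤ 9 * (4 * ‖z‖ ^ 2) := by gcongr
        _ = _ := by ring
    set B := s ^ (-(μ + 1)) with hBdef
    have hB0 : 0 < B := by positivity
    have hmB : m ^ μ * m ≤ 36 ^ (μ + 1) * B := by
      rw [← Real.rpow_add_one hm0.ne']
      calc _ ≤ (36 * s⁻¹) ^ (μ + 1) := by gcongr
        _ = _ := by
          rw [Real.mul_rpow (by norm_num) (by positivity), hBdef, Real.rpow_neg hs.le,
            Real.inv_rpow hs.le]
    have hzi : ⟪z, ei⟫ = -T := by
      rw [hei, EuclideanSpace.inner_single_right]; simp [hzT]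
    have heiN : ‖ei‖ = 1 := by simp [hei]
    have hγi : |⟪γ, ei⟫| ≤ ‖γ‖ := by simpa [heiN] using abs_real_inner_le_norm γ ei
    have hgi : |⟪gb, ei⟫| ≤ ‖gb‖ := by simpa [heiN] using abs_real_inner_le_norm gb ei
    have hγz := abs_real_inner_le_norm γ z
    have hterm : |⟪γ, z⟫ / ‖z‖ ^ 2 * T| ≤ ‖γ‖ := by
      rw [abs_mul, abs_div, abs_of_nonneg (sq_nonneg ‖z‖), abs_of_nonneg (by linarith : 0 ≤ T),
        div_mul_eq_mul_div, div_le_iff₀ (by positivity)]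
      calc _ ≤ ‖γ‖ * ‖z‖ * ‖z‖ := by gcongr
        _ = _ := by ring
    have hexp : ⟪m ^ μ • (m • γ - (2 * m * ⟪γ, z⟫ / ‖z‖ ^ 2) • z) -
        (2 * μ * kelvin μ l V z / ‖z‖ ^ 2) • z, ei⟫
        = m ^ μ * m * (⟪γ, ei⟫ + 2 * (⟪γ, z⟫ / ‖z‖ ^ 2 * T))
          + 2 * μ * kelvin μ l V z * T / ‖z‖ ^ 2 := by
      simp only [inner_sub_left, real_inner_smul_left, hzi]
      ring
    rw [hexp]
    have b1 : -(36 ^ (μ + 1) * B * (3 * gradBound μ))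
        ≤ m ^ μ * m * (⟪γ, ei⟫ + 2 * (⟪γ, z⟫ / ‖z‖ ^ 2 * T)) := by
      have h1 : -(3 * gradBound μ) ≤ ⟪γ, ei⟫ + 2 * (⟪γ, z⟫ / ‖z‖ ^ 2 * T) := by
        linarith [(abs_le.1 hγi).1, (abs_le.1 hterm).1]
      calc _ ≤ -(m ^ μ * m * (3 * gradBound μ)) := by gcongr
        _ = m ^ μ * m * (-(3 * gradBound μ)) := by ring
        _ ≤ _ := by gcongr
    have b2 : T / 13 * B ≤ 2 * μ * kelvin μ l V z * T / ‖z‖ ^ 2 := by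
      rw [le_div_iff₀ (by positivity)]
      have hsB : s ^ (-μ) = B * s := by
        rw [hBdef, ← Real.rpow_add_one hs.ne']; ring_nf
      have h1 : (99 / 100 : ℝ) * (B * s) ≤ kelvin μ l V z := by
        rw [← hsB]
        refine le_trans ?_ hX
        gcongr
        linarith [G.le]
      have h2 : ‖z‖ ^ 2 ≤ 13 * s := by nlinarith only [hsge, hl]
      calc T / 13 * B * ‖z‖ ^ 2 ≤ T / 13 * B * (13 * s) := by gcongr
        _ = 1 * ((B * s) * T) := by ring
        _ ≤ (2 * μ * (99 / 100)) * ((B * s) * T) :=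
          mul_le_mul_of_nonneg_right (by linarith) (by positivity)
        _ = 2 * μ * (99 / 100 * (B * s)) * T := by ring
        _ ≤ _ := by gcongr
    have b3 : d ≤ T / 26 * B := by
      calc d ≤ η * T * V z ^ ((μ + 1) / μ) := hd
        _ ≤ 1 / 104 * T * (4 * B) := by
          have h1 := S.hη
          have h2 := S.pos z hzd
          gcongr
        _ = _ := by ring
    have b4 : -(1 * (1000 * (μ + 2) * B)) ≤ τ * ⟪gb, ei⟫ := by
      have h1 : |τ * ⟪gb, ei⟫| ≤ 1 * (1000 * (μ + 2) * B) := by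
        rw [abs_mul, abs_of_pos S.hτ]
        have : τ ≤ 1 := by linarith [S.hτη]
        gcongr
        exact hgi.trans hgb
      exact (abs_le.1 h1).1
    have b5 : 26 * C * B < T * B := by gcongr
    rw [hC] at b5
    linarith
  have hmem : ∀ᶠ t in 𝓝[>] (0 : ℝ), 0 ≤ sphereDiff μ τ l e V (z + t • ei) := by
    have hcont : ContinuousAt (fun t : ℝ => ‖z + t • ei‖) 0 := by fun_prop
    have h1 := (hcont.tendsto.eventually_lt_const (by simpa using hzρ)).filter_mono
      (nhdsWithin_le_nhds (s := Ioi 0))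
    have h2 := (hcont.tendsto.eventually_const_lt (u := l) (by simpa using hlr)).filter_mono
      (nhdsWithin_le_nhds (s := Ioi 0))
    filter_upwards [h1, h2, self_mem_nhdsWithin] with t h1 h2 (ht : 0 < t)
    refine (hA _ ⟨h1.le, ?_⟩).resolve_left (by linarith)
    simp [hei, hzT, ht.le]
  refine hneg.not_ge (nonneg_of_hasDerivWithinAt_Ici hWd ?_)
  filter_upwards [hmem] with t ht
  have h0 : sphereDiff μ τ l e V (z + (0 : ℝ) • ei) = 0 := by rw [zero_smul, add_zero, hW]
  exact h0.trans_le ht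

end Boundary

section Start

variable {n : ℕ}

lemma hasLap_fundamental {μ : ℝ} (hμ : μ = ((n : ℝ) - 2) / 2) {z : Euc n} (hz : z ≠ 0) :
    HasLap (fun y => (‖y‖ ^ 2) ^ (-μ)) z ((-μ * (‖z‖ ^ 2) ^ (-μ - 1)) • (2 : ℝ) • z) 0 := by
  have hr : 0 < ‖z‖ := norm_pos_iff.2 hz
  have hr2 : 0 < ‖z‖ ^ 2 := by positivity
  have h1 : ∀ᶠ t in 𝓝 (‖z‖ ^ 2), HasDerivAt (fun t : ℝ => t ^ (-μ)) (-μ * t ^ (-μ - 1)) t := by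
    filter_upwards [lt_mem_nhds hr2] with t ht
    exact Real.hasDerivAt_rpow_const (.inl ht.ne')
  have h2 := (Real.hasDerivAt_rpow_const (x := ‖z‖ ^ 2) (p := -μ - 1) (.inl hr2.ne')).const_mul (-μ)
  refine ((HasLap.norm_sq z).comp h1 h2).congr rfl ?_
  rw [real_inner_smul_left, real_inner_smul_right, real_inner_self_eq_norm_sq,
    Real.rpow_sub_one hr2.ne' (-μ - 1), hμ]
  field_simp
  ring

/-- Lower bound for `V` away from the origin by a multiple of the fundamental solution. -/
lemma Setup.far_lower {i : Fin n} {μ η T ρ τ : ℝ} {e : Euc n} {V K : Euc n → ℝ}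
    (S : Setup i μ η T ρ τ e V K) (hη : η ≤ 1 / 100) {A ρ₁ : ℝ} (hA0 : 0 < A) (hA1 : A ≤ 1)
    (hρ₁ : 0 < ρ₁) (hlow : ∀ z ∈ dom i T ρ, ‖z‖ = ρ₁ → A * (‖z‖ ^ 2) ^ (-μ) ≤ V z) :
    ∀ z ∈ dom i T ρ, ρ₁ ≤ ‖z‖ → A * (‖z‖ ^ 2) ^ (-μ) ≤ V z := by
  have hμ := S.one_le
  obtain ⟨hT, hρ, h100⟩ := S.hundred_le hη
  set D : Set (Euc n) := dom i T ρ ∩ {z | ρ₁ ≤ ‖z‖} with hD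
  have hDc : IsCompact D := by
    have h1 : IsClosed D := by
      refine IsClosed.inter (IsClosed.inter ?_ ?_) (isClosed_le continuous_const continuous_norm)
      · exact isClosed_le continuous_norm continuous_const
      · exact isClosed_le continuous_const (by fun_prop : Continuous fun w : Euc n => w i)
    refine (isCompact_closedBall (0 : Euc n) ρ).of_isClosed_subset h1 fun z hz => ?_
    simpa using hz.1.1
  intro z hz hzρ
  set F : Euc n → ℝ := fun y => V y - A * (‖y‖ ^ 2) ^ (-μ) with hF
  have hFc : ContinuousOn F D := by
    refine (S.cont.mono inter_subset_left).sub (continuousOn_const.mul ?_)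
    refine ContinuousOn.rpow_const (by fun_prop) fun y hy => .inl ?_
    have : 0 < ‖y‖ := hρ₁.trans_le hy.2
    positivity
  obtain ⟨y, hy, hmin⟩ := hDc.exists_isMinOn ⟨z, hz, hzρ⟩ hFc
  have hyz : F y ≤ F z := hmin ⟨hz, hzρ⟩
  suffices 0 ≤ F y by
    have : 0 ≤ F z := this.trans hyz
    simpa [hF] using this
  by_contra! hneg
  have hyr : 0 < ‖y‖ := hρ₁.trans_le hy.2
  have hy0 : y ≠ 0 := norm_pos_iff.1 hyr
  have hy1 : ρ₁ < ‖y‖ := by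
    refine lt_of_le_of_ne hy.2 fun h => ?_
    have := hlow y hy.1 h.symm
    simp only [hF] at hneg
    linarith
  have hy2 : ‖y‖ < ρ := by
    refine lt_of_le_of_ne hy.1.1 fun h => ?_
    have h1 := S.outer y hy.1 h
    rw [← h] at h1
    have h2 : A * (‖y‖ ^ 2) ^ (-μ) ≤ η⁻¹ * (‖y‖ ^ 2) ^ (-μ) := by
      gcongr
      linarith
    simp only [hF] at hneg
    linarith
  have hK : 0 < K y := by
    have hn4 : (4 : ℝ) ≤ n := by exact_mod_cast S.hn
    have := (abs_le.1 (S.Kclose y hy.1)).1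
    nlinarith only [hn4, this, hη]
  have hVy := S.pos y hy.1
  rcases hy.1.2.lt_or_eq with hyT | hyT
  · obtain ⟨g, hg⟩ := S.lap y hy2 hyT
    have hL := hg.sub ((hasLap_fundamental S.hμ hy0).const_mul A)
    have hmin' : IsLocalMin F y := by
      refine hmin.isLocalMin ?_
      have c1 := continuous_norm.continuousAt (x := y)
      have c2 : ContinuousAt (fun w : Euc n => w i) y := by fun_prop
      filter_upwards [c1.eventually_lt_const hy2, c1.eventually_const_lt hy1,
        c2.eventually_const_lt hyT] with w h1 h2 h3
      exact ⟨⟨h1.le, h3.le⟩, h2.le⟩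
    have h1 := hL.nonneg_of_isLocalMin hmin'
    have h2 : 0 < K y * V y ^ ((μ + 2) / μ) := by positivity
    linarith
  · obtain ⟨d, hd, hVd⟩ := S.flat y hy2 hyT.symm
    have hFd := hVd.sub (((hasLap_fundamental S.hμ hy0).const_mul A).hasDerivWithinAt_line
      (EuclideanSpace.single i 1))
    have h1 := nonneg_of_hasDerivWithinAt_Ici hFd ?_
    · have hyi : ⟪y, EuclideanSpace.single i (1 : ℝ)⟫ = -T := by
        rw [EuclideanSpace.inner_single_right]; simp [← hyT]
      simp only [real_inner_smul_left, hyi] at h1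
      have hB : 0 < (‖y‖ ^ 2) ^ (-μ - 1) := by positivity
      have h2 : V y ^ ((μ + 1) / μ) ≤ A * (‖y‖ ^ 2) ^ (-μ - 1) := by
        have h3 : V y ≤ A * (‖y‖ ^ 2) ^ (-μ) := by
          simp only [hF] at hneg
          linarith
        calc _ ≤ (A * (‖y‖ ^ 2) ^ (-μ)) ^ ((μ + 1) / μ) :=
              Real.rpow_le_rpow hVy.le h3 (by positivity)
          _ = A ^ ((μ + 1) / μ) * (‖y‖ ^ 2) ^ (-μ - 1) := by
              rw [Real.mul_rpow hA0.le (by positivity), ← Real.rpow_mul (by positivity)]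
              congr 2
              field_simp
              ring
          _ ≤ A ^ (1 : ℝ) * (‖y‖ ^ 2) ^ (-μ - 1) := by
              gcongr ?_ * _
              refine Real.rpow_le_rpow_of_exponent_ge hA0 hA1 ?_
              rw [le_div_iff₀ (by linarith)]
              linarith
          _ = _ := by rw [Real.rpow_one]
      have h4 : d ≤ 1 * T * (A * (‖y‖ ^ 2) ^ (-μ - 1)) := by
        refine hd.trans ?_
        have h5 := S.hη
        gcongr
        linarith
      have h6 : 0 < T * (A * (‖y‖ ^ 2) ^ (-μ - 1)) := by positivity
      have h7 := mul_le_mul_of_nonneg_right hμ h6.le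
      linarith
    · have c1 : ContinuousAt (fun t : ℝ => ‖y + t • (EuclideanSpace.single i 1 : Euc n)‖) 0 := by
        fun_prop
      have k1 := (c1.tendsto.eventually_lt_const (by simpa using hy2)).filter_mono
        (nhdsWithin_le_nhds (s := Ioi 0))
      have k2 := (c1.tendsto.eventually_const_lt (u := ρ₁) (by simpa using hy1)).filter_mono
        (nhdsWithin_le_nhds (s := Ioi 0))
      filter_upwards [k1, k2, self_mem_nhdsWithin] with t k1 k2 (ht : 0 < t)
      have hmem : y + t • (EuclideanSpace.single i 1 : Euc n) ∈ D :=
        ⟨⟨k1.le, by simp [← hyT, ht.le]⟩, k2.le⟩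
      have : F y ≤ F (y + t • (EuclideanSpace.single i 1 : Euc n)) := hmin hmem
      simpa [hF] using this

end Start

section StartFar

variable {n : ℕ}

lemma bubBase_le_sq {e z : Euc n} (he : ‖e‖ = 1) :
    bubBase (13 / 5) e z ≤ ‖z‖ ^ 2 + (169 / 25 + 24 / 5 * ‖z‖) := by
  have := (abs_le.1 (abs_inner_le he z)).1
  unfold bubBase
  linarith

lemma kelBase_sub_bubBase {l : ℝ} (hl : 0 < l) (e z : Euc n) :
    kelBase l e z - bubBase (13 / 5) e z = (169 / 25 - l ^ 2) * (‖z‖ ^ 2 - l ^ 2) / l ^ 2 := by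
  unfold kelBase bubBase
  field_simp
  ring

lemma rpow_neg_sub_ge {a b μ : ℝ} (ha : 0 < a) (hab : a ≤ b) (hμ : 1 ≤ μ) :
    b ^ (-μ) * ((b - a) / a) ≤ a ^ (-μ) - b ^ (-μ) := by
  have hb : 0 < b := ha.trans_le hab
  have h0 : 0 ≤ (b - a) / a := div_nonneg (by linarith) ha.le
  have h1 := one_add_mul_self_le_rpow_one_add (s := (b - a) / a) (by linarith) hμ
  have h2 : 1 + (b - a) / a = b / a := by field_simp; ring
  have h3 : a ^ (-μ) = b ^ (-μ) * (b / a) ^ μ := by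
    rw [Real.div_rpow hb.le ha.le, Real.rpow_neg ha.le, Real.rpow_neg hb.le]
    field_simp
  rw [h2] at h1
  have h4 : 1 + (b - a) / a ≤ (b / a) ^ μ := by nlinarith
  have h5 := mul_le_mul_of_nonneg_left h4 (by positivity : 0 ≤ b ^ (-μ))
  rw [h3]
  linarith

set_option maxHeartbeats 1000000 in
lemma start_near {μ θ : ℝ} (hn : 4 ≤ n) (hμ : 1 ≤ μ) (hθ : 0 < θ) (hθ1 : θ ≤ 1 / 10) {R : ℝ}
    (hR : 0 < R) : ∀ᶠ η in 𝓝[>] (0 : ℝ), ∀ (i : Fin n) (T ρ τ : ℝ) (e : Euc n) (V K : Euc n → ℝ),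
      Setup i μ η T ρ τ e V K → ∀ z, 13 / 5 - θ ≤ ‖z‖ → ‖z‖ ≤ R →
        0 ≤ sphereDiff μ τ (13 / 5 - θ) e V z := by
  set Q := (R + 13 / 5) ^ 2 with hQ
  set c₁ := (2 * Q) ^ (-μ) * (3 * θ / Q) with hc₁
  have hQ0 : 0 < Q := by positivity
  have hc0 : 0 < c₁ := by positivity
  have c1 : ∀ᶠ η in 𝓝[>] (0 : ℝ), η < min (min (1 / 100) R⁻¹) (c₁ / (2 + μ + 4 * 2 ^ (μ + 1))) :=
    (eventually_lt_nhds (by positivity)).filter_mono nhdsWithin_le_nhds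
  filter_upwards [c1] with η hη i T ρ τ e V K S z hlz hzR
  obtain ⟨hη', hη3⟩ := lt_min_iff.1 hη
  obtain ⟨hη1, hη2⟩ := lt_min_iff.1 hη'
  rw [lt_div_iff₀ (by positivity)] at hη3
  set l := 13 / 5 - θ with hl
  have hl0 : 0 < l := by linarith
  have hl1 : 5 / 2 ≤ l := by linarith
  have hl2 : l ≤ 13 / 5 := by linarith
  have hr : 0 < ‖z‖ := hl0.trans_le hlz
  have hz0 : z ≠ 0 := norm_pos_iff.1 hr
  have hη0 := S.hη
  have hzη : ‖z‖ ≤ η⁻¹ := by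
    rw [lt_inv_comm₀ hη0 hR] at hη2
    linarith
  obtain ⟨hy1, hy2⟩ := norm_reflect hl0 hlz
  have hkb := kelvin_bub μ hl0 S.he hz0
  set m := l ^ 2 * (‖z‖ ^ 2)⁻¹ with hm
  have hm0 : 0 < m := by positivity
  have h1m : 1 - m = (‖z‖ ^ 2 - l ^ 2) / ‖z‖ ^ 2 := by rw [hm]; field_simp
  have hdr : ‖z‖ ^ 2 - l ^ 2 ≤ 2 * ‖z‖ * (‖z‖ - l) := by nlinarith only [sq_nonneg (‖z‖ - l)]
  have hdr0 : 0 ≤ ‖z‖ - l := by linarith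
  have h1m0 : 0 ≤ 1 - m := by
    rw [h1m]
    exact div_nonneg (by nlinarith only [hlz, hl0]) (by positivity)
  have h1mr : (1 - m) * ‖z‖ ≤ 2 * (‖z‖ - l) := by
    rw [h1m, div_mul_eq_mul_div, div_le_iff₀ (by positivity)]
    nlinarith only [mul_le_mul_of_nonneg_right hdr hr.le, hr]
  have h1m1 : 1 - m ≤ ‖z‖ - l := by nlinarith only [h1mr, h1m0, hlz, hl1]
  obtain ⟨-, -, -, hyη⟩ := S.small_mem hη1.le (y := m • z) (by linarith)
  have hE := S.closeLip z (m • z) hzη hyη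
  have hEy := S.close (m • z) hyη
  have hzy : ‖z - m • z‖ ≤ 2 * (‖z‖ - l) := by
    have : z - m • z = (1 - m) • z := by rw [sub_smul, one_smul]
    rwa [this, norm_smul, Real.norm_of_nonneg h1m0]
  have hmμ : 1 - μ * (1 - m) ≤ m ^ μ := by
    have := one_add_mul_self_le_rpow_one_add (s := m - 1) (by linarith) hμ
    rw [add_sub_cancel] at this
    linarith
  have hmμ1 : m ^ μ ≤ 1 := Real.rpow_le_one hm0.le (by linarith) (by linarith)
  have ha := bubBase_pos (l := 13 / 5) (by norm_num) S.he z
  have haQ : bubBase (13 / 5) e z ≤ Q := by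
    have := bubBase_le_sq (z := z) S.he
    rw [hQ]
    nlinarith only [this, hzR, hr]
  have hba := kelBase_sub_bubBase hl0 e z
  have hba1 : 3 * θ * (‖z‖ - l) ≤ kelBase l e z - bubBase (13 / 5) e z := by
    rw [hba, le_div_iff₀ (by positivity)]
    have e1 : 169 / 25 - l ^ 2 = θ * (13 / 5 + l) := by rw [hl]; ring
    have e2 : ‖z‖ ^ 2 - l ^ 2 = (‖z‖ - l) * (‖z‖ + l) := by ring
    rw [e1, e2]
    have e3 : 3 * l ^ 2 ≤ (13 / 5 + l) * (‖z‖ + l) := by nlinarith only [hlz, hl2, hl0]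
    calc _ = θ * (‖z‖ - l) * (3 * l ^ 2) := by ring
      _ ≤ θ * (‖z‖ - l) * ((13 / 5 + l) * (‖z‖ + l)) := by gcongr
      _ = _ := by ring
  have hb := kelBase_pos hl0 S.he hz0
  have hbQ : kelBase l e z ≤ 2 * Q := by
    have h1 : kelBase l e z - bubBase (13 / 5) e z ≤ Q := by
      rw [hba, div_le_iff₀ (by positivity)]
      have h2 : 169 / 25 - l ^ 2 ≤ l ^ 2 := by nlinarith only [hl1]
      have h3 : ‖z‖ ^ 2 - l ^ 2 ≤ Q := by rw [hQ]; nlinarith only [hzR, hr, hl0]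
      calc _ ≤ l ^ 2 * Q := mul_le_mul h2 h3 (by nlinarith only [hlz, hl0]) (by positivity)
        _ = _ := by ring
    linarith
  have hmain : c₁ * (‖z‖ - l) ≤ bubBase (13 / 5) e z ^ (-μ) - kelBase l e z ^ (-μ) := by
    have h3 : 0 ≤ 3 * θ * (‖z‖ - l) := by positivity
    refine le_trans ?_ (rpow_neg_sub_ge ha (by linarith) hμ)
    calc c₁ * (‖z‖ - l) = (2 * Q) ^ (-μ) * (3 * θ * (‖z‖ - l) / Q) := by rw [hc₁]; ring
      _ ≤ _ := by
        have h4 : (2 * Q) ^ (-μ) ≤ kelBase l e z ^ (-μ) :=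
          Real.rpow_le_rpow_of_nonpos hb hbQ (by linarith)
        have h5 : 0 ≤ kelBase l e z - bubBase (13 / 5) e z := h3.trans hba1
        gcongr
  have hbar : τ * barrier μ l e z ≤ η * (4 * 2 ^ (μ + 1) * (‖z‖ - l)) := by
    have hs := bubBase_ge hl0 S.he z
    have hs2 : (1 / 2 : ℝ) ≤ bubBase l e z := by nlinarith only [hs, hl1, hlz]
    have hs3 : bubBase l e z ^ (-(μ + 1)) ≤ 2 ^ (μ + 1) := by
      calc _ ≤ (1 / 2 : ℝ) ^ (-(μ + 1)) :=
            Real.rpow_le_rpow_of_nonpos (by norm_num) hs2 (by linarith)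
        _ = _ := by rw [one_div, Real.inv_rpow (by norm_num), Real.rpow_neg (by norm_num), inv_inv]
    have hs4 : (‖z‖ ^ 2 - l ^ 2) / ‖z‖ ≤ 2 * (‖z‖ - l) := by
      rw [div_le_iff₀ hr]; linarith
    have h5 := barrier_nonneg (μ := μ) hl0 S.he hlz
    have h6 : barrier μ l e z ≤ 4 * 2 ^ (μ + 1) * (‖z‖ - l) := by
      refine (barrier_le hn hl0 S.he hlz).trans ?_
      have : 0 < bubBase l e z ^ (-(μ + 1)) := by
        have := bubBase_pos hl0 S.he z
        positivity
      calc _ ≤ 2 * (2 * (‖z‖ - l)) * 2 ^ (μ + 1) := by gcongr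
        _ = _ := by ring
    exact mul_le_mul S.hτη h6 h5 hη0.le
  have hkel : kelvin μ l V z = kelBase l e z ^ (-μ)
      + m ^ μ * (V (m • z) - bubBase (13 / 5) e (m • z) ^ (-μ)) := by
    rw [← hkb]
    unfold kelvin
    ring
  have herr : (1 - m ^ μ) * |V (m • z) - bubBase (13 / 5) e (m • z) ^ (-μ)|
      ≤ μ * (‖z‖ - l) * η := by
    refine mul_le_mul ?_ hEy (abs_nonneg _) (by positivity)
    nlinarith only [hmμ, h1m1, hμ]
  have herr2 : -((1 - m ^ μ) * |V (m • z) - bubBase (13 / 5) e (m • z) ^ (-μ)|)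
      ≤ (1 - m ^ μ) * (V (m • z) - bubBase (13 / 5) e (m • z) ^ (-μ)) := by
    rw [← mul_neg]
    exact mul_le_mul_of_nonneg_left (neg_abs_le _) (by linarith)
  have hE1 := (abs_le.1 hE).1
  have hE2 : η * ‖z - m • z‖ ≤ η * (2 * (‖z‖ - l)) := by gcongr
  have hfin := mul_le_mul_of_nonneg_right hη3.le hdr0
  unfold sphereDiff
  rw [hkel]
  linarith

lemma start_far {μ θ : ℝ} (hn : 4 ≤ n) (hμ : 1 ≤ μ) (hθ : 0 < θ) (hθ1 : θ ≤ 1 / 10) :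
    ∃ R > 0, ∀ᶠ η in 𝓝[>] (0 : ℝ), ∀ (i : Fin n) (T ρ τ : ℝ) (e : Euc n) (V K : Euc n → ℝ),
      Setup i μ η T ρ τ e V K → ∀ z ∈ dom i T ρ, R ≤ ‖z‖ →
        0 ≤ sphereDiff μ τ (13 / 5 - θ) e V z := by
  set l := 13 / 5 - θ with hl
  have hl0 : 0 < l := by linarith
  have hl1 : 5 / 2 ≤ l := by linarith
  set q := (169 / 25) / l ^ 2 with hq
  have hq1 : 1 < q := by
    rw [hq, one_lt_div (by positivity)]
    nlinarith
  set q₁ := (1 + q) / 2 with hq₁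
  have hq₁1 : 1 < q₁ := by linarith
  have hq₁q : q₁ < q := by linarith
  have hb1 : q₁ ^ (-μ) < 1 := Real.rpow_lt_one_of_one_lt_of_neg hq₁1 (by linarith)
  have hb0 : 0 < q₁ ^ (-μ) := by positivity
  set A := (1 + q₁ ^ (-μ)) / 2 with hA
  have hA1 : A < 1 := by linarith
  have hA0 : q₁ ^ (-μ) < A := by linarith
  have hlim : Tendsto (fun R : ℝ => (1 + (169 / 25 * (R⁻¹ * R⁻¹) + 24 / 5 * R⁻¹)) ^ (-μ)) atTop
      (𝓝 1) := by
    have h1 : Tendsto (fun R : ℝ => 1 + (169 / 25 * (R⁻¹ * R⁻¹) + 24 / 5 * R⁻¹)) atTop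
        (𝓝 (1 + (169 / 25 * (0 * 0) + 24 / 5 * 0))) :=
      tendsto_const_nhds.add (((tendsto_inv_atTop_zero.mul tendsto_inv_atTop_zero).const_mul _).add
        (tendsto_inv_atTop_zero.const_mul _))
    have h2 := h1.rpow_const (p := -μ) (.inl (by norm_num))
    simpa using h2
  obtain ⟨R, hRlim, hRq, hR3⟩ := ((hlim.eventually_const_lt hA1).and
    ((eventually_ge_atTop (24 / 5 / (q - q₁))).and (eventually_ge_atTop (3 : ℝ)))).exists
  have hR0 : 0 < R := by linarith
  refine ⟨R, hR0, ?_⟩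
  set A₂ := (1 + (169 / 25 * (R⁻¹ * R⁻¹) + 24 / 5 * R⁻¹)) ^ (-μ) with hA₂
  have c1 : ∀ᶠ η in 𝓝[>] (0 : ℝ), η < min (min (1 / 100) R⁻¹) (min ((A₂ - A) * (R ^ 2) ^ (-μ))
      ((A - q₁ ^ (-μ)) / (9 ^ μ + 13 * 13 ^ μ))) := by
    have h1 : 0 < A₂ - A := by linarith
    have h2 : 0 < A - q₁ ^ (-μ) := by linarith
    exact (eventually_lt_nhds (by positivity)).filter_mono nhdsWithin_le_nhds
  filter_upwards [c1] with η hη i T ρ τ e V K S z hz hzR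
  obtain ⟨hη', hη''⟩ := lt_min_iff.1 hη
  obtain ⟨hη1, hη2⟩ := lt_min_iff.1 hη'
  obtain ⟨hη3, hη4⟩ := lt_min_iff.1 hη''
  rw [lt_div_iff₀ (by positivity)] at hη4
  have hη0 := S.hη
  rw [lt_inv_comm₀ hη0 hR0] at hη2
  have hV := S.far_lower hη1.le (A := A) (ρ₁ := R) (by linarith) hA1.le hR0 (fun w _ hwR => by
    have h1 := (abs_le.1 (S.close w (by linarith))).1
    have h2 := bubBase_le_sq (z := w) S.he
    have h3 : A₂ * (R ^ 2) ^ (-μ) ≤ bubBase (13 / 5) e w ^ (-μ) := by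
      rw [hA₂, ← Real.mul_rpow (by positivity) (by positivity)]
      refine Real.rpow_le_rpow_of_nonpos (bubBase_pos (by norm_num) S.he w) ?_ (by linarith)
      rw [hwR] at h2
      refine h2.trans_eq ?_
      field_simp
    rw [hwR]
    linarith) z hz hzR
  have hlz : l ≤ ‖z‖ := by linarith
  have hr : 0 < ‖z‖ := hl0.trans_le hlz
  have hz0 : z ≠ 0 := norm_pos_iff.1 hr
  obtain ⟨hy1, hy2⟩ := norm_reflect hl0 hlz
  have hkb := kelvin_bub μ hl0 S.he hz0
  set m := l ^ 2 * (‖z‖ ^ 2)⁻¹ with hm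
  obtain ⟨-, -, -, hyη⟩ := S.small_mem hη1.le (y := m • z) (by linarith)
  have hEy := S.close (m • z) hyη
  set P := (‖z‖ ^ 2) ^ (-μ) with hP
  have hP0 : 0 < P := by positivity
  have hbar : τ * barrier μ l e z ≤ η * (13 * (13 ^ μ * P)) := by
    refine mul_le_mul S.hτη ?_ (barrier_nonneg hl0 S.he hlz) hη0.le
    refine (barrier_le' hn (by linarith) S.he hlz).trans ?_
    gcongr
    exact bubBase_rpow_neg_le (by linarith) hl0 S.he hz0
  have hkB : kelBase l e z ^ (-μ) ≤ q₁ ^ (-μ) * P := by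
    rw [hP, ← Real.mul_rpow (by linarith) (by positivity)]
    refine Real.rpow_le_rpow_of_nonpos (by positivity) ?_ (by linarith)
    have h1 : kelBase l e z = q * ‖z‖ ^ 2 + l ^ 2 - 24 / 5 * ⟪e, z⟫ := by
      unfold kelBase
      rw [hq]
      ring
    have h2 := (abs_le.1 (abs_inner_le S.he z)).2
    have h3 : 24 / 5 ≤ R * (q - q₁) := by rwa [div_le_iff₀ (by linarith)] at hRq
    have h4 : 24 / 5 ≤ ‖z‖ * (q - q₁) :=
      h3.trans (mul_le_mul_of_nonneg_right hzR (by linarith))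
    have h5 := mul_le_mul_of_nonneg_left h4 hr.le
    rw [h1]
    nlinarith only [h5, h2, hl0]
  have hmP : m ^ μ ≤ 9 ^ μ * P := by
    rw [hm, Real.mul_rpow (by positivity) (by positivity), hP, Real.rpow_neg (by positivity),
      Real.inv_rpow (by positivity)]
    have : l ^ 2 ≤ 9 := by nlinarith
    gcongr
  have hkel : kelvin μ l V z = kelBase l e z ^ (-μ)
      + m ^ μ * (V (m • z) - bubBase (13 / 5) e (m • z) ^ (-μ)) := by
    rw [← hkb]
    unfold kelvin
    ring
  have herr : m ^ μ * (V (m • z) - bubBase (13 / 5) e (m • z) ^ (-μ)) ≤ 9 ^ μ * P * η := by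
    have hm0 : 0 < m := by positivity
    calc _ ≤ m ^ μ * η := by
          gcongr
          exact (abs_le.1 hEy).2
      _ ≤ _ := by gcongr
  have hfin := mul_le_mul_of_nonneg_right hη4.le hP0.le
  unfold sphereDiff
  rw [hkel]
  linarith

end StartFar

section Moving

variable {n : ℕ} {i : Fin n} {μ η T ρ τ ζ l : ℝ} {e : Euc n} {V K : Euc n → ℝ}

lemma sphere_end {μ θ : ℝ} (hμ : 1 ≤ μ) (hθ : 0 < θ) (hθ1 : θ ≤ 1 / 10) :
    ∀ᶠ η in 𝓝[>] (0 : ℝ), ∀ (i : Fin n) (T ρ τ : ℝ) (e : Euc n) (V K : Euc n → ℝ),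
      Setup i μ η T ρ τ e V K → ∃ z ∈ dom i T ρ, 13 / 5 + θ < ‖z‖ ∧
        sphereDiff μ τ (13 / 5 + θ) e V z < 0 := by
  set l := 13 / 5 + θ with hl
  have hl0 : 0 < l := by linarith
  set b := (l + 1) ^ 2 * (169 / 25) / l ^ 2 + l ^ 2 - 24 / 5 * (l + 1) with hb
  set a := (l + 1) ^ 2 + (13 / 5) ^ 2 - 24 / 13 * (13 / 5) * (l + 1) with ha
  have hab : b < a := by
    have e1 : a - b = (l ^ 2 - 169 / 25) * ((l + 1) ^ 2 - l ^ 2) / l ^ 2 := by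
      rw [ha, hb]
      field_simp
      ring
    have : 0 < a - b := by
      rw [e1]
      exact div_pos (mul_pos (by nlinarith) (by nlinarith)) (by positivity)
    linarith
  have hb0 : 0 < b := by
    have h1 : 24 / 5 * (l + 1) < (l + 1) ^ 2 * (169 / 25) / l ^ 2 + l ^ 2 := by
      rw [div_add' _ _ _ (by positivity), lt_div_iff₀ (by positivity)]
      have h2 : 0 ≤ ((l + 1) * (13 / 5) - l * l) ^ 2 := sq_nonneg _
      nlinarith [mul_pos hl0 (mul_pos hl0 hl0), mul_pos hl0 hl0]
    linarith
  have hc : 0 < b ^ (-μ) - a ^ (-μ) := by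
    have := Real.rpow_lt_rpow_of_neg hb0 hab (by linarith : -μ < 0)
    linarith
  have c1 : ∀ᶠ η in 𝓝[>] (0 : ℝ), η < min (1 / 100) ((b ^ (-μ) - a ^ (-μ)) / 2) :=
    (eventually_lt_nhds (by positivity)).filter_mono nhdsWithin_le_nhds
  filter_upwards [c1] with η hη i T ρ τ e V K S
  obtain ⟨hη1, hη2⟩ := lt_min_iff.1 hη
  have hz : ‖(l + 1) • e‖ = l + 1 := by
    rw [norm_smul, S.he, Real.norm_of_nonneg (by linarith), mul_one]
  have hez : ⟪e, (l + 1) • e⟫ = l + 1 := by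
    rw [real_inner_smul_right, real_inner_self_eq_norm_sq, S.he]; ring
  set z := (l + 1) • e
  obtain ⟨hzd, -, -, hzη⟩ := S.small_mem hη1.le (y := z) (by linarith)
  refine ⟨z, hzd, by linarith, ?_⟩
  have hlz : l ≤ ‖z‖ := by linarith
  have hz0 : z ≠ 0 := norm_pos_iff.1 (by linarith)
  obtain ⟨hy1, hy2⟩ := norm_reflect hl0 hlz
  have hkb := kelvin_bub μ hl0 S.he hz0
  have hbar := barrier_nonneg (μ := μ) hl0 S.he hlz
  have hm1 : l ^ 2 * (‖z‖ ^ 2)⁻¹ ≤ 1 := by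
    rw [← div_eq_mul_inv, div_le_one (by positivity)]; nlinarith
  unfold sphereDiff kelvin
  set m := l ^ 2 * (‖z‖ ^ 2)⁻¹ with hm
  have hm0 : 0 < m := by positivity
  obtain ⟨-, -, -, hyη⟩ := S.small_mem hη1.le (y := m • z) (by linarith)
  have hEy := (abs_le.1 (S.close (m • z) hyη)).1
  have hEz := (abs_le.1 (S.close z hzη)).2
  have hza : bubBase (13 / 5) e z = a := by rw [bubBase, hez, hz]
  have hzb : kelBase l e z = b := by rw [kelBase, hez, hz]
  rw [hza] at hEz
  rw [hzb] at hkb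
  have hmμ1 : m ^ μ ≤ 1 := Real.rpow_le_one hm0.le hm1 (by linarith)
  have hmμ0 : 0 < m ^ μ := by positivity
  have h1 := mul_le_mul_of_nonneg_left hEy hmμ0.le
  have h2 : m ^ μ * η ≤ 1 * η := mul_le_mul_of_nonneg_right hmμ1 S.hη.le
  have h3 := mul_nonneg S.hτ.le hbar
  linarith

lemma sphereDiff_eq_zero (hl : 0 < l) {z : Euc n} (hz : ‖z‖ = l) :
    sphereDiff μ τ l e V z = 0 := by
  have h1 : l ^ 2 * (l ^ 2)⁻¹ = 1 := mul_inv_cancel₀ (by positivity)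
  simp [sphereDiff, kelvin, barrier, hz, h1]

lemma continuousAt_barrier (hl : 0 < l) (he : ‖e‖ = 1) (z : Euc n) :
    ContinuousAt (fun p : ℝ × Euc n => barrier μ p.1 e p.2) (l, z) := by
  have hs := bubBase_pos hl he z
  have h1 : ContinuousAt (fun p : ℝ × Euc n => bubBase p.1 e p.2) (l, z) := by
    unfold bubBase
    fun_prop
  have h2 : ContinuousAt (fun p : ℝ × Euc n => bubBase p.1 e p.2 ^ (-(μ + 1))) (l, z) :=
    h1.rpow_const (.inl hs.ne')
  have h3 : ContinuousAt (fun p : ℝ × Euc n => (‖p.2‖ ^ 2 + p.1 ^ 2)⁻¹) (l, z) :=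
    ContinuousAt.inv₀ (by fun_prop) (by positivity)
  unfold barrier
  fun_prop

lemma Setup.reflect_mem (S : Setup i μ η T ρ τ e V K) (hη : η ≤ 1 / 100) (hl : 0 < l)
    (hl3 : l ≤ 3) {z : Euc n} (hz : l ≤ ‖z‖) :
    ContDiffAt ℝ 2 V ((l ^ 2 * (‖z‖ ^ 2)⁻¹) • z) := by
  obtain ⟨hy1, hy2⟩ := norm_reflect hl hz
  obtain ⟨-, h1, h2, -⟩ := S.small_mem hη (y := (l ^ 2 * (‖z‖ ^ 2)⁻¹) • z) (by linarith)
  exact S.smooth _ h1 h2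

lemma Setup.continuousWithinAt_sphereDiff (S : Setup i μ η T ρ τ e V K) (hη : η ≤ 1 / 100)
    (hl : 0 < l) (hl3 : l ≤ 3) {z : Euc n} (hzd : z ∈ dom i T ρ) (hz : l ≤ ‖z‖) :
    ContinuousWithinAt (fun p : ℝ × Euc n => sphereDiff μ τ p.1 e V p.2) (univ ×ˢ dom i T ρ)
      (l, z) := by
  have hr : 0 < ‖z‖ := hl.trans_le hz
  have h1 : ContinuousWithinAt (fun p : ℝ × Euc n => V p.2) (univ ×ˢ dom i T ρ) (l, z) :=
    (S.cont z hzd).comp (t := dom i T ρ) continuousWithinAt_snd fun p hp => hp.2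
  have h2 : ContinuousAt (fun p : ℝ × Euc n => p.1 ^ 2 * (‖p.2‖ ^ 2)⁻¹) (l, z) :=
    ContinuousAt.mul (by fun_prop) (ContinuousAt.inv₀ (by fun_prop) (by positivity))
  have h3 : ContinuousAt (fun p : ℝ × Euc n => kelvin μ p.1 V p.2) (l, z) := by
    refine (h2.rpow_const (.inl (by positivity))).mul ?_
    exact ContinuousAt.comp (g := V) (f := fun p : ℝ × Euc n => (p.1 ^ 2 * (‖p.2‖ ^ 2)⁻¹) • p.2)
      (S.reflect_mem hη hl hl3 hz).continuousAt (h2.smul continuousAt_snd)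
  exact (h1.sub h3.continuousWithinAt).sub
    ((continuousAt_barrier hl S.he z).const_mul τ).continuousWithinAt

lemma Setup.contDiffAt_sphereDiff (S : Setup i μ η T ρ τ e V K) (hη : η ≤ 1 / 100)
    (hl : 0 < l) (hl3 : l ≤ 3) {z : Euc n} (hz : ‖z‖ = l) :
    ContDiffAt ℝ 1 (fun p : ℝ × Euc n => sphereDiff μ τ p.1 e V p.2) (l, z) := by
  have hr : 0 < ‖z‖ := hl.trans_le hz.ge
  have hs := bubBase_pos hl S.he z
  obtain ⟨-, k1, k2, -⟩ := S.small_mem hη (y := z) (by linarith)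
  have hn : ContDiffAt ℝ 1 (fun p : ℝ × Euc n => ‖p.2‖ ^ 2) (l, z) :=
    contDiffAt_snd.norm_sq ℝ
  have hi : ContDiffAt ℝ 1 (fun p : ℝ × Euc n => ⟪e, p.2⟫) (l, z) :=
    contDiffAt_const.inner ℝ contDiffAt_snd
  have hl2 : ContDiffAt ℝ 1 (fun p : ℝ × Euc n => p.1 ^ 2) (l, z) := contDiffAt_fst.pow 2
  have hn' : ContDiffAt ℝ 1 (fun p : ℝ × Euc n => ‖p.2‖) (l, z) :=
    contDiffAt_snd.norm ℝ (norm_pos_iff.1 hr)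
  have h1 : ContDiffAt ℝ 1 (fun p : ℝ × Euc n => V p.2) (l, z) :=
    ContDiffAt.comp (g := V) (l, z) ((S.smooth z k1 k2).of_le (by norm_num)) contDiffAt_snd
  have h2 : ContDiffAt ℝ 1 (fun p : ℝ × Euc n => p.1 ^ 2 * (‖p.2‖ ^ 2)⁻¹) (l, z) :=
    ContDiffAt.mul (by fun_prop) (hn.inv (by positivity))
  have h3 : ContDiffAt ℝ 1 (fun p : ℝ × Euc n => kelvin μ p.1 V p.2) (l, z) := by
    refine (h2.rpow_const_of_ne (by positivity)).mul ?_
    exact ContDiffAt.comp (g := V) (f := fun p : ℝ × Euc n => (p.1 ^ 2 * (‖p.2‖ ^ 2)⁻¹) • p.2)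
      (l, z) ((S.reflect_mem hη hl hl3 hz.ge).of_le (by norm_num)) (h2.smul contDiffAt_snd)
  have h4 : ContDiffAt ℝ 1 (fun p : ℝ × Euc n => bubBase p.1 e p.2 ^ (-(μ + 1))) (l, z) := by
    refine ContDiffAt.rpow_const_of_ne ?_ hs.ne'
    exact (hn.add hl2).sub ((contDiffAt_const.mul contDiffAt_fst).mul hi)
  have h5 : ContDiffAt ℝ 1 (fun p : ℝ × Euc n => (‖p.2‖ ^ 2 + p.1 ^ 2)⁻¹) (l, z) :=
    ContDiffAt.inv (hn.add hl2) (by positivity)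
  have h6 : ContDiffAt ℝ 1 (fun p : ℝ × Euc n => barrier μ p.1 e p.2) (l, z) :=
    contDiffAt_const.mul (((hn.sub hl2).mul h4).mul ((hi.add hn').mul h5))
  exact (h1.sub h3).sub (contDiffAt_const.mul h6)

lemma Setup.exists_lap_neg (S : Setup i μ η T ρ τ e V K) (G : Good n μ ζ) (hη : η ≤ ζ)
    (N : Near μ ζ l e V) {z : Euc n} (hz : l < ‖z‖) (hzρ : ‖z‖ < ρ) (hzT : -T < z i)
    (hW : 0 ≤ sphereDiff μ τ l e V z) :
    ∃ g L, HasLap (sphereDiff μ τ l e V) z g L ∧ L < 0 :=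
  S.lap_neg G hη N.lo (by linarith [N.hi]) N.sq hz hzρ hzT (N.ge z hz.le) (N.le z hz.le) hW

lemma Setup.sphereDiff_pos (S : Setup i μ η T ρ τ e V K) (G : Good n μ ζ) (hη : η ≤ ζ)
    (N : Near μ ζ l e V)
    (hout : ∀ z ∈ dom i T ρ, ‖z‖ = ρ → 0 < sphereDiff μ τ l e V z)
    (hflat : ∀ z, ‖z‖ < ρ → z i = -T → sphereDiff μ τ l e V z ≠ 0)
    (hA : ∀ z ∈ dom i T ρ, ‖z‖ ≤ l ∨ 0 ≤ sphereDiff μ τ l e V z)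
    {z : Euc n} (hz : z ∈ dom i T ρ) (hlz : l < ‖z‖) : 0 < sphereDiff μ τ l e V z := by
  have hW := (hA z hz).resolve_left (by linarith)
  refine lt_of_le_of_ne hW fun h0 => ?_
  rcases hz.1.lt_or_eq with h1 | h1
  swap
  · exact (hout z hz h1).ne h0
  rcases hz.2.lt_or_eq with h2 | h2
  swap
  · exact hflat z h1 h2.symm h0.symm
  obtain ⟨g, L, hL, hneg⟩ := S.exists_lap_neg G hη N hlz h1 h2 hW
  refine hneg.not_ge (hL.nonneg_of_isLocalMin ?_)
  have c1 := continuous_norm.continuousAt (x := z)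
  have c2 : ContinuousAt (fun w : Euc n => w i) z := by fun_prop
  filter_upwards [c1.eventually_lt_const h1, c1.eventually_const_lt hlz,
    c2.eventually_const_lt h2] with w k1 k2 k3
  rw [← h0]
  exact (hA w ⟨k1.le, k3.le⟩).resolve_left (by linarith)

lemma Setup.hopf (S : Setup i μ η T ρ τ e V K) (G : Good n μ ζ) (hη : η ≤ ζ) (N : Near μ ζ l e V)
    (hpos : ∀ z ∈ dom i T ρ, l < ‖z‖ → 0 < sphereDiff μ τ l e V z) {k : Euc n} (hk : ‖k‖ = l) :
    ∃ ε > 0, ∀ z, l ≤ ‖z‖ → ‖z‖ ≤ l + 1 →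
      ε * ((l ^ 2) ^ (-μ) - (‖z‖ ^ 2) ^ (-μ)) ≤ sphereDiff μ τ l e V z := by
  have hη1 : η ≤ 1 / 100 := hη.trans G.le
  have hl := N.pos
  have hl3 : l ≤ 3 := by linarith [N.hi]
  have hcont : ContinuousOn (sphereDiff μ τ l e V) {z | l ≤ ‖z‖ ∧ ‖z‖ ≤ l + 1} := by
    intro z hz
    obtain ⟨hzd, -, -, -⟩ := S.small_mem hη1 (y := z) (by linarith [hz.2])
    have h1 := S.continuousWithinAt_sphereDiff hη1 hl hl3 hzd hz.1
    have h2 : ContinuousWithinAt (fun w : Euc n => (l, w)) {z | l ≤ ‖z‖ ∧ ‖z‖ ≤ l + 1} z := by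
      fun_prop
    refine h1.comp (f := fun w : Euc n => (l, w)) h2 fun w hw => ⟨mem_univ _, ?_⟩
    exact (S.small_mem hη1 (y := w) (by linarith [hw.2])).1
  have hsph : {z : Euc n | ‖z‖ = l + 1} = sphere 0 (l + 1) := by ext; simp
  obtain ⟨z₀, hz₀, hmin₀⟩ := (isCompact_sphere (0 : Euc n) (l + 1)).exists_isMinOn
    ⟨((l + 1) / l) • k, by
      rw [mem_sphere_zero_iff_norm, norm_smul, hk, Real.norm_of_nonneg (by positivity)]
      field_simp⟩ (hcont.mono fun z hz => by
        have := mem_sphere_zero_iff_norm.1 hz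
        exact ⟨by linarith, this.le⟩)
  have hz₀' := mem_sphere_zero_iff_norm.1 hz₀
  have hw0 := hpos z₀ (S.small_mem hη1 (y := z₀) (by linarith)).1 (by linarith)
  set w₀ := sphereDiff μ τ l e V z₀
  have hP0 : 0 < (l ^ 2) ^ (-μ) := by positivity
  set P := (l ^ 2) ^ (-μ) with hP
  refine ⟨w₀ / P, by positivity, fun z hz1 hz2 => ?_⟩
  set F : Euc n → ℝ := fun y => sphereDiff μ τ l e V y - (w₀ / P * P - w₀ / P * (‖y‖ ^ 2) ^ (-μ))
    with hF
  have hset : {z : Euc n | l ≤ ‖z‖ ∧ ‖z‖ ≤ l + 1} = closedBall 0 (l + 1) ∩ {z | l ≤ ‖z‖} := by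
    ext; simp [and_comm]
  have hcomp : IsCompact {z : Euc n | l ≤ ‖z‖ ∧ ‖z‖ ≤ l + 1} := by
    rw [hset]
    exact (isCompact_closedBall _ _).inter_right (isClosed_le continuous_const continuous_norm)
  have hFc : ContinuousOn F {z | l ≤ ‖z‖ ∧ ‖z‖ ≤ l + 1} := by
    refine hcont.sub (continuousOn_const.sub (continuousOn_const.mul ?_))
    refine ContinuousOn.rpow_const (by fun_prop) fun y hy => .inl ?_
    have : 0 < ‖y‖ := hl.trans_le hy.1
    positivity
  obtain ⟨y, hy, hmin⟩ := hcomp.exists_isMinOn ⟨z, hz1, hz2⟩ hFc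
  have hyz : F y ≤ F z := hmin ⟨hz1, hz2⟩
  suffices h : 0 ≤ F y by
    have h' : 0 ≤ F z := h.trans hyz
    simp only [hF] at h'
    linarith
  have hyr : 0 < ‖y‖ := hl.trans_le hy.1
  obtain ⟨hyd, hyρ, hyT, -⟩ := S.small_mem hη1 (y := y) (by linarith [hy.2])
  rcases hy.1.eq_or_lt with h1 | h1
  · simp only [hF]
    rw [sphereDiff_eq_zero hl h1.symm, ← h1]
    simp [hP]
  rcases hy.2.eq_or_lt with h2 | h2
  · have h3 : w₀ ≤ sphereDiff μ τ l e V y := hmin₀ (mem_sphere_zero_iff_norm.2 h2)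
    have h4 : w₀ / P * P = w₀ := by field_simp
    have h5 : 0 ≤ w₀ / P * (‖y‖ ^ 2) ^ (-μ) := by positivity
    simp only [hF]
    linarith
  obtain ⟨g, L, hL, hneg⟩ := S.exists_lap_neg G hη N h1 hyρ hyT (hpos y hyd h1).le
  exfalso
  have hH := ((HasLap.const (w₀ / P * P) y).sub
    ((hasLap_fundamental S.hμ (norm_pos_iff.1 hyr)).const_mul (w₀ / P)))
  have hmin' : IsLocalMin F y := by
    refine hmin.isLocalMin ?_
    have c1 := continuous_norm.continuousAt (x := y)
    filter_upwards [c1.eventually_lt_const h2, c1.eventually_const_lt h1] with w k1 k2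
    exact ⟨k2.le, k1.le⟩
  have h3 := (hL.sub hH).nonneg_of_isLocalMin hmin'
  linarith

end Moving

section Conclusion

variable {n : ℕ} {i : Fin n} {μ η T ρ τ ζ l : ℝ} {e : Euc n} {V K : Euc n → ℝ}

lemma fderiv_radial_pos (hμ : μ = ((n : ℝ) - 2) / 2) (hμ0 : 0 < μ) (hl : 0 < l) {k : Euc n} (hk : ‖k‖ = l)
    {F : ℝ × Euc n → ℝ} {L : ℝ × Euc n →L[ℝ] ℝ} (hF : HasFDerivAt F L (l, k)) (h0 : F (l, k) = 0)
    (hhopf : ∃ ε > 0, ∀ z, l ≤ ‖z‖ → ‖z‖ ≤ l + 1 →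
      ε * ((l ^ 2) ^ (-μ) - (‖z‖ ^ 2) ^ (-μ)) ≤ F (l, z)) : 0 < L (0, k) := by
  obtain ⟨ε, hε, hb⟩ := hhopf
  have hk0 : k ≠ 0 := norm_pos_iff.1 (hl.trans_le hk.ge)
  have hline : HasDerivAt (fun t : ℝ => ((l, k + t • k) : ℝ × Euc n)) (0, k) 0 := by
    have h1 : HasDerivAt (fun t : ℝ => k + t • k) k 0 := by
      simpa using ((hasDerivAt_id (0 : ℝ)).smul_const k).const_add k
    exact (hasDerivAt_const (0 : ℝ) l).prodMk h1
  have hF' : HasFDerivAt F L (l, k + (0 : ℝ) • k) := by simpa using hF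
  have h1 := (hF'.comp_hasDerivAt (0 : ℝ) hline).hasDerivWithinAt (s := Ici 0)
  have h2 := (hasLap_fundamental hμ hk0).hasDerivWithinAt_line k
  have h3 := h1.sub ((h2.const_sub ((l ^ 2) ^ (-μ))).const_mul ε)
  have h4 := nonneg_of_hasDerivWithinAt_Ici h3 ?_
  · rw [inner_smul_left, inner_smul_left, real_inner_self_eq_norm_sq, hk] at h4
    simp only [conj_trivial] at h4
    have : 0 < ε * (μ * (l ^ 2) ^ (-μ - 1) * (2 * l ^ 2)) := by positivity
    linarith
  · filter_upwards [Ioo_mem_nhdsGT (show (0 : ℝ) < 1 / l by positivity)] with t ht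
    have hn : ‖k + t • k‖ = (1 + t) * l := by
      rw [show k + t • k = (1 + t) • k by module, norm_smul, hk,
        Real.norm_of_nonneg (by linarith [ht.1])]
    have htl : t * l < 1 := (lt_div_iff₀ hl).1 ht.2
    have := hb (k + t • k) (by rw [hn]; nlinarith [ht.1]) (by rw [hn]; linarith)
    simpa [h0, hk] using this

lemma eventually_nonneg_of_fderiv_radial_pos (hl : 0 < l) {k : Euc n} (hk : ‖k‖ = l)
    {F : ℝ × Euc n → ℝ} {L : ℝ × Euc n →L[ℝ] ℝ} (hF : HasStrictFDerivAt F L (l, k))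
    (hL : 0 < L (0, k)) (h0 : ∀ r : ℝ, 0 < r → ∀ z, ‖z‖ = r → F (r, z) = 0) :
    ∀ᶠ p in 𝓝 (l, k), ‖p.2‖ ≤ p.1 ∨ 0 ≤ F p := by
  set d := L (0, k) with hd
  have hk0 : ‖k‖ ≠ 0 := by rw [hk]; exact hl.ne'
  have hq : ContinuousAt (fun p : ℝ × Euc n => (p, (p.1, (p.1 / ‖p.2‖) • p.2))) (l, k) := by
    have : ContinuousAt (fun p : ℝ × Euc n => p.1 / ‖p.2‖) (l, k) :=
      continuousAt_fst.div (by fun_prop) hk0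
    fun_prop
  have hq' : Tendsto (fun p : ℝ × Euc n => (p, (p.1, (p.1 / ‖p.2‖) • p.2))) (𝓝 (l, k))
      (𝓝 ((l, k), (l, k))) := by
    have := hq.tendsto
    simpa [hk, div_self hl.ne'] using this
  have hc : 0 < d / (4 * l) := by positivity
  have h1 := hq'.eventually (hF.isLittleO.def hc)
  have hc2 : ContinuousAt (fun p : ℝ × Euc n => L (0, p.2)) (l, k) := by fun_prop
  have h2 : ∀ᶠ p : ℝ × Euc n in 𝓝 (l, k), d / 2 < L (0, p.2) :=
    hc2.eventually_const_lt (by simp only; rw [← hd]; linarith)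
  have hc3 : ContinuousAt (fun p : ℝ × Euc n => ‖p.2‖) (l, k) := by fun_prop
  have h3 : ∀ᶠ p : ℝ × Euc n in 𝓝 (l, k), ‖p.2‖ < 2 * l :=
    hc3.eventually_lt_const (by simp only; linarith)
  have h4 : ∀ᶠ p : ℝ × Euc n in 𝓝 (l, k), 0 < p.1 := continuousAt_fst.eventually_const_lt hl
  filter_upwards [h1, h2, h3, h4] with ⟨r, z⟩ k1 k2 k3 k4
  simp only at k1 k2 k3 k4 ⊢
  rcases le_or_gt ‖z‖ r with hz | hz
  · exact .inl hz
  right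
  have hz0 : 0 < ‖z‖ := k4.trans hz
  set s := 1 - r / ‖z‖ with hs
  have hs0 : 0 ≤ s := sub_nonneg.2 ((div_le_one hz0).2 hz.le)
  have hdiff : ((r, z) : ℝ × Euc n) - (r, (r / ‖z‖) • z) = s • ((0, z) : ℝ × Euc n) := by
    ext1
    · simp
    · simp [hs, sub_smul]
  have hF0 : F (r, (r / ‖z‖) • z) = 0 := h0 r k4 _ (by
    rw [norm_smul, Real.norm_of_nonneg (by positivity), div_mul_cancel₀ _ hz0.ne'])
  have hno : ‖((0, z) : ℝ × Euc n)‖ = ‖z‖ := by simp [Prod.norm_def]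
  rw [hdiff, hF0, map_smul, sub_zero, norm_smul, Real.norm_of_nonneg hs0, hno, smul_eq_mul] at k1
  have k5 := (abs_le.1 k1).1
  have k6 : d / (4 * l) * ‖z‖ ≤ d / 2 := by
    calc d / (4 * l) * ‖z‖ ≤ d / (4 * l) * (2 * l) := by gcongr
      _ = d / 2 := by field_simp; norm_num
  nlinarith [mul_nonneg hs0 (sub_nonneg.2 (k6.trans k2.le))]

lemma isCompact_dom (i : Fin n) (T ρ : ℝ) : IsCompact (dom i T ρ) := by
  have : dom i T ρ = closedBall 0 ρ ∩ {z | -T ≤ z i} := by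
    ext z
    simp [dom]
  rw [this]
  exact (isCompact_closedBall _ _).inter_right (isClosed_le continuous_const (by fun_prop))

lemma Setup.eventually_nonneg (S : Setup i μ η T ρ τ e V K) (G : Good n μ ζ) (hη : η ≤ ζ)
    (N : Near μ ζ l e V)
    (hpos : ∀ z ∈ dom i T ρ, l < ‖z‖ → 0 < sphereDiff μ τ l e V z) :
    ∀ᶠ r in 𝓝 l, ∀ z ∈ dom i T ρ, ‖z‖ ≤ r ∨ 0 ≤ sphereDiff μ τ r e V z := by
  have hη1 : η ≤ 1 / 100 := hη.trans G.le
  have hl := N.pos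
  have hl3 : l ≤ 3 := by linarith [N.hi]
  have hμ : 0 < μ := by linarith [S.one_le]
  suffices h : ∀ᶠ r in 𝓝 l, ∀ z ∈ dom i T ρ, z ∈ dom i T ρ → ‖z‖ ≤ r ∨
      0 ≤ sphereDiff μ τ r e V z from h.mono fun r hr z hz => hr z hz hz
  refine (isCompact_dom i T ρ).eventually_forall_of_forall_eventually fun k hk => ?_
  rcases lt_trichotomy ‖k‖ l with h | h | h
  · have c : ContinuousAt (fun p : ℝ × Euc n => p.1 - ‖p.2‖) (l, k) := by fun_prop
    filter_upwards [c.eventually_const_lt (u := 0) (by simpa using h)] with p hp _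
    exact .inl (by linarith)
  · have hC := (S.contDiffAt_sphereDiff hη1 hl hl3 h).hasStrictFDerivAt (by simp)
    have hL := fderiv_radial_pos S.hμ hμ hl h hC.hasFDerivAt (sphereDiff_eq_zero hl h)
      (S.hopf G hη N hpos h)
    filter_upwards [eventually_nonneg_of_fderiv_radial_pos hl h hC hL
      fun r hr z hz => sphereDiff_eq_zero hr hz] with p hp _
    exact hp
  · have c := (S.continuousWithinAt_sphereDiff hη1 hl hl3 hk h.le).tendsto.eventually_const_lt
      (hpos k hk h)
    rw [nhdsWithin, eventually_inf_principal] at c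
    filter_upwards [c] with p hp hd
    exact .inr (hp ⟨mem_univ _, hd⟩).le

lemma Setup.moving (S : Setup i μ η T ρ τ e V K) (G : Good n μ ζ) (hη : η ≤ ζ) {l₀ l₁ : ℝ}
    (h01 : l₀ ≤ l₁) (N : ∀ l ∈ Icc l₀ l₁, Near μ ζ l e V)
    (hout : ∀ l, Near μ ζ l e V → ∀ z ∈ dom i T ρ, ‖z‖ = ρ → 0 < sphereDiff μ τ l e V z)
    (hflat : ∀ l, Near μ ζ l e V → (∀ z ∈ dom i T ρ, ‖z‖ ≤ l ∨ 0 ≤ sphereDiff μ τ l e V z) →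
      ∀ z, ‖z‖ < ρ → z i = -T → sphereDiff μ τ l e V z ≠ 0)
    (hstart : ∀ z ∈ dom i T ρ, ‖z‖ ≤ l₀ ∨ 0 ≤ sphereDiff μ τ l₀ e V z) :
    ∀ z ∈ dom i T ρ, ‖z‖ ≤ l₁ ∨ 0 ≤ sphereDiff μ τ l₁ e V z := by
  set A := {l | ∀ z ∈ dom i T ρ, ‖z‖ ≤ l ∨ 0 ≤ sphereDiff μ τ l e V z} with hA
  have hη1 : η ≤ 1 / 100 := hη.trans G.le
  have hsub : Icc l₀ l₁ ⊆ A := by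
    refine IsClosed.Icc_subset_of_forall_mem_nhdsWithin ?_ hstart fun l hl => ?_
    · rw [← closure_subset_iff_isClosed]
      intro l hl
      have hlI : l ∈ Icc l₀ l₁ :=
        isClosed_Icc.closure_subset (closure_mono inter_subset_right hl)
      refine ⟨fun z hz => ?_, hlI⟩
      have Nl := N l hlI
      rcases le_or_gt ‖z‖ l with h | h
      · exact .inl h
      refine .inr (not_lt.1 fun hneg => ?_)
      have c := (S.continuousWithinAt_sphereDiff hη1 Nl.pos (by linarith [Nl.hi]) hz
        h.le).tendsto.eventually_lt_const hneg
      have c2 : Tendsto (fun r : ℝ => (r, z)) (𝓝 l) (𝓝[univ ×ˢ dom i T ρ] (l, z)) := by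
        refine tendsto_nhdsWithin_iff.2 ⟨?_, .of_forall fun r => ⟨mem_univ _, hz⟩⟩
        exact (Continuous.tendsto (by fun_prop) l)
      obtain ⟨r, ⟨hr1, hr2⟩, hr3⟩ :=
        mem_closure_iff_nhds.1 hl _ ((c2.eventually c).and (eventually_lt_nhds h))
      rcases hr3.1 z hz with h' | h'
      · exact hr2.not_ge h'
      · exact hr1.not_ge h'
    · have Nl := N l ⟨hl.2.1, hl.2.2.le⟩
      refine mem_nhdsWithin_of_mem_nhds (S.eventually_nonneg G hη Nl fun z hz hlz => ?_)
      exact S.sphereDiff_pos G hη Nl (hout l Nl) (hflat l Nl hl.1) hl.1 hz hlz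
  exact hsub (right_mem_Icc.2 h01)

/-- The moving sphere argument: no solution close enough to the bubble exists when the
coefficient has a slope that dominates its oscillation. -/
theorem eventually_not_setup (hn : 4 ≤ n) (hμ : μ = ((n : ℝ) - 2) / 2) :
    ∀ᶠ η in 𝓝[>] (0 : ℝ), ∀ (i : Fin n) (T ρ τ : ℝ) (e : Euc n) (V K : Euc n → ℝ),
      ¬ Setup i μ η T ρ τ e V K := by
  have hn4 : (4 : ℝ) ≤ n := by exact_mod_cast hn
  have hμ1 : 1 ≤ μ := by rw [hμ]; linarith
  have hμ0 : 0 < μ := by linarith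
  obtain ⟨ζ, G⟩ := exists_good hn hμ
  obtain ⟨θ, hθ, hθ1, hk⟩ := Setup.kelvin_close (n := n) hμ0 G.pos
  obtain ⟨R, hR, hfar⟩ := start_far (n := n) hn hμ1 hθ hθ1
  have c1 : ∀ᶠ η in 𝓝[>] (0 : ℝ), η < ζ :=
    (eventually_lt_nhds G.pos).filter_mono nhdsWithin_le_nhds
  filter_upwards [c1, hk, hfar, start_near hn hμ1 hθ hθ1 hR, sphere_end (n := n) hμ1 hθ hθ1,
    outer_pos hμ0 G, flat_ne_zero hμ0 G] with η hη hk hfar hnear hend hout hflat i T ρ τ e V K S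
  obtain ⟨z, hz, hlz, hneg⟩ := hend i T ρ τ e V K S
  refine ((S.moving G hη.le (l₀ := 13 / 5 - θ) (l₁ := 13 / 5 + θ) (by linarith) ?_
    (hout i T ρ τ e V K S) (hflat i T ρ τ e V K S) ?_ z hz).resolve_left hlz.not_ge).not_gt hneg
  · rintro l ⟨h1, h2⟩
    obtain ⟨k1, k2⟩ := hk i T ρ τ e V K S l (abs_le.2 ⟨by linarith, by linarith⟩)
    exact ⟨by linarith, by linarith, k1, fun z hz => (k2 z hz).1, fun z hz => (k2 z hz).2⟩
  · intro z hz
    rcases le_or_gt ‖z‖ (13 / 5 - θ) with h | h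
    · exact .inl h
    rcases le_total ‖z‖ R with h' | h'
    · exact .inr (hnear i T ρ τ e V K S z h.le h')
    · exact .inr (hfar i T ρ τ e V K S z hz h')

end Conclusion

section HalfBall

variable {n : ℕ} {h0 : 0 < n} {r : ℝ} {x : Euc n}

lemma isOpen_upperHalf : IsOpen (upperHalf n h0) :=
  isOpen_lt continuous_const (by fun_prop)

lemma isOpen_halfBall : IsOpen (halfBall n h0 r) := isOpen_ball.inter isOpen_upperHalf

lemma convex_halfBall : Convex ℝ (halfBall n h0 r) := by
  refine (convex_ball _ _).inter fun x hx y hy a b ha hb hab => ?_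
  simp only [upperHalf, mem_ofPred_eq, PiLp.add_apply, PiLp.smul_apply, smul_eq_mul] at hx hy ⊢
  rcases ha.eq_or_lt with rfl | ha
  · have : b = 1 := by linarith
    simpa [this] using hy
  · nlinarith [mul_pos ha hx, mul_nonneg hb hy.le]

lemma convex_closure_halfBall : Convex ℝ (closure (halfBall n h0 r)) := convex_halfBall.closure

lemma mem_closure_halfBall (hx : ‖x‖ < r) (hx0 : 0 ≤ x (lastIdx n h0)) :
    x ∈ closure (halfBall n h0 r) := by
  have hc : Continuous fun t : ℝ => x + t • EuclideanSpace.single (lastIdx n h0) (1 : ℝ) := by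
    fun_prop
  have ht : Tendsto (fun t : ℝ => x + t • EuclideanSpace.single (lastIdx n h0) (1 : ℝ)) (𝓝[>] 0)
      (𝓝 x) := by
    simpa using (hc.tendsto 0).mono_left nhdsWithin_le_nhds
  refine mem_closure_of_tendsto ht ?_
  filter_upwards [ht.eventually (isOpen_ball.mem_nhds (mem_ball_zero_iff.2 hx)),
    self_mem_nhdsWithin] with t h1 h2
  refine ⟨h1, ?_⟩
  have : 0 < t := h2
  simp only [upperHalf, mem_ofPred_eq, PiLp.add_apply, PiLp.smul_apply, smul_eq_mul,
    PiLp.single_apply, if_true]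
  linarith

lemma nonneg_of_mem_closure_upperHalf (hx : x ∈ closure (upperHalf n h0)) :
    0 ≤ x (lastIdx n h0) :=
  closure_minimal (s := upperHalf n h0) (t := {y : Euc n | 0 ≤ y (lastIdx n h0)})
    (fun y (hy : 0 < y (lastIdx n h0)) => show 0 ≤ y (lastIdx n h0) from hy.le)
    (isClosed_le continuous_const (by fun_prop)) hx

lemma uniqueDiffOn_closure_halfBall (hr : 0 < r) :
    UniqueDiffOn ℝ (closure (halfBall n h0 r)) := by
  refine uniqueDiffOn_convex convex_closure_halfBall ⟨EuclideanSpace.single (lastIdx n h0) (r / 2),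
    interior_maximal subset_closure isOpen_halfBall ⟨?_, ?_⟩⟩
  · simp [abs_of_pos hr, hr]
  · simp [upperHalf, hr]

end HalfBall

section Coefficient

variable {E : Type*} [NormedAddCommGroup E] [NormedSpace ℝ E] {s : Set E} {k : E → ℝ} {Λ : ℝ}

lemma norm_fderivWithin_sub_le_of_iteratedFDerivWithin_two (hs : Convex ℝ s)
    (hu : UniqueDiffOn ℝ s) (hk : ContDiffOn ℝ 2 k s)
    (h2 : ∀ x ∈ s, ‖iteratedFDerivWithin ℝ 2 k s x‖ ≤ Λ) {x y : E} (hx : x ∈ s) (hy : y ∈ s) :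
    ‖fderivWithin ℝ k s y - fderivWithin ℝ k s x‖ ≤ Λ * ‖y - x‖ := by
  refine hs.norm_image_sub_le_of_norm_fderivWithin_le (𝕜 := ℝ)
    ((hk.fderivWithin hu (m := 1) (by norm_num)).differentiableOn (by simp)) (fun z hz => ?_) hx hy
  rw [← norm_iteratedFDerivWithin_one _ (hu z hz), norm_iteratedFDerivWithin_fderivWithin hu hz]
  exact h2 z hz

lemma abs_sub_sub_fderivWithin_le (hs : Convex ℝ s)
    (hu : UniqueDiffOn ℝ s) (hk : ContDiffOn ℝ 2 k s) (hΛ : 0 ≤ Λ)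
    (h2 : ∀ x ∈ s, ‖iteratedFDerivWithin ℝ 2 k s x‖ ≤ Λ) {x y z : E} {r : ℝ} (hx : x ∈ s)
    (hy : y ∈ s) (hz : z ∈ s) (hyr : ‖y - x‖ ≤ r) (hzr : ‖z - x‖ ≤ r) :
    |k y - k z - fderivWithin ℝ k s x (y - z)| ≤ Λ * r * ‖y - z‖ := by
  have hd := hk.differentiableOn (by simp)
  refine (hs.inter (convex_closedBall x r)).norm_image_sub_le_of_norm_hasFDerivWithin_le'
    (𝕜 := ℝ) (f' := fderivWithin ℝ k s)
    (fun w hw => (hd w hw.1).hasFDerivWithinAt.mono inter_subset_left) (fun w hw => ?_)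
    ⟨hz, mem_closedBall_iff_norm.2 hzr⟩ ⟨hy, mem_closedBall_iff_norm.2 hyr⟩
  refine (norm_fderivWithin_sub_le_of_iteratedFDerivWithin_two hs hu hk h2 hx hw.1).trans ?_
  gcongr
  exact mem_closedBall_iff_norm.1 hw.2

end Coefficient

section Laplacian

variable {n : ℕ} {h0 : 0 < n} {u : Euc n → ℝ} {x : Euc n} {s : Set (Euc n)}

lemma lapWithin_eq_of_mem_nhds (hs : s ∈ 𝓝 x) :
    lapWithin n s u x = ∑ j, fderiv ℝ (fderiv ℝ u) x (EuclideanSpace.single j 1)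
      (EuclideanSpace.single j 1) := by
  have h : s =ᶠ[𝓝 x] univ := by rwa [eventuallyEq_univ]
  simp [lapWithin, iteratedFDerivWithin_congr_set h, iteratedFDerivWithin_univ,
    iteratedFDeriv_two_apply]

lemma HasLap.comp_affine {F : Euc n → ℝ} {g a : Euc n} {L r : ℝ}
    (h : HasLap F (a + r • x) g L) :
    HasLap (fun y => F (a + r • y)) x (r • g) (r ^ 2 * L) := by
  obtain ⟨F', B, k1, k2, k3, k4⟩ := h
  have hA : ∀ y : Euc n, HasFDerivAt (fun y => a + r • y) (r • ContinuousLinearMap.id ℝ (Euc n)) y :=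
    fun y => ((hasFDerivAt_id y).const_smul r).const_add a
  refine ⟨fun y => r • F' (a + r • y), _, ?_,
    (HasFDerivAt.comp (g := F') (f := fun y => a + r • y) x k2 (hA x)).const_smul r, ?_, ?_⟩
  · filter_upwards [(hA x).continuousAt.eventually k1] with y hy
    refine (hy.comp y (hA y)).congr_fderiv ?_
    ext w
    simp
  · simp [k3]
  · rw [← k4, Finset.mul_sum]
    refine Finset.sum_congr rfl fun j _ => ?_
    simp
    ring

end Laplacian

section Rescale

variable {n : ℕ} {h0 : 0 < n} {x₀ e z : Euc n} {Γ δ Λ M μ : ℝ} {u k c : Euc n → ℝ}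

/-- Blow-up coordinates at scale `Γ⁻¹`, centred so that `x₀` corresponds to `(12/5) e`. -/
def rescale (x₀ : Euc n) (Γ : ℝ) (e z : Euc n) : Euc n :=
  (x₀ - Γ⁻¹ • (12 / 5 : ℝ) • e) + Γ⁻¹ • z

lemma rescale_eq : rescale x₀ Γ e z = x₀ + Γ⁻¹ • (z - (12 / 5 : ℝ) • e) := by
  unfold rescale
  module

/-- Height of the centre of the blow-up coordinates over the flat boundary. -/
def height (h0 : 0 < n) (x₀ : Euc n) (Γ : ℝ) (e : Euc n) : ℝ :=
  x₀ (lastIdx n h0) * Γ - 12 / 5 * e (lastIdx n h0)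

lemma rescale_last (hΓ : 0 < Γ) : rescale x₀ Γ e z (lastIdx n h0) =
    Γ⁻¹ * (z (lastIdx n h0) + height h0 x₀ Γ e) := by
  simp only [rescale_eq, height, PiLp.add_apply, PiLp.smul_apply, PiLp.sub_apply, smul_eq_mul]
  field_simp
  ring

lemma norm_rescale_sub_le (hΓ : 0 < Γ) (he : ‖e‖ = 1) (hδ : 12 / 5 ≤ δ * Γ) (hz : ‖z‖ ≤ δ * Γ) :
    ‖rescale x₀ Γ e z - x₀‖ ≤ 2 * δ := by
  have h1 : ‖z - (12 / 5 : ℝ) • e‖ ≤ 2 * δ * Γ := by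
    refine (norm_sub_le _ _).trans ?_
    rw [norm_smul, he, Real.norm_of_nonneg (by norm_num)]
    linarith
  rw [rescale_eq, add_sub_cancel_left, norm_smul, Real.norm_of_nonneg (by positivity)]
  calc Γ⁻¹ * ‖z - (12 / 5 : ℝ) • e‖ ≤ Γ⁻¹ * (2 * δ * Γ) := by gcongr
    _ = 2 * δ := by field_simp

lemma norm_rescale_lt (hx : ‖x₀‖ < 1 / 2) (hΓ : 0 < Γ) (he : ‖e‖ = 1) (hδ : 12 / 5 ≤ δ * Γ)
    (hδ1 : δ ≤ 1 / 20) (hz : ‖z‖ ≤ δ * Γ) : ‖rescale x₀ Γ e z‖ < 2 / 3 := by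
  have h1 := norm_rescale_sub_le (x₀ := x₀) hΓ he hδ hz
  have h2 := norm_le_norm_add_norm_sub' (rescale x₀ Γ e z) x₀
  linarith

lemma rescale_mem_closure (hx : ‖x₀‖ < 1 / 2) (hΓ : 0 < Γ) (he : ‖e‖ = 1)
    (hδ : 12 / 5 ≤ δ * Γ) (hδ1 : δ ≤ 1 / 20) {r : ℝ} (hr : 2 / 3 ≤ r)
    (hz : z ∈ dom (lastIdx n h0) (height h0 x₀ Γ e) (δ * Γ)) :
    rescale x₀ Γ e z ∈ closure (halfBall n h0 r) := by
  refine mem_closure_halfBall ((norm_rescale_lt hx hΓ he hδ hδ1 hz.1).trans_le hr) ?_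
  rw [rescale_last hΓ]
  have := hz.2
  exact mul_nonneg (by positivity) (by linarith)

lemma rescale_mem_halfBall (hΓ : 0 < Γ) {r : ℝ} (hzn : ‖rescale x₀ Γ e z‖ < r)
    (hz : -height h0 x₀ Γ e < z (lastIdx n h0)) : rescale x₀ Γ e z ∈ halfBall n h0 r := by
  refine ⟨mem_ball_zero_iff.2 hzn, ?_⟩
  simp only [upperHalf, mem_ofPred_eq]
  rw [rescale_last hΓ]
  exact mul_pos (by positivity) (by linarith)

lemma closure_halfBall_mem_nhds {r : ℝ} {y : Euc n} (hy : y ∈ halfBall n h0 r) :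
    closure (halfBall n h0 r) ∈ 𝓝 y :=
  mem_of_superset (isOpen_halfBall.mem_nhds hy) subset_closure

lemma IsYamabeSol.contDiffAt_rescale (hu : IsYamabeSol n h0 k c u)
    (hz : rescale x₀ Γ e z ∈ halfBall n h0 1) :
    ContDiffAt ℝ 2 (fun z => u (rescale x₀ Γ e z) / M) z := by
  have h1 : ContDiffAt ℝ 2 u (rescale x₀ Γ e z) :=
    (hu.1 _ (subset_closure hz)).contDiffAt (closure_halfBall_mem_nhds hz)
  refine ContDiffAt.div_const ?_ _
  refine ContDiffAt.comp (g := u) (f := rescale x₀ Γ e) z h1 ?_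
  unfold rescale
  fun_prop

lemma rpow_scale_sq (hn : 4 ≤ n) (hμ : μ = ((n : ℝ) - 2) / 2) (hM : 0 < M)
    (hΓ : Γ = M ^ ((2 : ℝ) / ((n : ℝ) - 2))) : Γ ^ 2 * M = M ^ ((μ + 2) / μ) := by
  have hn4 : (4 : ℝ) ≤ n := by exact_mod_cast hn
  have : (μ + 2) / μ = 2 / ((n : ℝ) - 2) * (2 : ℕ) + 1 := by
    rw [hμ, div_eq_iff (by linarith)]
    have : (n : ℝ) - 2 ≠ 0 := by linarith
    field_simp
    push_cast
    ring
  rw [this, Real.rpow_add hM, Real.rpow_one, Real.rpow_mul hM.le, ← hΓ, Real.rpow_natCast]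

lemma rpow_scale (hn : 4 ≤ n) (hμ : μ = ((n : ℝ) - 2) / 2) (hM : 0 < M)
    (hΓ : Γ = M ^ ((2 : ℝ) / ((n : ℝ) - 2))) : Γ * M = M ^ ((μ + 1) / μ) := by
  have hn4 : (4 : ℝ) ≤ n := by exact_mod_cast hn
  have : (μ + 1) / μ = 2 / ((n : ℝ) - 2) + 1 := by
    rw [hμ, div_eq_iff (by linarith)]
    have : (n : ℝ) - 2 ≠ 0 := by linarith
    field_simp
    ring
  rw [this, Real.rpow_add hM, Real.rpow_one, ← hΓ]

lemma rpow_scale_neg (hn : 4 ≤ n) (hμ : μ = ((n : ℝ) - 2) / 2) (hM : 0 < M)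
    (hΓ : Γ = M ^ ((2 : ℝ) / ((n : ℝ) - 2))) : (Γ ^ 2) ^ (-μ) = (M ^ 2)⁻¹ := by
  have hn4 : (4 : ℝ) ≤ n := by exact_mod_cast hn
  have h : 2 / ((n : ℝ) - 2) * (2 : ℕ) * μ = (2 : ℕ) := by
    have : (n : ℝ) - 2 ≠ 0 := by linarith
    rw [hμ]
    field_simp
  rw [← Real.rpow_natCast Γ, hΓ, ← Real.rpow_mul hM.le, ← Real.rpow_mul hM.le, mul_neg, h,
    Real.rpow_neg hM.le, Real.rpow_natCast]

lemma IsYamabeSol.lap_rescale (hu : IsYamabeSol n h0 k c u) (hn : 4 ≤ n)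
    (hμ : μ = ((n : ℝ) - 2) / 2) (hM : 0 < M) (hΓ : Γ = M ^ ((2 : ℝ) / ((n : ℝ) - 2)))
    (hz : rescale x₀ Γ e z ∈ halfBall n h0 1) :
    ∃ g, HasLap (fun z => u (rescale x₀ Γ e z) / M) z g
      (-(k (rescale x₀ Γ e z) * (u (rescale x₀ Γ e z) / M) ^ ((μ + 2) / μ))) := by
  have hΓ0 : 0 < Γ := hΓ ▸ Real.rpow_pos_of_pos hM _
  have hzc := subset_closure hz
  have h1 : ContDiffAt ℝ 2 u (rescale x₀ Γ e z) :=
    (hu.1 _ hzc).contDiffAt (closure_halfBall_mem_nhds hz)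
  have h2 := ((HasLap.of_contDiffAt h1).comp_affine.const_mul M⁻¹)
  have h3 := hu.2.2.1 _ hz
  rw [lapWithin_eq_of_mem_nhds (closure_halfBall_mem_nhds hz)] at h3
  have hp : ((n : ℝ) + 2) / (n - 2) = (μ + 2) / μ := by
    have hn4 : (4 : ℝ) ≤ n := by exact_mod_cast hn
    have h5 : (n : ℝ) - 2 ≠ 0 := by linarith
    rw [hμ]
    field_simp
    ring
  have hup := hu.2.1 _ hzc
  have hMp := rpow_scale_sq hn hμ hM hΓ
  simp only [div_eq_inv_mul (u _)]
  refine ⟨_, h2.congr rfl ?_⟩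
  rw [← div_eq_inv_mul (u _), Real.div_rpow hup.le hM.le, ← hMp, ← hp, eq_neg_of_add_eq_zero_left h3]
  field_simp

lemma IsYamabeSol.flat_rescale (hu : IsYamabeSol n h0 k c u) (hn : 4 ≤ n)
    (hμ : μ = ((n : ℝ) - 2) / 2) (hM : 0 < M) (hΓ : Γ = M ^ ((2 : ℝ) / ((n : ℝ) - 2)))
    (hzn : ‖rescale x₀ Γ e z‖ < 1) (hz : z (lastIdx n h0) = -height h0 x₀ Γ e) :
    HasDerivWithinAt (fun t : ℝ => u (rescale x₀ Γ e
        (z + t • EuclideanSpace.single (lastIdx n h0) 1)) / M)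
      (c (rescale x₀ Γ e z) * (u (rescale x₀ Γ e z) / M) ^ ((μ + 1) / μ)) (Ici 0) 0 := by
  have hΓ0 : 0 < Γ := hΓ ▸ Real.rpow_pos_of_pos hM _
  have hlast : rescale x₀ Γ e z (lastIdx n h0) = 0 := by
    rw [rescale_last hΓ0, hz]
    simp
  have hmem : rescale x₀ Γ e z ∈ closure (halfBall n h0 1) := mem_closure_halfBall hzn hlast.ge
  have hflat := hu.2.2.2 _ ⟨mem_ball_zero_iff.2 hzn, hlast⟩
  have hd := ((hu.1 _ hmem).differentiableWithinAt (by simp)).hasFDerivWithinAt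
  have hline : HasDerivAt (fun t : ℝ => rescale x₀ Γ e
      (z + t • EuclideanSpace.single (lastIdx n h0) 1))
      (Γ⁻¹ • EuclideanSpace.single (lastIdx n h0) 1) 0 := by
    unfold rescale
    simpa using ((((hasDerivAt_id (0 : ℝ)).smul_const
      (EuclideanSpace.single (lastIdx n h0) (1 : ℝ))).const_add z).const_smul Γ⁻¹).const_add
        (x₀ - Γ⁻¹ • (12 / 5 : ℝ) • e)
  have hnear : ∀ᶠ t in 𝓝[≥] (0 : ℝ), rescale x₀ Γ e
      (z + t • EuclideanSpace.single (lastIdx n h0) 1) ∈ closure (halfBall n h0 1) := by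
    have hc := (hline.continuousAt.norm.tendsto.eventually_lt_const (u := 1)
      (by simpa using hzn)).filter_mono (nhdsWithin_le_nhds (s := Ici 0))
    filter_upwards [hc, self_mem_nhdsWithin] with t ht ht0
    refine mem_closure_halfBall ht ?_
    rw [rescale_last hΓ0]
    have : (0 : ℝ) ≤ t := ht0
    simp only [PiLp.add_apply, PiLp.smul_apply, smul_eq_mul, PiLp.single_apply, if_true, hz]
    have : 0 < Γ⁻¹ := by positivity
    nlinarith
  have hcomp := (HasFDerivWithinAt.comp_hasDerivWithinAt_of_eq (0 : ℝ) hd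
    (hline.hasDerivWithinAt (s := {t | rescale x₀ Γ e
      (z + t • EuclideanSpace.single (lastIdx n h0) 1) ∈ closure (halfBall n h0 1)}))
    (fun t ht => ht) (by simp)).mono_of_mem_nhdsWithin hnear
  have hq : (n : ℝ) / (n - 2) = (μ + 1) / μ := by
    have hn4 : (4 : ℝ) ≤ n := by exact_mod_cast hn
    have h5 : (n : ℝ) - 2 ≠ 0 := by linarith
    rw [hμ]
    field_simp
    ring
  have hup := hu.2.1 _ hmem
  rw [normalDerivWithin, hq] at hflat
  refine (hcomp.div_const M).congr_deriv ?_
  rw [map_smul, hflat, Real.div_rpow hup.le hM.le, ← rpow_scale hn hμ hM hΓ, smul_eq_mul]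
  field_simp

end Rescale

section Blowup

variable {n : ℕ} {h0 : 0 < n} {x₀ g : Euc n} {Γ δ Λ M μ η : ℝ} {u k c : Euc n → ℝ}

lemma bubBase_eq_norm_sub {e : Euc n} (he : ‖e‖ = 1) (z : Euc n) :
    bubBase (13 / 5) e z = 1 + ‖z - (12 / 5 : ℝ) • e‖ ^ 2 := by
  rw [bubBase, norm_sub_sq_real, inner_smul_right, norm_smul, he, real_inner_comm,
    Real.norm_of_nonneg (by norm_num)]
  ring

lemma height_le {e : Euc n} (he : ‖e‖ = 1) :
    x₀ (lastIdx n h0) * Γ - 12 / 5 ≤ height h0 x₀ Γ e := by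
  have := (le_abs_self _).trans ((PiLp.norm_apply_le e (lastIdx n h0)).trans he.le)
  unfold height
  linarith

lemma Setup.of_solution (hn : 4 ≤ n) (hμ : μ = ((n : ℝ) - 2) / 2) (hη : 0 < η) (hΛ : 0 ≤ Λ)
    (hu : IsYamabeSol n h0 k c u) (hc : ∀ z ∈ flatBdry n h0 1, |c z| ≤ Λ)
    (hk : ContDiffOn ℝ 2 k (closure (halfBall n h0 1)))
    (hk1 : ∀ y ∈ closure (halfBall n h0 1), ‖fderivWithin ℝ k (closure (halfBall n h0 1)) y‖ ≤ Λ)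
    (hk2 : ∀ y ∈ closure (halfBall n h0 1),
      ‖iteratedFDerivWithin ℝ 2 k (closure (halfBall n h0 1)) y‖ ≤ Λ)
    (hx : ‖x₀‖ < 1 / 2) (hx0 : 0 ≤ x₀ (lastIdx n h0))
    (hM : 0 < M) (hΓ : Γ = M ^ ((2 : ℝ) / ((n : ℝ) - 2)))
    (hδ : 12 / 5 ≤ δ * Γ) (hδ1 : δ ≤ 1 / 20)
    (hg : fderivWithin ℝ k (closure (halfBall n h0 1)) x₀ = innerSL ℝ g) (hg0 : g ≠ 0)
    (hT : η⁻¹ ≤ x₀ (lastIdx n h0) * Γ - 12 / 5)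
    (hΛT : Λ ≤ η * (x₀ (lastIdx n h0) * Γ - 12 / 5)) (hρ : η⁻¹ ≤ δ * Γ) (hgη : ‖g‖ / Γ ≤ η)
    (hδg : Λ * (2 * δ) ≤ η * ‖g‖) (hδη : Λ * (2 * δ) ≤ η / 2)
    (hk0 : |k x₀ - n * (n - 2)| ≤ η / 2)
    (hout : ∀ y ∈ closure (halfBall n h0 (2 / 3)), η⁻¹ * (δ ^ 2) ^ (-μ) ≤ M * u y)
    (hclose : ∀ y : Euc n, ‖y‖ ≤ η⁻¹ + 3 →
      |u (x₀ + Γ⁻¹ • y) / M - (1 + ‖y‖ ^ 2) ^ (-μ)| ≤ η)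
    (hlip : ∀ y y' : Euc n, ‖y‖ ≤ η⁻¹ + 3 → ‖y'‖ ≤ η⁻¹ + 3 →
      |(u (x₀ + Γ⁻¹ • y) / M - (1 + ‖y‖ ^ 2) ^ (-μ)) -
        (u (x₀ + Γ⁻¹ • y') / M - (1 + ‖y'‖ ^ 2) ^ (-μ))| ≤ η * ‖y - y'‖) :
    Setup (lastIdx n h0) μ η (height h0 x₀ Γ (‖g‖⁻¹ • g)) (δ * Γ) (‖g‖ / Γ) (‖g‖⁻¹ • g)
      (fun z => u (rescale x₀ Γ (‖g‖⁻¹ • g) z) / M) (fun z => k (rescale x₀ Γ (‖g‖⁻¹ • g) z)) := by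
  set e := ‖g‖⁻¹ • g with he_def
  have hgn : 0 < ‖g‖ := norm_pos_iff.2 hg0
  have he : ‖e‖ = 1 := by
    rw [he_def, norm_smul, norm_inv, norm_norm, inv_mul_cancel₀ hgn.ne']
  have hΓ0 : 0 < Γ := hΓ ▸ Real.rpow_pos_of_pos hM _
  have hH := height_le (h0 := h0) (x₀ := x₀) (Γ := Γ) he
  have hδ0 : 0 < δ := pos_of_mul_pos_left (by linarith) hΓ0.le
  have hx1 : x₀ ∈ closure (halfBall n h0 1) := mem_closure_halfBall (by linarith) hx0
  have hmem : ∀ z ∈ dom (lastIdx n h0) (height h0 x₀ Γ e) (δ * Γ),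
      rescale x₀ Γ e z ∈ closure (halfBall n h0 1) := fun z hz =>
    rescale_mem_closure hx hΓ0 he hδ hδ1 (by norm_num) hz
  have hint : ∀ z : Euc n, ‖z‖ < δ * Γ → -height h0 x₀ Γ e < z (lastIdx n h0) →
      rescale x₀ Γ e z ∈ halfBall n h0 1 := fun z hz hz' => rescale_mem_halfBall hΓ0
    ((norm_rescale_lt hx hΓ0 he hδ hδ1 hz.le).trans (by norm_num)) hz'
  have hshift : ∀ z : Euc n, ‖z‖ ≤ η⁻¹ → ‖z - (12 / 5 : ℝ) • e‖ ≤ η⁻¹ + 3 := fun z hz => by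
    refine (norm_sub_le _ _).trans ?_
    rw [norm_smul, he, Real.norm_of_nonneg (by norm_num)]
    linarith
  refine ⟨hn, hμ, hη, hT.trans hH, hρ, by positivity, hgη, he, ?_, ?_, ?_, ?_, ?_, ?_, ?_, ?_,
    ?_, ?_⟩
  · refine ContinuousOn.div_const ?_ _
    refine hu.1.continuousOn.comp (f := rescale x₀ Γ e) ?_ hmem
    unfold rescale
    fun_prop
  · exact fun z hz => div_pos (hu.2.1 _ (hmem z hz)) hM
  · exact fun z h1 h2 => hu.contDiffAt_rescale (hint z h1 h2)
  · exact fun z h1 h2 => hu.lap_rescale hn hμ hM hΓ (hint z h1 h2)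
  · intro z h1 h2
    have h3 := (norm_rescale_lt hx hΓ0 he hδ hδ1 h1.le).trans (show (2 / 3 : ℝ) < 1 by norm_num)
    refine ⟨_, ?_, hu.flat_rescale hn hμ hM hΓ h3 h2⟩
    have h4 : rescale x₀ Γ e z (lastIdx n h0) = 0 := by
      rw [rescale_last hΓ0, h2]
      simp
    have h5 := hu.2.1 _ (hmem z ⟨h1.le, h2.ge⟩)
    have h6 := hc _ ⟨mem_ball_zero_iff.2 h3, h4⟩
    gcongr
    exact (le_abs_self _).trans (h6.trans (hΛT.trans (by gcongr)))
  · intro z hz _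
    have h1 := hout _ (rescale_mem_closure hx hΓ0 he hδ hδ1 le_rfl hz)
    rw [mul_pow, Real.mul_rpow (by positivity) (by positivity), rpow_scale_neg hn hμ hM hΓ,
      ← mul_assoc, ← div_eq_mul_inv, div_le_div_iff₀ (by positivity) hM]
    nlinarith
  · intro z hz
    have := hclose _ (hshift z hz)
    rwa [← rescale_eq, ← bubBase_eq_norm_sub he] at this
  · intro z z' hz hz'
    have := hlip _ _ (hshift z hz) (hshift z' hz')
    rwa [← rescale_eq, ← rescale_eq, ← bubBase_eq_norm_sub he, ← bubBase_eq_norm_sub he,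
      sub_sub_sub_cancel_right] at this
  · intro z hz
    have h1 := convex_closure_halfBall.norm_image_sub_le_of_norm_fderivWithin_le (𝕜 := ℝ)
      (hk.differentiableOn (by simp)) hk1 hx1 (hmem z hz)
    have h2 := norm_rescale_sub_le (x₀ := x₀) hΓ0 he hδ hz.1
    have h3 : |k (rescale x₀ Γ e z) - k x₀| ≤ η / 2 :=
      h1.trans ((mul_le_mul_of_nonneg_left h2 hΛ).trans hδη)
    have := abs_sub_le (k (rescale x₀ Γ e z)) (k x₀) (n * (n - 2))
    linarith
  · intro z hz z' hz'
    have h1 := abs_sub_sub_fderivWithin_le convex_closure_halfBall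
      (uniqueDiffOn_closure_halfBall one_pos) hk hΛ hk2 hx1 (hmem z hz) (hmem z' hz')
      (norm_rescale_sub_le hΓ0 he hδ hz.1) (norm_rescale_sub_le hΓ0 he hδ hz'.1)
    have h2 : rescale x₀ Γ e z - rescale x₀ Γ e z' = Γ⁻¹ • (z - z') := by
      unfold rescale
      module
    have h3 : ‖g‖ / Γ * ⟪e, z - z'⟫ = innerSL ℝ g (Γ⁻¹ • (z - z')) := by
      rw [innerSL_apply_apply, inner_smul_right, he_def, inner_smul_left, conj_trivial]
      field_simp
    rw [hg, h2, norm_smul, Real.norm_of_nonneg (by positivity), ← h3] at h1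
    refine h1.trans ?_
    calc Λ * (2 * δ) * (Γ⁻¹ * ‖z - z'‖) ≤ η * ‖g‖ * (Γ⁻¹ * ‖z - z'‖) := by gcongr
      _ = η * (‖g‖ / Γ) * ‖z - z'‖ := by ring

end Blowup

lemma TendstoC2LocOn.eventually_close {n : ℕ} {v : ℕ → Euc n → ℝ} {U : Euc n → ℝ}
    (hconv : TendstoC2LocOn n v U univ) (hU : Differentiable ℝ U) {R η : ℝ} (hη : 0 < η)
    (hv : ∀ᶠ i in atTop, ∀ y, ‖y‖ ≤ R → DifferentiableAt ℝ (v i) y) :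
    ∀ᶠ i in atTop, (∀ y, ‖y‖ ≤ R → |v i y - U y| ≤ η) ∧ ∀ y y', ‖y‖ ≤ R → ‖y'‖ ≤ R →
      |(v i y - U y) - (v i y' - U y')| ≤ η * ‖y - y'‖ := by
  obtain ⟨h1, h2, -⟩ := hconv (closedBall 0 R) (isCompact_closedBall _ _) (subset_univ _)
  filter_upwards [hv, Metric.tendstoUniformlyOn_iff.1 h1 η hη,
    Metric.tendstoUniformlyOn_iff.1 h2 η hη] with i hd k1 k2
  refine ⟨fun y hy => ?_, fun y y' hy hy' => ?_⟩
  · have := k1 y (mem_closedBall_zero_iff.2 hy)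
    rw [dist_comm, Real.dist_eq] at this
    exact this.le
  · refine (convex_closedBall (0 : Euc n) R).norm_image_sub_le_of_norm_fderiv_le (𝕜 := ℝ)
      (f := fun y => v i y - U y) (fun w hw => ?_) (fun w hw => ?_) (mem_closedBall_zero_iff.2 hy')
      (mem_closedBall_zero_iff.2 hy)
    · exact (hd w (mem_closedBall_zero_iff.1 hw)).sub (hU w)
    · have := k2 w hw
      rw [fderivWithin_univ, fderivWithin_univ, dist_comm, dist_eq_norm] at this
      rw [fderiv_fun_sub (hd w (mem_closedBall_zero_iff.1 hw)) (hU w)]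
      exact this.le

lemma differentiable_bubble {n : ℕ} (μ : ℝ) :
    Differentiable ℝ fun y : Euc n => (1 + ‖y‖ ^ 2) ^ (-μ) := by
  have h : Differentiable ℝ fun y : Euc n => 1 + ‖y‖ ^ 2 :=
    (differentiable_const _).add (differentiable_id.norm_sq ℝ)
  exact fun y => (h y).rpow_const (.inl (by positivity))

/-- in the blow-up framework with `T_i → ∞`, the gradient of `K_i`
at the blow-up points vanishes along a subsequence. -/
theorem gradK_vanishes_Ti_unbounded (n : ℕ) (hn : 4 ≤ n) (h0 : 0 < n)
    (C₀ Λ : ℝ) (hC₀ : 0 < C₀) (hΛ : 0 < Λ)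
    (K : ℕ → Euc n → ℝ) (c : ℕ → Euc n → ℝ) (u : ℕ → Euc n → ℝ)
    (x : ℕ → Euc n) (σ : ℕ → ℝ) (M Γ : ℕ → ℝ) (v : ℕ → Euc n → ℝ) (U : Euc n → ℝ)
    (hK1 : ∀ i, CondK1 n h0 C₀ (K i))
    (hK2 : ∀ i, CondK2 n h0 Λ (K i))
    (hK3 : ∀ i, CondK3 n h0 (K i))
    (hKx : Filter.Tendsto (fun i => K i (x i)) Filter.atTop (nhds ((n : ℝ) * ((n : ℝ) - 2))))
    (hc : ∀ i, ∀ z ∈ flatBdry n h0 1, |c i z| ≤ Λ)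
    (hsol : ∀ i, IsYamabeSol n h0 (K i) (c i) (u i))
    (hx : ∀ i, x i ∈ closure (upperHalf n h0) ∩ Metric.ball (0 : Euc n) (1/2))
    (hM : ∀ i, M i = u i (x i))
    (hΓ : ∀ i, Γ i = M i ^ ((2 : ℝ) / ((n : ℝ) - 2)))
    (hmax : ∀ i, sSup (u i '' closure (halfBall n h0 (1/3))) ≤ M i)
    (hσ0 : Filter.Tendsto σ Filter.atTop (nhds 0))
    (hloc : ∀ i, ∀ z ∈ Metric.ball (x i) (σ i) ∩ upperHalf n h0, u i z ≤ M i)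
    (hσGamma : Filter.Tendsto (fun i => Γ i * σ i) Filter.atTop Filter.atTop)
    (hblow : ∀ i : ℕ, (i : ℝ) < M i * sInf (u i '' closure (halfBall n h0 (2/3))))
    (hT : Filter.Tendsto (fun i => x i (lastIdx n h0) * Γ i) Filter.atTop Filter.atTop)
    (hv : ∀ i y, v i y = u i (x i + (Γ i)⁻¹ • y) / M i)
    (hU : ∀ y : Euc n, U y = (1 + ‖y‖ ^ 2) ^ (-(((n : ℝ) - 2) / 2)))
    (hconv : TendstoC2LocOn n v U Set.univ) :
    ∃ φ : ℕ → ℕ, StrictMono φ ∧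
      Filter.Tendsto
        (fun k => ‖iteratedFDerivWithin ℝ 1 (K (φ k)) (closure (halfBall n h0 1)) (x (φ k))‖)
        Filter.atTop (nhds 0) := by
  have hn4 : (4 : ℝ) ≤ n := by exact_mod_cast hn
  set μ := ((n : ℝ) - 2) / 2 with hμ
  set D := closure (halfBall n h0 1) with hD
  have hx0 : ∀ i, 0 ≤ x i (lastIdx n h0) := fun i => nonneg_of_mem_closure_upperHalf (hx i).1
  have hx1 : ∀ i, ‖x i‖ < 1 / 2 := fun i => mem_ball_zero_iff.1 (hx i).2
  have hxD : ∀ i, x i ∈ D := fun i => mem_closure_halfBall (by linarith [hx1 i]) (hx0 i)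
  have hMpos : ∀ i, 0 < M i := fun i => hM i ▸ (hsol i).2.1 _ (hxD i)
  have hΓpos : ∀ i, 0 < Γ i := fun i => hΓ i ▸ Real.rpow_pos_of_pos (hMpos i) _
  have huD : UniqueDiffOn ℝ D := uniqueDiffOn_closure_halfBall one_pos
  have hKc : ∀ i, ContDiffOn ℝ 2 (K i) D := fun i =>
    (hK1 i).1.of_le (by exact_mod_cast (by omega : 2 ≤ n - 2))
  have hKd : ∀ i, ∀ y ∈ D, ‖fderivWithin ℝ (K i) D y‖ ≤ Λ := fun i y hy => by
    rw [← norm_iteratedFDerivWithin_one _ (huD y hy)]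
    exact (hK2 i y hy).2 1 le_rfl (by omega)
  have hΓtop : Tendsto Γ atTop atTop := by
    refine tendsto_atTop_mono (fun i => ?_) hT
    have h1 := (le_abs_self _).trans (PiLp.norm_apply_le (x i) (lastIdx n h0))
    nlinarith [hx1 i, hΓpos i]
  suffices hfreq : ∀ m : ℕ, ∃ᶠ i in atTop,
      ‖iteratedFDerivWithin ℝ 1 (K i) D (x i)‖ < 1 / ((m : ℝ) + 1) by
    obtain ⟨φ, hφ, hφ'⟩ := Filter.extraction_forall_of_frequently hfreq
    exact ⟨φ, hφ, squeeze_zero (fun _ => norm_nonneg _) (fun m => (hφ' m).le)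
      tendsto_one_div_add_atTop_nhds_zero_nat⟩
  intro m
  by_contra hcon
  rw [Filter.not_frequently] at hcon
  set ε := 1 / ((m : ℝ) + 1) with hε
  have hε0 : 0 < ε := by positivity
  obtain ⟨η, hη0, hnot⟩ := (eventually_mem_nhdsWithin.and (eventually_not_setup hn hμ)).exists
  have hη : 0 < η := hη0
  set δ := min (1 / 20) (min (η * ε / (2 * Λ)) (η / 2 / (2 * Λ))) with hδ
  have hδ0 : 0 < δ := by positivity
  have hδ1 : δ ≤ 1 / 20 := min_le_left _ _
  have hδ2 : Λ * (2 * δ) ≤ η * ε := by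
    have := (le_div_iff₀ (by positivity)).1
      ((min_le_right (1 / 20) _).trans (min_le_left _ _) : δ ≤ η * ε / (2 * Λ))
    linarith
  have hδ3 : Λ * (2 * δ) ≤ η / 2 := by
    have := (le_div_iff₀ (by positivity)).1
      ((min_le_right (1 / 20) _).trans (min_le_right _ _) : δ ≤ η / 2 / (2 * Λ))
    linarith
  have hdiff : ∀ᶠ i in atTop, ∀ y, ‖y‖ ≤ η⁻¹ + 3 → DifferentiableAt ℝ (v i) y := by
    filter_upwards [hT.eventually_gt_atTop (η⁻¹ + 3),
      hΓtop.eventually_gt_atTop (2 * (η⁻¹ + 3))] with i k1 k2 y hy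
    have hin : x i + (Γ i)⁻¹ • y ∈ halfBall n h0 1 := by
      have k3 : ‖(Γ i)⁻¹ • y‖ < 1 / 2 := by
        rw [norm_smul, Real.norm_of_nonneg (inv_nonneg.2 (hΓpos i).le), inv_mul_lt_iff₀ (hΓpos i)]
        linarith
      refine ⟨mem_ball_zero_iff.2 ((norm_add_le _ _).trans_lt (by linarith [hx1 i])), ?_⟩
      have k4 := neg_le_of_abs_le (PiLp.norm_apply_le y (lastIdx n h0))
      have k5 : 0 < (Γ i)⁻¹ * (x i (lastIdx n h0) * Γ i + y (lastIdx n h0)) :=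
        mul_pos (inv_pos.2 (hΓpos i)) (by linarith)
      rw [mul_add, mul_comm (x i _), inv_mul_cancel_left₀ (hΓpos i).ne'] at k5
      simpa [upperHalf] using k5
    have h1 : DifferentiableAt ℝ (u i) (x i + (Γ i)⁻¹ • y) :=
      (((hsol i).1 _ (subset_closure hin)).contDiffAt
        (closure_halfBall_mem_nhds hin)).differentiableAt (by simp)
    have h2 : v i = fun y => u i (x i + (Γ i)⁻¹ • y) / M i := funext (hv i)
    rw [h2]
    have h3 : DifferentiableAt ℝ (fun y => u i (x i + (Γ i)⁻¹ • y)) y :=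
      h1.comp (f := fun y => x i + (Γ i)⁻¹ • y) y (by fun_prop)
    simpa only [div_eq_mul_inv] using h3.mul_const (M i)⁻¹
  have hUeq : U = fun y => (1 + ‖y‖ ^ 2) ^ (-μ) := funext hU
  have hclose := hconv.eventually_close (hUeq ▸ differentiable_bubble μ) hη hdiff
  have hHtop : Tendsto (fun i => x i (lastIdx n h0) * Γ i - 12 / 5) atTop atTop :=
    tendsto_atTop_add_const_right _ _ hT
  have hKx' : ∀ᶠ i in atTop, |K i (x i) - n * (n - 2)| ≤ η / 2 := by
    filter_upwards [Metric.tendsto_nhds.1 hKx (η / 2) (by positivity)] with i hi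
    exact hi.le
  have hcast : Tendsto (fun i : ℕ => (i : ℝ)) atTop atTop := tendsto_natCast_atTop_atTop
  have hevent := hcon.and <| hclose.and <| hKx'.and <| (hHtop.eventually_ge_atTop η⁻¹).and <|
    (hHtop.eventually_ge_atTop (Λ / η)).and <| (hΓtop.eventually_ge_atTop (12 / 5 / δ)).and <|
    (hΓtop.eventually_ge_atTop (η⁻¹ / δ)).and <| (hΓtop.eventually_ge_atTop (Λ / η)).and <|
    hcast.eventually_ge_atTop (η⁻¹ * (δ ^ 2) ^ (-μ))
  obtain ⟨i, k1, ⟨k2, k3⟩, k4, k5, k6, k7, k8, k9, k10⟩ := hevent.exists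
  set g := (InnerProductSpace.toDual ℝ (Euc n)).symm (fderivWithin ℝ (K i) D (x i)) with hg
  have hgn : ‖g‖ = ‖fderivWithin ℝ (K i) D (x i)‖ := by rw [hg, LinearIsometryEquiv.norm_map]
  have hgε : ε ≤ ‖g‖ := by
    rw [hgn, ← norm_iteratedFDerivWithin_one _ (huD _ (hxD i))]
    exact not_lt.1 k1
  have hgΛ : ‖g‖ ≤ Λ := hgn.trans_le (hKd i _ (hxD i))
  simp only [hv, hU] at k2 k3
  refine hnot _ _ _ _ _ _ _ (Setup.of_solution hn hμ hη hΛ.le (hsol i) (hc i) (hKc i) (hKd i)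
    (fun y hy => (hK2 i y hy).2 2 (by norm_num) (by omega)) (hx1 i) (hx0 i) (hMpos i) (hΓ i)
    (δ := δ) (g := g) ?_ hδ1 ?_ (norm_pos_iff.1 (hε0.trans_le hgε)) k5 ?_ ?_ ?_ ?_ hδ3 k4 ?_ k2 k3)
  · rwa [div_le_iff₀' hδ0] at k7
  · exact ((InnerProductSpace.toDual ℝ (Euc n)).apply_symm_apply _).symm
  · rwa [div_le_iff₀' hη] at k6
  · rwa [div_le_iff₀' hδ0] at k8
  · rw [div_le_iff₀' hη] at k9
    rw [div_le_iff₀ (hΓpos i)]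
    linarith
  · exact hδ2.trans (by gcongr)
  · intro y hy
    have hsub : closure (halfBall n h0 (2 / 3)) ⊆ D :=
      closure_mono (inter_subset_inter_left _ (ball_subset_ball (by norm_num)))
    have hbdd : BddBelow (u i '' closure (halfBall n h0 (2 / 3))) :=
      ⟨0, by rintro _ ⟨w, hw, rfl⟩; exact ((hsol i).2.1 w (hsub hw)).le⟩
    have h1 := csInf_le hbdd (mem_image_of_mem _ hy)
    have h2 := mul_le_mul_of_nonneg_left h1 (hMpos i).le
    linarith [hblow i]
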